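/- Tverberg theorem for simplicial spheres: Let d ≥ 1, let r be a prime power, and let S be a finite simplicial complex in ℝ^N whose realization |S| is homeomorphic to the sphere of dimension (d+1)(r−1)−1. Then for every continuous map f : |S| → ℝ^d there exist r pairwise disjoint faces σ_1, …, σ_r of S such that f(σ_1) ∩ ⋯ ∩ f(σ_r) ≠ ∅. -/

import Mathlib

open Geometry


namespace Tvb

set_option linter.unusedSectionVars false

/-! ### Chains on lists -/

section chains

variable {k : Type*} [Field k] {Ω Ω' Ω'' : Type*}

/-- Chains of lists (ordered simplices, possibly degenerate; the empty list is the augmentation). -/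
abbrev Ch (k : Type*) [Field k] (Ω : Type*) := List Ω →₀ k

/-- cone operator -/
noncomputable def cone (x : Ω) : Ch k Ω →ₗ[k] Ch k Ω := Finsupp.lmapDomain k k (List.cons x)

/-- boundary of a list -/
noncomputable def bdL (k : Type*) [Field k] {Ω : Type*} : List Ω → Ch k Ω
  | [] => 0
  | x :: l => Finsupp.single l 1 - cone x (bdL k l)

/-- boundary -/
noncomputable def bd : Ch k Ω →ₗ[k] Ch k Ω := Finsupp.linearCombination k (bdL k)

/-- induced map -/
noncomputable def mp (φ : Ω → Ω') : Ch k Ω →ₗ[k] Ch k Ω' := Finsupp.lmapDomain k k (List.map φ)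

@[simp] lemma cone_single (x : Ω) (l : List Ω) (a : k) :
    cone x (Finsupp.single l a) = Finsupp.single (x :: l) a := by
  simp [cone]

@[simp] lemma mp_single (φ : Ω → Ω') (l : List Ω) (a : k) :
    mp φ (Finsupp.single l a) = Finsupp.single (l.map φ) a := by
  simp [mp]

lemma bd_single (l : List Ω) : bd (Finsupp.single l (1 : k)) = bdL k l := by
  simp [bd]

lemma bd_nil : bd (Finsupp.single ([] : List Ω) (1 : k)) = 0 := by
  simp [bd_single, bdL]

lemma ch_ext {M : Type*} [AddCommGroup M] [Module k M] {f g : Ch k Ω →ₗ[k] M}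
    (h : ∀ l, f (Finsupp.single l 1) = g (Finsupp.single l 1)) : f = g := by
  apply Finsupp.lhom_ext'
  intro l
  apply LinearMap.ext_ring
  simpa using h l

lemma bd_cone (x : Ω) (c : Ch k Ω) : bd (cone x c) = c - cone x (bd c) := by
  have : (bd ∘ₗ cone x : Ch k Ω →ₗ[k] Ch k Ω) = LinearMap.id - cone x ∘ₗ bd := by
    apply ch_ext
    intro l
    simp [bd_single, bdL]
  exact congrArg (fun f => f c) this

lemma bd_bd (c : Ch k Ω) : bd (bd c) = 0 := by
  have : (bd ∘ₗ bd : Ch k Ω →ₗ[k] Ch k Ω) = 0 := by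
    apply ch_ext
    intro l
    induction l with
    | nil => simp [bd_single, bdL]
    | cons x l ih =>
      simp only [LinearMap.comp_apply, bd_single, LinearMap.zero_apply] at ih ⊢
      simp only [bdL, map_sub, bd_single, bd_cone, ih]
      simp
  exact congrArg (fun f => f c) this

lemma mp_cone (φ : Ω → Ω') (x : Ω) (c : Ch k Ω) : mp φ (cone x c) = cone (φ x) (mp φ c) := by
  have : (mp φ ∘ₗ cone x : Ch k Ω →ₗ[k] Ch k Ω') = cone (φ x) ∘ₗ mp φ := by
    apply ch_ext
    intro l
    simp
  exact congrArg (fun f => f c) this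

lemma bd_mp (φ : Ω → Ω') (c : Ch k Ω) : bd (mp φ c) = mp φ (bd c) := by
  have : (bd ∘ₗ mp φ : Ch k Ω →ₗ[k] Ch k Ω') = mp φ ∘ₗ bd := by
    apply ch_ext
    intro l
    induction l with
    | nil => simp [bd_single, bdL]
    | cons x l ih =>
      simp only [LinearMap.comp_apply, bd_single, mp_single] at ih ⊢
      simp only [List.map_cons, bdL, map_sub, mp_single, mp_cone, ← ih]
  exact congrArg (fun f => f c) this

lemma mp_mp (φ : Ω → Ω') (ψ : Ω' → Ω'') (c : Ch k Ω) : mp ψ (mp φ c) = mp (ψ ∘ φ) c := by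
  have : (mp ψ ∘ₗ mp φ : Ch k Ω →ₗ[k] Ch k Ω'') = mp (ψ ∘ φ) := by
    apply ch_ext
    intro l
    simp
  exact congrArg (fun f => f c) this

lemma mp_id (c : Ch k Ω) : mp (fun x => x) c = c := by
  have : (mp (fun x => x) : Ch k Ω →ₗ[k] Ch k Ω) = LinearMap.id := by
    apply ch_ext
    intro l
    simp
  exact congrArg (fun f => f c) this

/-- chains supported on lists satisfying `P` -/
noncomputable abbrev sp (k : Type*) [Field k] {Ω : Type*} (P : List Ω → Prop) :
    Submodule k (Ch k Ω) := Finsupp.supported k k {l | P l}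

lemma single_mem_sp {P : List Ω → Prop} {l : List Ω} (h : P l) (a : k) :
    Finsupp.single l a ∈ sp k P := Finsupp.single_mem_supported k a h

lemma sp_mono {P Q : List Ω → Prop} (h : ∀ l, P l → Q l) {c : Ch k Ω} (hc : c ∈ sp k P) :
    c ∈ sp k Q := Finsupp.supported_mono (R := k) (M := k) (s := {l | P l}) (t := {l | Q l}) h hc

/-- induction principle: a linear map sends `sp P` into a submodule if it does so on lists -/
lemma map_sp {M : Type*} [AddCommGroup M] [Module k M] {P : List Ω → Prop}
    {f : Ch k Ω →ₗ[k] M} {N : Submodule k M} (h : ∀ l, P l → f (Finsupp.single l 1) ∈ N)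
    {c : Ch k Ω} (hc : c ∈ sp k P) : f c ∈ N := by
  rw [sp, Finsupp.supported_eq_span_single] at hc
  have : Submodule.span k ((fun i => Finsupp.single i (1 : k)) '' {l | P l}) ≤ N.comap f := by
    rw [Submodule.span_le]
    rintro _ ⟨l, hl, rfl⟩
    exact h l hl
  exact this hc

/-- two linear maps agree on `sp P` if they do on lists -/
lemma eq_on_sp {M : Type*} [AddCommGroup M] [Module k M] {P : List Ω → Prop}
    {f g : Ch k Ω →ₗ[k] M} (h : ∀ l, P l → f (Finsupp.single l 1) = g (Finsupp.single l 1))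
    {c : Ch k Ω} (hc : c ∈ sp k P) : f c = g c := by
  have := map_sp (f := f - g) (N := ⊥) (P := P) (fun l hl => by simp [h l hl]) hc
  simpa [sub_eq_zero] using this

lemma cone_mem {P Q : List Ω → Prop} {x : Ω} (h : ∀ l, P l → Q (x :: l)) {c : Ch k Ω}
    (hc : c ∈ sp k P) : cone x c ∈ sp k Q :=
  map_sp (fun l hl => by rw [cone_single]; exact single_mem_sp (h l hl) 1) hc

lemma mp_mem {P : List Ω → Prop} {Q : List Ω' → Prop} {φ : Ω → Ω'}
    (h : ∀ l, P l → Q (l.map φ)) {c : Ch k Ω}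
    (hc : c ∈ sp k P) : mp φ c ∈ sp k Q :=
  map_sp (fun l hl => by rw [mp_single]; exact single_mem_sp (h l hl) 1) hc

lemma bdL_mem (l : List Ω) :
    bdL k l ∈ sp k (fun l' => l'.Sublist l ∧ l'.length + 1 = l.length) := by
  induction l with
  | nil => simp [bdL]
  | cons x l ih =>
    apply Submodule.sub_mem
    · exact single_mem_sp ⟨List.sublist_cons_self x l, by simp⟩ 1
    · refine cone_mem ?_ ih
      rintro l' ⟨h1, h2⟩
      exact ⟨h1.cons_cons x, by simp [h2]⟩

lemma bd_mem {P Q : List Ω → Prop}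
    (h : ∀ l, P l → ∀ l', l'.Sublist l → l'.length + 1 = l.length → Q l') {c : Ch k Ω}
    (hc : c ∈ sp k P) : bd c ∈ sp k Q :=
  map_sp (fun l hl => by
    rw [bd_single]
    exact sp_mono (fun l' hl' => h l hl l' hl'.1 hl'.2) (bdL_mem l)) hc

lemma bd_len_zero {c : Ch k Ω} (hc : c ∈ sp k (fun l => l.length = 0)) : bd c = 0 := by
  refine eq_on_sp (g := 0) (fun l hl => ?_) hc
  rw [List.length_eq_zero_iff.1 hl]; simp [bd_nil]

end chains

/-! ### Complexes and acyclicity -/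

section complexes

variable {k : Type*} [Field k] {W : Type*} [DecidableEq W]

/-- chains of a complex, on lists of length `j` -/
noncomputable abbrev chn (k : Type*) [Field k] {W : Type*} [DecidableEq W]
    (K : Set (Finset W)) (j : ℕ) : Submodule k (Ch k W) :=
  sp k (fun l => l.length = j ∧ l.toFinset ∈ K)

/-- acyclicity in one degree -/
def Ac (k : Type*) [Field k] {W : Type*} [DecidableEq W] (K : Set (Finset W)) (j : ℕ) : Prop :=
  ∀ c ∈ chn k K j, bd c = 0 → ∃ b ∈ chn k K (j + 1), bd b = c

lemma toFinset_sub {l l' : List W} (h : l'.Sublist l) : l'.toFinset ⊆ l.toFinset := by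
  intro x hx
  rw [List.mem_toFinset] at hx ⊢
  exact h.subset hx

lemma chn_mono {K L : Set (Finset W)} (h : K ⊆ L) {j : ℕ} {c : Ch k W} (hc : c ∈ chn k K j) :
    c ∈ chn k L j := sp_mono (fun _ hl => ⟨hl.1, h hl.2⟩) hc

lemma bd_chn {K : Set (Finset W)} (hK : IsLowerSet K) {j : ℕ} {c : Ch k W}
    (hc : c ∈ chn k K (j + 1)) : bd c ∈ chn k K j :=
  bd_mem (fun l hl l' h1 h2 => ⟨by have := hl.1; omega, hK (toFinset_sub h1) hl.2⟩) hc

lemma chn_inter {K L : Set (Finset W)} {j : ℕ} {c : Ch k W}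
    (h1 : c ∈ chn k K j) (h2 : c ∈ chn k L j) : c ∈ chn k (K ∩ L) j := by
  rw [chn, sp, Finsupp.mem_supported] at *
  intro l hl
  exact ⟨(h1 hl).1, (h1 hl).2, (h2 hl).2⟩

lemma chn_union {K L : Set (Finset W)} {j : ℕ} {c : Ch k W}
    (h : c ∈ chn k (K ∪ L) j) : ∃ a ∈ chn k K j, ∃ b ∈ chn k L j, a + b = c := by
  have h' : c ∈ chn k K j ⊔ chn k L j := by
    rw [chn, chn, sp, sp, ← Finsupp.supported_union]
    refine sp_mono ?_ h
    rintro l ⟨h1, h2 | h2⟩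
    · exact Or.inl ⟨h1, h2⟩
    · exact Or.inr ⟨h1, h2⟩
  exact Submodule.mem_sup.1 h'

lemma Ac_inter {K L : Set (Finset W)} (hK : IsLowerSet K) (hL : IsLowerSet L) {j : ℕ}
    (hU : Ac k (K ∪ L) (j + 1)) (h1 : Ac k K j) (h2 : Ac k L j) : Ac k (K ∩ L) j := by
  intro c hc hz
  obtain ⟨a, ha, hac⟩ := h1 c (chn_mono Set.inter_subset_left hc) hz
  obtain ⟨b, hb, hbc⟩ := h2 c (chn_mono Set.inter_subset_right hc) hz
  obtain ⟨w, hw, hwab⟩ := hU (a - b)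
    (Submodule.sub_mem _ (chn_mono Set.subset_union_left ha) (chn_mono Set.subset_union_right hb))
    (by rw [map_sub, hac, hbc, sub_self])
  obtain ⟨u, hu, v, hv, rfl⟩ := chn_union hw
  rw [map_add] at hwab
  have e : a - bd u = b + bd v := by
    rw [sub_eq_iff_eq_add, add_assoc, add_comm (bd v), hwab]; abel
  refine ⟨a - bd u, chn_inter (Submodule.sub_mem _ ha (bd_chn hK hu)) ?_, ?_⟩
  · rw [e]; exact Submodule.add_mem _ hb (bd_chn hL hv)
  · rw [map_sub, bd_bd, hac, sub_zero]

lemma Ac_union {K L : Set (Finset W)} (hK : IsLowerSet K) (hL : IsLowerSet L) {j : ℕ}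
    (h1 : Ac k K j) (h2 : Ac k L j) (h : ∀ i, i + 1 = j → Ac k (K ∩ L) i) :
    Ac k (K ∪ L) j := by
  intro c hc hz
  obtain ⟨a, ha, b, hb, rfl⟩ := chn_union hc
  obtain ⟨e, he1, he2, hea⟩ : ∃ e, e ∈ chn k K j ∧ e ∈ chn k L j ∧ bd e = bd a := by
    rcases j with _ | i
    · exact ⟨0, Submodule.zero_mem _, Submodule.zero_mem _, by
        rw [map_zero, bd_len_zero (sp_mono (fun l hl => hl.1) ha)]⟩
    · have hab : bd a = - bd b := by rw [map_add] at hz; exact eq_neg_of_add_eq_zero_left hz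
      obtain ⟨e, he, hh⟩ := h i rfl (bd a) (chn_inter (bd_chn hK ha)
        (by rw [hab]; exact Submodule.neg_mem _ (bd_chn hL hb))) (bd_bd a)
      exact ⟨e, chn_mono Set.inter_subset_left he, chn_mono Set.inter_subset_right he, hh⟩
  obtain ⟨u, hu, hua⟩ := h1 (a - e) (Submodule.sub_mem _ ha he1) (by rw [map_sub, hea, sub_self])
  obtain ⟨v, hv, hvb⟩ := h2 (b + e) (Submodule.add_mem _ hb he2)
    (by rw [map_add] at hz ⊢; rw [hea, add_comm, hz])
  refine ⟨u + v, Submodule.add_mem _ (chn_mono Set.subset_union_left hu)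
    (chn_mono Set.subset_union_right hv), ?_⟩
  rw [map_add, hua, hvb]; abel

lemma Ac_cone {K : Set (Finset W)} (v : W) (h : ∀ A ∈ K, insert v A ∈ K) (j : ℕ) : Ac k K j := by
  intro c hc hz
  refine ⟨cone v c, cone_mem ?_ hc, by rw [bd_cone, hz, map_zero, sub_zero]⟩
  rintro l ⟨h1, h2⟩
  exact ⟨by simp [h1], by rw [List.toFinset_cons]; exact h _ h2⟩

lemma Ac_empty (j : ℕ) : Ac k (∅ : Set (Finset W)) j := by
  intro c hc _
  have : c = 0 := by
    have h : c ∈ sp k (fun _ : List W => False) := sp_mono (fun l hl => hl.2) hc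
    have := eq_on_sp (f := LinearMap.id) (g := 0) (fun l hl => hl.elim) h
    simpa using this
  exact ⟨0, Submodule.zero_mem _, by rw [this, map_zero]⟩

/-- boundary of `τ` joined with `L` -/
def bj (τ : Finset W) (L : Set (Finset W)) : Set (Finset W) := {A | A \ τ ∈ L ∧ ¬ τ ⊆ A}

lemma Ac_bj {L : Set (Finset W)} (hL : IsLowerSet L) (τ : Finset W)
    (hd : ∀ A ∈ L, Disjoint A τ) : ∀ j, (∀ i, i + τ.card = j + 1 → Ac k L i) →
    Ac k (bj τ L) j := by
  induction τ using Finset.induction_on with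
  | empty =>
    intro j _
    have : bj ∅ L = ∅ := by ext A; simp [bj]
    rw [this]; exact Ac_empty j
  | insert v τ hv ih =>
    intro j hj
    have hdv : ∀ A ∈ L, v ∉ A := fun A hA => by
      have := hd A hA
      rw [Finset.disjoint_insert_right] at this
      exact this.1
    have hdτ : ∀ A ∈ L, Disjoint A τ := fun A hA => by
      have := hd A hA
      rw [Finset.disjoint_insert_right] at this
      exact this.2
    set P : Set (Finset W) := {A | A \ insert v τ ∈ L ∧ ¬ τ ⊆ A} with hP
    set Q : Set (Finset W) := {A | v ∉ A ∧ A \ τ ∈ L} with hQ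
    have hPl : IsLowerSet P := by
      intro A B hBA hA
      exact ⟨hL (Finset.sdiff_subset_sdiff hBA le_rfl) hA.1, fun h => hA.2 (h.trans hBA)⟩
    have hQl : IsLowerSet Q := by
      intro A B hBA hA
      exact ⟨fun h => hA.1 (hBA h), hL (Finset.sdiff_subset_sdiff hBA le_rfl) hA.2⟩
    have hsd : ∀ A : Finset W, v ∉ A → A \ insert v τ = A \ τ := by
      intro A hA
      ext x
      simp only [Finset.mem_sdiff, Finset.mem_insert, not_or]
      constructor
      · rintro ⟨h1, h2, h3⟩; exact ⟨h1, h3⟩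
      · rintro ⟨h1, h2⟩; exact ⟨h1, fun h => hA (h ▸ h1), h2⟩
    have hun : bj (insert v τ) L = P ∪ Q := by
      ext A
      simp only [bj, hP, hQ, Set.mem_ofPred_eq, Set.mem_union, Finset.insert_subset_iff]
      constructor
      · rintro ⟨h1, h2⟩
        by_cases hvA : v ∈ A
        · exact Or.inl ⟨h1, fun h => h2 ⟨hvA, h⟩⟩
        · exact Or.inr ⟨hvA, by rwa [hsd A hvA] at h1⟩
      · rintro (⟨h1, h2⟩ | ⟨h1, h2⟩)
        · exact ⟨h1, fun h => h2 h.2⟩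
        · exact ⟨by rwa [hsd A h1], fun h => h1 h.1⟩
    rw [hun]
    apply Ac_union hPl hQl
    · apply Ac_cone v
      rintro A ⟨h1, h2⟩
      refine ⟨?_, ?_⟩
      · rwa [Finset.insert_sdiff_of_mem _ (Finset.mem_insert_self v τ)]
      · intro h
        apply h2
        intro x hx
        rcases Finset.mem_insert.1 (h hx) with rfl | h'
        · exact absurd hx hv
        · exact h'
    · rcases τ.eq_empty_or_nonempty with rfl | ⟨x, hx⟩
      · have : Q = L := by
          ext A
          simp only [hQ, Set.mem_ofPred_eq, Finset.sdiff_empty]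
          exact ⟨fun h => h.2, fun h => ⟨hdv A h, h⟩⟩
        rw [this]
        apply hj; simp
      · apply Ac_cone x
        rintro A ⟨h1, h2⟩
        refine ⟨?_, ?_⟩
        · rw [Finset.mem_insert, not_or]
          exact ⟨fun h => hv (h ▸ hx), h1⟩
        · rwa [Finset.insert_sdiff_of_mem _ hx]
    · intro i hi
      have : P ∩ Q = bj τ L := by
        ext A
        simp only [hP, hQ, bj, Set.mem_inter_iff, Set.mem_ofPred_eq]
        constructor
        · rintro ⟨⟨h1, h2⟩, h3, h4⟩; exact ⟨h4, h2⟩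
        · rintro ⟨h1, h2⟩
          have hvA : v ∉ A := fun h => hdv _ h1 (Finset.mem_sdiff.2 ⟨h, hv⟩)
          exact ⟨⟨by rwa [hsd A hvA], h2⟩, hvA, h1⟩
      rw [this]
      apply ih hdτ
      intro i' hi'
      apply hj
      rw [Finset.card_insert_of_notMem hv]; omega

/-- deletion of an open star does not matter if the link is acyclic enough -/
lemma Ac_del {K : Set (Finset W)} (hK : IsLowerSet K) {τ : Finset W} (hτ : τ.Nonempty) {j : ℕ}
    (h1 : Ac k {A | A ∈ K ∧ ¬ τ ⊆ A} j)
    (h2 : ∀ i, i + τ.card = j → Ac k {A | A ∪ τ ∈ K ∧ Disjoint A τ} i) : Ac k K j := by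
  set D : Set (Finset W) := {A | A ∈ K ∧ ¬ τ ⊆ A}
  set St : Set (Finset W) := {A | A ∪ τ ∈ K}
  set Lk : Set (Finset W) := {A | A ∪ τ ∈ K ∧ Disjoint A τ}
  have hDl : IsLowerSet D := fun A B hBA hA => ⟨hK hBA hA.1, fun h => hA.2 (h.trans hBA)⟩
  have hSl : IsLowerSet St := fun A B hBA hA => hK (Finset.union_subset_union hBA le_rfl) hA
  have hLl : IsLowerSet Lk := fun A B hBA hA => ⟨hSl hBA hA.1, hA.2.mono_left hBA⟩
  have hun : K = D ∪ St := by
    ext A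
    constructor
    · intro hA
      by_cases h : τ ⊆ A
      · right
        change A ∪ τ ∈ K
        rwa [Finset.union_eq_left.2 h]
      · exact Or.inl ⟨hA, h⟩
    · rintro (h | h)
      · exact h.1
      · exact hK Finset.subset_union_left h
  obtain ⟨v, hv⟩ := hτ
  rw [hun]
  apply Ac_union hDl hSl h1
  · apply Ac_cone v
    intro A hA
    change insert v A ∪ τ ∈ K
    rwa [Finset.insert_union, Finset.insert_eq_of_mem (Finset.mem_union_right A hv)]
  · intro i hi
    have : D ∩ St = bj τ Lk := by
      ext A
      change ((A ∈ K ∧ ¬ τ ⊆ A) ∧ A ∪ τ ∈ K) ↔ (((A \ τ) ∪ τ ∈ K ∧ Disjoint (A \ τ) τ) ∧ ¬ τ ⊆ A)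
      rw [Finset.sdiff_union_self_eq_union]
      constructor
      · rintro ⟨⟨h1, h2⟩, h3⟩
        exact ⟨⟨h3, Finset.sdiff_disjoint⟩, h2⟩
      · rintro ⟨⟨h1, _⟩, h2⟩
        exact ⟨⟨hK Finset.subset_union_left h1, h2⟩, h1⟩
    rw [this]
    apply Ac_bj hLl τ (fun A hA => hA.2)
    intro i' hi'
    apply h2
    omega

/-- acyclicity is preserved by injective relabelling -/
lemma Ac_image {W' : Type*} [DecidableEq W'] {K : Set (Finset W)} {K' : Set (Finset W')}
    (φ : W → W') (ψ : W' → W) (hφ : ∀ A ∈ K, A.image φ ∈ K') (hψ : ∀ A ∈ K', A.image ψ ∈ K)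
    (hid : ∀ A ∈ K', ∀ x ∈ A, φ (ψ x) = x) {j : ℕ} (h : Ac k K j) : Ac k K' j := by
  intro c hc hz
  have hc' : mp ψ c ∈ chn k K j := mp_mem (fun l hl => ⟨by simp [hl.1], by
    have := hψ _ hl.2
    convert this using 1
    ext x; simp⟩) hc
  obtain ⟨b, hb, hbc⟩ := h _ hc' (by rw [bd_mp, hz, map_zero])
  refine ⟨mp φ b, mp_mem (fun l hl => ⟨by simp [hl.1], by
    have := hφ _ hl.2
    convert this using 1
    ext x; simp⟩) hb, ?_⟩
  rw [bd_mp, hbc, mp_mp]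
  refine (eq_on_sp (f := mp (φ ∘ ψ)) (g := LinearMap.id) ?_ hc)
  intro l hl
  rw [mp_single]
  have : l.map (φ ∘ ψ) = l := by
    conv_rhs => rw [← List.map_id l]
    apply List.map_congr_left
    intro x hx
    exact hid _ hl.2 x (List.mem_toFinset.2 hx)
  rw [this]; rfl

/-- homotopy operator of the carrier lemma -/
noncomputable def hop (b : ℕ → Ch k W →ₗ[k] Ch k W) : ℕ → Ch k W →ₗ[k] Ch k W
  | 0 => 0
  | m + 1 => Finsupp.linearCombination k (fun l => match l with
      | [] => 0
      | x :: l' => cone x (Finsupp.single (x :: l') 1 - b (m + 1) (Finsupp.single (x :: l') 1)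
          - hop b m (bdL k (x :: l'))))

lemma hop_mem {b : ℕ → Ch k W →ₗ[k] Ch k W} {Q : List W → Prop}
    (hQ : ∀ l l' : List W, l'.Sublist l → Q l → Q l')
    (hb : ∀ l : List W, Q l → b l.length (Finsupp.single l 1) ∈
      sp k (fun l' => l'.length = l.length ∧ ∀ x ∈ l', x ∈ l)) (m : ℕ) :
    ∀ l : List W, Q l → l.length = m → hop b m (Finsupp.single l 1) ∈
      sp k (fun l' => l'.length = m + 1 ∧ ∀ x ∈ l', x ∈ l) := by
  induction m with
  | zero => intro l _ _; simp [hop]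
  | succ m ih =>
    intro l hq hl
    match l, hq, hl with
    | x :: l', hq, hl =>
      simp only [hop, Finsupp.linearCombination_single, one_smul]
      apply cone_mem (P := fun l'' => l''.length = m + 1 ∧ ∀ y ∈ l'', y ∈ x :: l')
      · rintro l'' ⟨h1, h2⟩
        refine ⟨by simp [h1], ?_⟩
        intro y hy
        rcases List.mem_cons.1 hy with rfl | hy
        · simp
        · exact h2 y hy
      · refine Submodule.sub_mem _ (Submodule.sub_mem _ ?_ ?_) ?_
        · exact single_mem_sp ⟨hl, fun y hy => hy⟩ 1
        · have := hb (x :: l') hq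
          rwa [hl] at this
        · refine map_sp ?_ (bdL_mem (k := k) (x :: l'))
          rintro l'' ⟨h1, h2⟩
          refine sp_mono ?_ (ih l'' (hQ _ _ h1 hq) (by omega))
          rintro l3 ⟨h3, h4⟩
          exact ⟨h3, fun y hy => h1.subset (h4 y hy)⟩

lemma carrier {K : Set (Finset W)} (hK : IsLowerSet K) (Q : List W → Prop)
    (hQ : ∀ l l' : List W, l'.Sublist l → Q l → Q l') (b : ℕ → Ch k W →ₗ[k] Ch k W)
    (hb0 : b 0 (Finsupp.single [] 1) = Finsupp.single [] 1)
    (hb : ∀ l : List W, Q l → b l.length (Finsupp.single l 1) ∈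
      sp k (fun l' => l'.length = l.length ∧ ∀ x ∈ l', x ∈ l))
    (hbd : ∀ m, ∀ l : List W, l.length = m + 1 →
      bd (b (m + 1) (Finsupp.single l 1)) = b m (bdL k l))
    (j : ℕ) (hj : ∀ l : List W, l.length = j → l.toFinset ∈ K → Q l)
    (z : Ch k W) (hz : z ∈ chn k K j) (hz0 : bd z = 0) :
    ∃ y ∈ chn k K (j + 1), bd y = z - b j z := by
  have key0 : ∀ c ∈ sp k (fun l : List W => l.length = 0), c - b 0 c = 0 := by
    intro c hc
    have := eq_on_sp (f := LinearMap.id) (g := b 0) (fun l hl => by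
      rw [List.length_eq_zero_iff.1 hl, hb0]; rfl) hc
    rw [← this]; simp
  have key : ∀ m, ∀ c ∈ sp k (fun l : List W => l.length = m + 1),
      bd (hop b (m + 1) c) = c - b (m + 1) c - hop b m (bd c) := by
    intro m
    induction m with
    | zero =>
      intro c hc
      refine eq_on_sp (f := bd ∘ₗ hop b 1) (g := LinearMap.id - b 1 - hop b 0 ∘ₗ bd) ?_ hc
      intro l hl
      match l, hl with
      | [x], hl =>
        have h1 : bdL k [x] = Finsupp.single [] 1 := by simp [bdL]
        have h2 := hbd 0 [x] rfl
        rw [h1, hb0] at h2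
        simp only [LinearMap.comp_apply, LinearMap.sub_apply, LinearMap.id_apply]
        simp only [hop, Finsupp.linearCombination_single, one_smul, LinearMap.zero_apply, sub_zero]
        rw [bd_cone, map_sub, h2, bd_single, h1]
        simp
    | succ m ih =>
      intro c hc
      refine eq_on_sp (f := bd ∘ₗ hop b (m + 2)) (g := LinearMap.id - b (m + 2) - hop b (m + 1) ∘ₗ bd) ?_ hc
      intro l hl
      have hmem : bdL k l ∈ sp k (fun l : List W => l.length = m + 1) :=
        sp_mono (fun l' h => by have := h.2; omega) (bdL_mem l)
      have h1 := ih _ hmem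
      have h3 : bd (bdL k l) = 0 := by rw [← bd_single, bd_bd]
      have h2 := hbd (m + 1) l hl
      match l, hl with
      | x :: l', hl =>
        simp only [LinearMap.comp_apply, LinearMap.sub_apply, LinearMap.id_apply, bd_single]
        conv_lhs => rw [hop]
        simp only [Finsupp.linearCombination_single, one_smul]
        have hY : bd (Finsupp.single (x :: l') 1 - b (m + 2) (Finsupp.single (x :: l') 1)
            - hop b (m + 1) (bdL k (x :: l'))) = 0 := by
          rw [map_sub (bd (k := k) (Ω := W)), map_sub (bd (k := k) (Ω := W)), h1, h2, h3, bd_single]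
          simp
        rw [bd_cone]
        erw [hY]
        simp
  rcases j with _ | j
  · refine ⟨0, Submodule.zero_mem _, ?_⟩
    rw [map_zero, key0 z (sp_mono (fun l hl => hl.1) hz)]
  · refine ⟨hop b (j + 1) z, map_sp ?_ hz, ?_⟩
    · rintro l ⟨h1, h2⟩
      refine sp_mono ?_ (hop_mem hQ hb (j + 1) l (hj l h1 h2) h1)
      rintro l' ⟨h3, h4⟩
      refine ⟨h3, hK ?_ h2⟩
      intro x hx
      simp only [List.mem_toFinset] at hx ⊢
      exact h4 x hx
    · rw [key j z (sp_mono (fun l hl => hl.1) hz), hz0, map_zero, sub_zero]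

end complexes

end Tvb

namespace Tvb

section partB
variable {k : Type*} [Field k] {V : Type*} [DecidableEq V]

lemma Ac_R {S : Set (Finset V)} (hS : IsLowerSet S) {n : ℕ}
    (T1 : ∀ j, j + 1 ≤ n → Ac k S j)
    (T2 : ∀ σ ∈ S, σ.Nonempty → ∀ j, Ac k {A | A ∈ S ∧ ¬ σ ⊆ A} j) :
    ∀ f : ℕ, ∀ F : Finset (Finset V), F.card = f → (∀ σ ∈ F, σ ∈ S ∧ σ.Nonempty) → 1 ≤ f →
      ∀ j, j + f ≤ n → Ac k {A | A ∈ S ∧ ∀ σ ∈ F, ¬ σ ⊆ A} j := by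
  have low : ∀ F : Finset (Finset V), IsLowerSet {A | A ∈ S ∧ ∀ σ ∈ F, ¬ σ ⊆ A} :=
    fun F A B hBA hA => ⟨hS hBA hA.1, fun σ hσ h => hA.2 σ hσ (h.trans hBA)⟩
  intro f
  induction f using Nat.strong_induction_on with
  | _ f ih =>
    intro F hF hFS hf j hj
    have hne : F.Nonempty := Finset.card_pos.1 (by omega)
    obtain ⟨σ, hσ⟩ := hne
    obtain ⟨F', hσF, rfl⟩ : ∃ F', σ ∉ F' ∧ insert σ F' = F :=
      ⟨F.erase σ, Finset.notMem_erase _ _, Finset.insert_erase hσ⟩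
    rw [Finset.card_insert_of_notMem hσF] at hF
    have hσS := hFS σ (Finset.mem_insert_self _ _)
    have eq1 : {A | A ∈ S ∧ ∀ τ ∈ insert σ F', ¬ τ ⊆ A} =
        {A | A ∈ S ∧ ¬ σ ⊆ A} ∩ {A | A ∈ S ∧ ∀ τ ∈ F', ¬ τ ⊆ A} := by
      ext A
      simp only [Set.mem_ofPred_eq, Set.mem_inter_iff, Finset.forall_mem_insert]
      tauto
    rcases F'.eq_empty_or_nonempty with rfl | hF'
    · convert T2 σ hσS.1 hσS.2 j using 1
      ext A; simp
    · have hc := Finset.card_pos.2 hF'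
      rw [eq1]
      have low1 : IsLowerSet {A | A ∈ S ∧ ¬ σ ⊆ A} :=
        fun A B hBA hA => ⟨hS hBA hA.1, fun h => hA.2 (h.trans hBA)⟩
      refine Ac_inter low1 (low F')
        ?_ (T2 σ hσS.1 hσS.2 j) (ih F'.card (by omega) F' rfl
          (fun τ hτ => hFS τ (Finset.mem_insert_of_mem hτ)) hc j (by omega))
      classical
      set F'' := (F'.image (fun ρ => σ ∪ ρ)).filter (fun τ => τ ∈ S) with hF''
      have hc2 : F''.card ≤ F'.card := (Finset.card_filter_le _ _).trans Finset.card_image_le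
      have eq2 : {A | A ∈ S ∧ ¬ σ ⊆ A} ∪ {A | A ∈ S ∧ ∀ τ ∈ F', ¬ τ ⊆ A} =
          {A | A ∈ S ∧ ∀ τ ∈ F'', ¬ τ ⊆ A} := by
        ext A
        simp only [Set.mem_ofPred_eq, Set.mem_union, hF'', Finset.mem_filter, Finset.mem_image]
        constructor
        · rintro (⟨h1, h2⟩ | ⟨h1, h2⟩)
          · refine ⟨h1, ?_⟩
            rintro _ ⟨⟨ρ, hρ, rfl⟩, _⟩ h
            exact h2 (Finset.subset_union_left.trans h)
          · refine ⟨h1, ?_⟩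
            rintro _ ⟨⟨ρ, hρ, rfl⟩, _⟩ h
            exact h2 ρ hρ (Finset.subset_union_right.trans h)
        · rintro ⟨h1, h2⟩
          by_cases hσA : σ ⊆ A
          · refine Or.inr ⟨h1, fun ρ hρ h => ?_⟩
            have : σ ∪ ρ ⊆ A := Finset.union_subset hσA h
            exact h2 _ ⟨⟨ρ, hρ, rfl⟩, hS this h1⟩ this
          · exact Or.inl ⟨h1, hσA⟩
      rw [eq2]
      rcases F''.eq_empty_or_nonempty with h0 | h0
      · rw [h0]
        convert T1 (j + 1) (by omega) using 1
        ext A; simp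
      · refine ih F''.card (by omega) F'' rfl ?_ (Finset.card_pos.2 h0) (j + 1) (by omega)
        intro τ hτ
        rw [hF'', Finset.mem_filter, Finset.mem_image] at hτ
        obtain ⟨⟨ρ, hρ, rfl⟩, h⟩ := hτ
        exact ⟨h, hσS.2.mono Finset.subset_union_left⟩

lemma Ac_sdiff {S : Set (Finset V)} (hS : IsLowerSet S) {n : ℕ}
    (T1 : ∀ j, j + 1 ≤ n → Ac k S j)
    (T2 : ∀ σ ∈ S, σ.Nonempty → ∀ j, Ac k {A | A ∈ S ∧ ¬ σ ⊆ A} j)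
    (U : Finset V) (hU : U.Nonempty) (j : ℕ) (hj : j + U.card ≤ n) :
    Ac k {A | A ∈ S ∧ Disjoint A U} j := by
  classical
  set F := (U.image (fun u => ({u} : Finset V))).filter (fun τ => τ ∈ S) with hF
  have hc2 : F.card ≤ U.card := (Finset.card_filter_le _ _).trans Finset.card_image_le
  have hc := Finset.card_pos.2 hU
  have eq : {A | A ∈ S ∧ Disjoint A U} = {A | A ∈ S ∧ ∀ τ ∈ F, ¬ τ ⊆ A} := by
    ext A
    simp only [Set.mem_ofPred_eq, hF, Finset.mem_filter, Finset.mem_image]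
    refine and_congr_right fun hA => ?_
    rw [Finset.disjoint_right]
    constructor
    · rintro h _ ⟨⟨u, hu, rfl⟩, _⟩ h'
      exact h hu (Finset.singleton_subset_iff.1 h')
    · intro h u hu huA
      have : {u} ⊆ A := Finset.singleton_subset_iff.2 huA
      exact h _ ⟨⟨u, hu, rfl⟩, hS this hA⟩ this
  rw [eq]
  rcases F.eq_empty_or_nonempty with h0 | h0
  · rw [h0]
    convert T1 j (by omega) using 1
    ext A; simp
  · refine Ac_R hS T1 T2 F.card F rfl ?_ (Finset.card_pos.2 h0) j (by omega)
    intro τ hτ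
    rw [hF, Finset.mem_filter, Finset.mem_image] at hτ
    obtain ⟨⟨u, hu, rfl⟩, h⟩ := hτ
    exact ⟨h, Finset.singleton_nonempty u⟩

end partB
end Tvb

namespace Tvb

section partD
variable {k : Type*} [Field k] {E F : Type*} [NormedAddCommGroup E] [NormedSpace ℝ E]
  [NormedAddCommGroup F] [NormedSpace ℝ F]

/-- barycenter of a list of points -/
noncomputable def mean (l : List E) : E := (l.length : ℝ)⁻¹ • l.sum

/-- barycentric subdivision operator on lists of length `m` -/
noncomputable def sd (k : Type*) [Field k] {E : Type*} [NormedAddCommGroup E] [NormedSpace ℝ E] :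
    ℕ → Ch k E →ₗ[k] Ch k E
  | 0 => LinearMap.id
  | m + 1 => Finsupp.linearCombination k (fun l => cone (mean l) (sd k m (bdL k l)))

lemma sd_single (m : ℕ) (l : List E) : sd k (m + 1) (Finsupp.single l 1) =
    cone (mean l) (sd k m (bdL k l)) := by
  rw [sd]; simp

lemma bd_sd (m : ℕ) : ∀ c ∈ sp k (fun l : List E => l.length = m + 1),
    bd (sd k (m + 1) c) = sd k m (bd c) := by
  induction m with
  | zero =>
    intro c hc
    refine eq_on_sp (f := bd ∘ₗ sd k 1) (g := sd k 0 ∘ₗ bd) ?_ hc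
    intro l hl
    match l, hl with
    | [x], hl =>
      have h1 : bdL k [x] = Finsupp.single [] 1 := by simp [bdL]
      simp only [LinearMap.comp_apply]
      rw [sd_single, bd_cone, bd_single, h1]
      simp [sd, bd_nil]
  | succ m ih =>
    intro c hc
    refine eq_on_sp (f := (bd (k := k) (Ω := E)).comp (sd k (m + 1 + 1)))
      (g := (sd k (m + 1)).comp (bd (k := k) (Ω := E))) ?_ hc
    intro l hl
    have hmem : bdL k l ∈ sp k (fun l : List E => l.length = m + 1) :=
      sp_mono (fun l' h => by have := h.2; omega) (bdL_mem l)
    simp only [LinearMap.comp_apply]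
    rw [sd_single, bd_cone, ih _ hmem, bd_single, ← bd_single, bd_bd, map_zero, map_zero, sub_zero]

lemma sd_len (m : ℕ) : ∀ c ∈ sp k (fun l : List E => l.length = m),
    sd k m c ∈ sp k (fun l : List E => l.length = m) := by
  induction m with
  | zero => intro c hc; exact hc
  | succ m ih =>
    intro c hc
    refine map_sp ?_ hc
    intro l hl
    rw [sd_single]
    refine cone_mem (P := fun l => l.length = m) (fun l h => by simp [h]) (ih _ ?_)
    exact sp_mono (fun l' h => by have := h.2; omega) (bdL_mem l)

lemma mean_mem {C : Set E} (hC : Convex ℝ C) {l : List E} (hl : l ≠ []) (h : ∀ x ∈ l, x ∈ C) :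
    mean l ∈ C := by
  have h0 : (l.length : ℝ) ≠ 0 := by
    simpa using hl
  have h1 : mean l = ∑ i : Fin l.length, (l.length : ℝ)⁻¹ • l.get i := by
    rw [← Finset.smul_sum, mean]
    congr 1
    rw [← List.sum_ofFn, List.ofFn_get]
  rw [h1]
  refine hC.sum_mem (fun i _ => by positivity) ?_ (fun i _ => h _ (List.get_mem l i))
  simp [h0]

lemma sd_conv (m : ℕ) {C : Set E} (hC : Convex ℝ C) (l : List E) (hm : l.length = m)
    (h : ∀ x ∈ l, x ∈ C) : sd k m (Finsupp.single l 1) ∈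
      sp k (fun l' => l'.length = m ∧ ∀ x ∈ l', x ∈ C) := by
  induction m generalizing l with
  | zero => exact single_mem_sp ⟨hm, h⟩ 1
  | succ m ih =>
    rw [sd_single]
    refine cone_mem (P := fun l' => l'.length = m ∧ ∀ x ∈ l', x ∈ C) ?_ (map_sp ?_ (bdL_mem l))
    · rintro l' ⟨h1, h2⟩
      refine ⟨by simp [h1], ?_⟩
      intro x hx
      rcases List.mem_cons.1 hx with rfl | hx
      · exact mean_mem hC (by rintro rfl; simp at hm) h
      · exact h2 x hx
    · rintro l' ⟨h1, h2⟩
      exact ih l' (by omega) (fun x hx => h x (h1.subset hx))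

/-- smallness of a list -/
def Sm (D : ℝ) (l : List E) : Prop := ∀ x ∈ l, ∀ y ∈ l, dist x y ≤ D

lemma mean_dist [DecidableEq E] {l : List E} {m : ℕ} (hm : l.length = m + 1) {D : ℝ} (h : Sm D l) {y : E} (hy : y ∈ l) :
    dist y (mean l) ≤ m / (m + 1) * D := by
  have hp := List.perm_cons_erase hy
  have h1 : (l.erase y).length = m := by rw [List.length_erase_of_mem hy]; omega
  have h2 : mean l = (m + 1 : ℝ)⁻¹ • (y + (l.erase y).sum) := by
    rw [mean, hm, hp.sum_eq]; simp
  have h3 : y - mean l = (m + 1 : ℝ)⁻¹ • ((l.erase y).map (fun x => y - x)).sum := by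
    have : ∀ l' : List E, (l'.map (fun x => y - x)).sum = (l'.length : ℝ) • y - l'.sum := by
      intro l'
      induction l' with
      | nil => simp
      | cons a t ih =>
        rw [List.map_cons, List.sum_cons, List.sum_cons, ih, List.length_cons]
        push_cast
        module
    rw [this, h1, h2]
    have h0 : (m + 1 : ℝ) ≠ 0 := by positivity
    rw [eq_inv_smul_iff₀ h0, smul_sub, smul_inv_smul₀ h0]
    module
  rw [dist_eq_norm, h3, norm_smul]
  have h4 : ‖((l.erase y).map (fun x => y - x)).sum‖ ≤ m * D := by
    have : ∀ l' : List E, (∀ x ∈ l', dist y x ≤ D) →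
        ‖(l'.map (fun x => y - x)).sum‖ ≤ l'.length * D := by
      intro l'
      induction l' with
      | nil => simp
      | cons a t ih =>
        intro h
        rw [List.map_cons, List.sum_cons, List.length_cons]
        refine (norm_add_le _ _).trans ?_
        have h1 := ih (fun x hx => h x (List.mem_cons_of_mem _ hx))
        have h2 := h a (by simp)
        rw [dist_eq_norm] at h2
        push_cast
        linarith
    have := this (l.erase y) (fun x hx => h y hy x (List.mem_of_mem_erase hx))
    rwa [h1] at this
  have h5 : ‖((m : ℝ) + 1)⁻¹‖ = ((m : ℝ) + 1)⁻¹ := by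
    rw [Real.norm_of_nonneg]; positivity
  rw [h5]
  calc _ ≤ ((m : ℝ) + 1)⁻¹ * (m * D) := by gcongr
    _ = _ := by ring

lemma sd_small (m : ℕ) {D : ℝ} (hD : 0 ≤ D) (l : List E) (hm : l.length = m)
    (h : Sm D l) : sd k m (Finsupp.single l 1) ∈ sp k (Sm ((m / (m + 1) : ℝ) * D)) := by
  classical
  induction m generalizing l with
  | zero =>
    refine single_mem_sp ?_ 1
    rw [List.length_eq_zero_iff.1 hm]
    intro x hx; simp at hx
  | succ m ih =>
    rw [sd_single]
    set B := Metric.closedBall (mean l) (m / (m + 1) * D)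
    have hB : ∀ x ∈ l, x ∈ B := fun x hx => Metric.mem_closedBall.2 (mean_dist hm h hx)
    refine cone_mem (P := fun l' => (l'.length = m ∧ ∀ x ∈ l', x ∈ B) ∧
      Sm ((m / (m + 1) : ℝ) * D) l') ?_ (map_sp ?_ (bdL_mem l))
    · rintro l' ⟨⟨h0, h1⟩, h2⟩
      have hle : (m / (m + 1) : ℝ) * D ≤ ((m + 1 : ℕ) / ((m + 1 : ℕ) + 1) : ℝ) * D := by
        refine mul_le_mul_of_nonneg_right ?_ hD
        push_cast
        rw [div_le_div_iff₀ (by positivity) (by positivity)]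
        nlinarith
      intro x hx y hy
      refine le_trans ?_ hle
      rcases List.mem_cons.1 hx with rfl | hx <;> rcases List.mem_cons.1 hy with rfl | hy
      · rw [dist_self]; positivity
      · rw [dist_comm]; exact Metric.mem_closedBall.1 (h1 y hy)
      · exact Metric.mem_closedBall.1 (h1 x hx)
      · exact h2 x hx y hy
    · rintro l' ⟨h1, h2⟩
      have a1 := sd_conv (k := k) m (convex_closedBall _ _) l' (by omega)
        (fun x hx => hB x (h1.subset hx))
      have a2 := ih l' (by omega) (fun x hx y hy => h x (h1.subset hx) y (h1.subset hy))
      rw [sp, Finsupp.mem_supported] at a1 a2 ⊢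
      exact fun l hl => ⟨a1 hl, a2 hl⟩

/-- iterated subdivision -/
noncomputable def sdi (k : Type*) [Field k] {E : Type*} [NormedAddCommGroup E] [NormedSpace ℝ E]
    (M m : ℕ) : Ch k E →ₗ[k] Ch k E := (sd k m) ^ M

lemma sdi_zero (m : ℕ) (c : Ch k E) : sdi k 0 m c = c := by simp [sdi]

lemma sdi_succ (M m : ℕ) (c : Ch k E) : sdi k (M + 1) m c = sd k m (sdi k M m c) := by
  rw [sdi, pow_succ']; rfl

lemma sdi_len (M m : ℕ) {c : Ch k E} (hc : c ∈ sp k (fun l : List E => l.length = m)) :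
    sdi k M m c ∈ sp k (fun l : List E => l.length = m) := by
  induction M with
  | zero => rwa [sdi_zero]
  | succ M ih => rw [sdi_succ]; exact sd_len m _ ih

lemma bd_sdi (M m : ℕ) {c : Ch k E} (hc : c ∈ sp k (fun l : List E => l.length = m + 1)) :
    bd (sdi k M (m + 1) c) = sdi k M m (bd c) := by
  induction M with
  | zero => rw [sdi_zero, sdi_zero]
  | succ M ih => rw [sdi_succ, sdi_succ, bd_sd _ _ (sdi_len M _ hc), ih]

lemma sdi_len_zero (M : ℕ) (c : Ch k E) : sdi k M 0 c = c := by
  induction M with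
  | zero => rw [sdi_zero]
  | succ M ih => rw [sdi_succ, ih]; rfl

/-- main estimate on iterated subdivisions -/
lemma sdi_mem (𝒞 : Set (Set E)) (h𝒞 : ∀ C ∈ 𝒞, Convex ℝ C) {m₀ m : ℕ} (hm : m ≤ m₀) {D : ℝ} (hD : 0 ≤ D) (M : ℕ)
    {c : Ch k E} (hc : c ∈ sp k (fun l : List E => l.length = m ∧ (∃ C ∈ 𝒞, ∀ x ∈ l, x ∈ C) ∧ Sm D l)) :
    sdi k M m c ∈ sp k (fun l : List E => l.length = m ∧ (∃ C ∈ 𝒞, ∀ x ∈ l, x ∈ C) ∧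
      Sm ((m₀ / (m₀ + 1) : ℝ) ^ M * D) l) := by
  induction M with
  | zero => simpa [sdi_zero] using hc
  | succ M ih =>
    rw [sdi_succ]
    refine map_sp ?_ ih
    rintro l ⟨h1, ⟨C, hC, h2⟩, h3⟩
    have a1 := sd_conv (k := k) m (h𝒞 C hC) l h1 h2
    have a2 := sd_small (k := k) m (by positivity) l h1 h3
    rw [sp, Finsupp.mem_supported] at a1 a2 ⊢
    refine fun l hl => ⟨(a1 hl).1, ⟨C, hC, (a1 hl).2⟩, fun x hx y hy => (a2 hl x hx y hy).trans ?_⟩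
    rw [pow_succ', mul_assoc]
    refine mul_le_mul_of_nonneg_right ?_ (by positivity)
    rw [div_le_div_iff₀ (by positivity) (by positivity)]
    have : (m : ℝ) ≤ m₀ := by exact_mod_cast hm
    nlinarith

lemma exists_M (m₀ : ℕ) (D : ℝ) {δ : ℝ} (hδ : 0 < δ) : ∃ M : ℕ, (m₀ / (m₀ + 1) : ℝ) ^ M * D ≤ δ := by
  have h : Filter.Tendsto (fun M : ℕ => (m₀ / (m₀ + 1) : ℝ) ^ M * D) Filter.atTop (nhds (0 * D)) := by
    refine (tendsto_pow_atTop_nhds_zero_of_lt_one (by positivity) ?_).mul_const D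
    rw [div_lt_one (by positivity)]; linarith
  rw [zero_mul] at h
  exact ((h.eventually (gt_mem_nhds hδ)).exists).imp fun M hM => hM.le

lemma mp_sd (L : E →ₗ[ℝ] F) (m : ℕ) (c : Ch k E) : mp L (sd k m c) = sd k m (mp L c) := by
  induction m generalizing c with
  | zero => rfl
  | succ m ih =>
    have : mp L ∘ₗ sd k (m + 1) = sd k (m + 1) ∘ₗ mp (k := k) L := by
      apply ch_ext
      intro l
      simp only [LinearMap.comp_apply]
      rw [mp_single, sd_single, sd_single, mp_cone, ih, ← bd_single, ← bd_mp, mp_single, bd_single]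
      congr 2
      simp [mean, map_list_sum]
    exact congrArg (fun f => f c) this

lemma mp_sdi (L : E →ₗ[ℝ] F) (M m : ℕ) (c : Ch k E) : mp L (sdi k M m c) = sdi k M m (mp L c) := by
  induction M with
  | zero => rw [sdi_zero, sdi_zero]
  | succ M ih => rw [sdi_succ, sdi_succ, mp_sd, ih]

end partD
end Tvb

namespace Tvb

set_option linter.unusedSectionVars false

section partC

lemma exists_kappa {X ι : Type*} [TopologicalSpace X] [Fintype ι] [Nonempty ι] {Z : Set X}
    (hZ : IsCompact Z) (φ : X → ι → ℝ) (hφ : ContinuousOn φ Z)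
    (h : ∀ x ∈ Z, ∃ i, 0 < φ x i) : ∃ κ > 0, ∀ x ∈ Z, ∃ i, κ ≤ φ x i := by
  rcases Z.eq_empty_or_nonempty with rfl | hne
  · exact ⟨1, one_pos, fun x hx => hx.elim⟩
  have hc : ContinuousOn (fun x => Finset.univ.sup' Finset.univ_nonempty (fun i => φ x i)) Z :=
    ContinuousOn.finset_sup'_apply _ (fun i _ => (continuousOn_pi.1 hφ i))
  obtain ⟨x0, hx0, hmin⟩ := hZ.exists_isMinOn hne hc
  refine ⟨Finset.univ.sup' Finset.univ_nonempty (fun i => φ x0 i), ?_, fun x hx => ?_⟩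
  · obtain ⟨i, hi⟩ := h x0 hx0
    exact lt_of_lt_of_le hi (Finset.le_sup' (fun i => φ x0 i) (Finset.mem_univ i))
  · obtain ⟨i, _, hi⟩ := Finset.exists_mem_eq_sup' Finset.univ_nonempty (fun i => φ x i)
    exact ⟨i, by rw [← hi]; exact hmin hx⟩

lemma unif_near {X Y : Type*} [PseudoMetricSpace X] [PseudoMetricSpace Y] {Z : Set X}
    (hZ : IsCompact Z) (φ : X → Y) (hφ : ∀ x ∈ Z, ContinuousAt φ x) {ε : ℝ} (hε : 0 < ε) :
    ∃ δ > 0, ∀ x ∈ Z, ∀ y, dist x y ≤ δ → dist (φ x) (φ y) < ε := by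
  have := hZ.uniformContinuousAt_of_continuousAt φ hφ (Metric.dist_mem_uniformity hε)
  obtain ⟨δ, hδ, h⟩ := Metric.mem_uniformity_dist.1 this
  exact ⟨δ / 2, by positivity, fun x hx y hxy => h (by linarith : dist x y < δ) hx⟩

lemma unif_on {X Y : Type*} [PseudoMetricSpace X] [PseudoMetricSpace Y] {Z : Set X}
    (hZ : IsCompact Z) (φ : X → Y) (hφ : ContinuousOn φ Z) {ε : ℝ} (hε : 0 < ε) :
    ∃ δ > 0, ∀ x ∈ Z, ∀ y ∈ Z, dist x y ≤ δ → dist (φ x) (φ y) < ε := by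
  have := hZ.uniformContinuousOn_of_continuous hφ
  obtain ⟨δ, hδ, h⟩ := Metric.uniformContinuousOn_iff.1 this ε hε
  exact ⟨δ / 2, by positivity, fun x hx y hy hxy => h x hx y hy (by linarith)⟩

variable {V : Type*} [Fintype V] [DecidableEq V]

/-- realization of a closed simplex -/
def sim (A : Finset V) : Set (V → ℝ) :=
  {w | (∀ v, 0 ≤ w v) ∧ ∑ v, w v = 1 ∧ ∀ v ∉ A, w v = 0}

/-- support of a weight -/
noncomputable def wsupp (w : V → ℝ) : Finset V := by classical exact Finset.univ.filter (fun v => w v ≠ 0)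

@[simp] lemma mem_wsupp {w : V → ℝ} {v : V} : v ∈ wsupp w ↔ w v ≠ 0 := by simp [wsupp]

/-- realization of an abstract complex -/
def geom (K : Set (Finset V)) : Set (V → ℝ) :=
  {w | (∀ v, 0 ≤ w v) ∧ ∑ v, w v = 1 ∧ wsupp w ∈ K}

lemma sim_convex (A : Finset V) : Convex ℝ (sim A) := by
  rintro x ⟨h1, h2, h3⟩ y ⟨h4, h5, h6⟩ a b ha hb hab
  refine ⟨fun v => ?_, ?_, fun v hv => ?_⟩
  · have := h1 v; have := h4 v
    simp only [Pi.add_apply, Pi.smul_apply, smul_eq_mul]; positivity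
  · simp only [Pi.add_apply, Pi.smul_apply, smul_eq_mul, Finset.sum_add_distrib, ← Finset.mul_sum,
      h2, h5]; linarith
  · simp [h3 v hv, h6 v hv]

lemma sim_compact (A : Finset V) : IsCompact (sim A) := by
  have hsub : sim A ⊆ stdSimplex ℝ V := fun w hw => ⟨hw.1, hw.2.1⟩
  refine (isCompact_stdSimplex ℝ V).of_isClosed_subset ?_ hsub
  have : sim A = stdSimplex ℝ V ∩ ⋂ v ∈ {v | v ∉ A}, {w | w v = 0} := by
    ext w
    simp only [sim, stdSimplex, Set.mem_ofPred_eq, Set.mem_inter_iff, Set.mem_iInter]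
    tauto
  rw [this]
  refine (isClosed_stdSimplex ℝ V).inter ?_
  exact isClosed_biInter fun v _ => isClosed_eq (continuous_apply v) continuous_const

lemma sim_sub_geom {K : Set (Finset V)} (hK : IsLowerSet K) {A : Finset V} (hA : A ∈ K) :
    sim A ⊆ geom K := by
  rintro w ⟨h1, h2, h3⟩
  refine ⟨h1, h2, hK ?_ hA⟩
  intro v hv
  by_contra h
  exact (mem_wsupp.1 hv) (h3 v h)

lemma mem_sim_wsupp {K : Set (Finset V)} {w : V → ℝ} (hw : w ∈ geom K) : w ∈ sim (wsupp w) :=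
  ⟨hw.1, hw.2.1, fun v hv => by simpa using hv⟩

lemma geom_eq {K : Set (Finset V)} (hK : IsLowerSet K) : geom K = ⋃ A ∈ K, sim A := by
  ext w
  simp only [Set.mem_iUnion]
  exact ⟨fun h => ⟨wsupp w, h.2.2, mem_sim_wsupp h⟩,
    fun ⟨A, hA, h⟩ => sim_sub_geom hK hA h⟩

lemma geom_compact {K : Set (Finset V)} (hK : IsLowerSet K) : IsCompact (geom K) := by
  rw [geom_eq hK]
  exact (Set.toFinite K).isCompact_biUnion fun A _ => sim_compact A

lemma single_mem_sim {A : Finset V} {v : V} (hv : v ∈ A) : (Pi.single v 1 : V → ℝ) ∈ sim A := by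
  refine ⟨fun w => ?_, ?_, fun w hw => ?_⟩
  · by_cases h : w = v
    · subst h; simp
    · simp [h]
  · simp
  · have : w ≠ v := by rintro rfl; exact hw hv
    simp [this]

lemma sim_dist {A : Finset V} {w w' : V → ℝ} (h : w ∈ sim A) (h' : w' ∈ sim A) : dist w w' ≤ 1 := by
  have key : ∀ {w}, w ∈ sim A → ∀ v, w v ≤ 1 := by
    intro w h v
    rw [← h.2.1]
    exact Finset.single_le_sum (fun i _ => h.1 i) (Finset.mem_univ v)
  rw [dist_pi_le_iff zero_le_one]
  intro v
  rw [Real.dist_eq, abs_le]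
  have := key h v; have := key h' v; have := h.1 v; have := h'.1 v
  constructor <;> linarith

lemma exists_Sm {k : Type*} [Field k] {E : Type*} [NormedAddCommGroup E] [NormedSpace ℝ E] (c : Ch k E) :
    ∃ D, 0 ≤ D ∧ c ∈ sp k (Sm D) := by
  classical
  set T : Set E := ⋃ l ∈ c.support, {x | x ∈ l}
  have hT : T.Finite := by
    refine Set.Finite.biUnion (Finset.finite_toSet _) fun l _ => ?_
    exact List.finite_toSet l
  refine ⟨Metric.diam T, Metric.diam_nonneg, ?_⟩
  rw [sp, Finsupp.mem_supported]
  intro l hl x hx y hy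
  exact Metric.dist_le_diam_of_mem hT.isBounded (Set.mem_biUnion hl hx) (Set.mem_biUnion hl hy)

/-- barycentric pieces of a list of vertices -/
lemma sdi_vert (k : Type*) [Field k] {j m : ℕ} (hm : m ≤ j) {δ : ℝ} {M : ℕ}
    (hM : (j / (j + 1) : ℝ) ^ M * 1 ≤ δ) (K : Set (Finset V)) {c : Ch k V}
    (hc : c ∈ sp k (fun l => l.length = m ∧ l.toFinset ∈ K)) :
    sdi k M m (mp (fun v => (Pi.single v 1 : V → ℝ)) c) ∈
      sp k (fun l => l.length = m ∧ (∃ C ∈ sim '' K, ∀ x ∈ l, x ∈ C) ∧ Sm δ l) := by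
  have h1 : mp (fun v => (Pi.single v 1 : V → ℝ)) c ∈
      sp k (fun l => l.length = m ∧ (∃ C ∈ sim '' K, ∀ x ∈ l, x ∈ C) ∧ Sm 1 l) := by
    refine mp_mem ?_ hc
    rintro l ⟨h1, h2⟩
    have h3 : ∀ x ∈ l.map (fun v => (Pi.single v 1 : V → ℝ)), x ∈ sim l.toFinset := by
      intro x hx
      obtain ⟨v, hv, rfl⟩ := List.mem_map.1 hx
      exact single_mem_sim (List.mem_toFinset.2 hv)
    exact ⟨by simp [h1], ⟨_, ⟨_, h2, rfl⟩, h3⟩, fun x hx y hy => sim_dist (h3 x hx) (h3 y hy)⟩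
  refine sp_mono ?_ (sdi_mem (sim '' K) (by rintro _ ⟨A, _, rfl⟩; exact sim_convex A) hm
    zero_le_one M h1)
  rintro l ⟨h1, h2, h3⟩
  exact ⟨h1, h2, fun x hx y hy => (h3 x hx y hy).trans hM⟩

end partC
end Tvb

namespace Tvb

set_option linter.unusedSectionVars false

section partC2
variable {V : Type*} [Fintype V] [DecidableEq V]

/-- label: a coordinate with maximal value -/
lemma exists_label [Nonempty V] (w : V → ℝ) : ∃ v, ∀ v', w v' ≤ w v := by
  obtain ⟨v, _, hv⟩ := Finset.exists_max_image Finset.univ w Finset.univ_nonempty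
  exact ⟨v, fun v' => hv v' (Finset.mem_univ _)⟩

noncomputable def lab [Nonempty V] (w : V → ℝ) : V := (exists_label w).choose

lemma lab_spec [Nonempty V] (w : V → ℝ) (v' : V) : w v' ≤ w (lab w) := (exists_label w).choose_spec v'

lemma lab_near [Nonempty V] {κ : ℝ} {w w' : V → ℝ} (h : dist w w' < κ)
    (h' : ∃ v, κ ≤ w' v) : 0 < w (lab w') := by
  obtain ⟨v, hv⟩ := h'
  have h1 := lab_spec w' v
  have h2 : dist (w (lab w')) (w' (lab w')) < κ := (dist_le_pi_dist w w' _).trans_lt h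
  rw [Real.dist_eq, abs_lt] at h2
  linarith [h2.1]

lemma lab_near' [Nonempty V] {κ : ℝ} {w w' : V → ℝ} (h : dist w w' < κ / 2)
    (h' : ∃ v, κ ≤ w v) : 0 < w (lab w') := by
  obtain ⟨v, hv⟩ := h'
  have h1 := lab_spec w' v
  have h2 : dist (w (lab w')) (w' (lab w')) < κ / 2 := (dist_le_pi_dist w w' _).trans_lt h
  have h3 : dist (w v) (w' v) < κ / 2 := (dist_le_pi_dist w w' _).trans_lt h
  rw [Real.dist_eq, abs_lt] at h2 h3
  linarith [h2.1, h3.2]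

lemma hull_compact {E : Type*} [NormedAddCommGroup E] [NormedSpace ℝ E] (l : List E) :
    IsCompact (convexHull ℝ {x | x ∈ l}) := (List.finite_toSet l).isCompact_convexHull ℝ

lemma sdi_zero_map {k : Type*} [Field k] {E : Type*} [NormedAddCommGroup E] [NormedSpace ℝ E]
    (M : ℕ) (c : Ch k E) : sdi k M 0 c = c := sdi_len_zero M c

variable {E : Type*} [NormedAddCommGroup E] [NormedSpace ℝ E] [FiniteDimensional ℝ E]

lemma transfer (k : Type*) [Field k] [Nonempty V] {K : Set (Finset V)} (hK : IsLowerSet K) (j : ℕ)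
    (h : (V → ℝ) → E) (hh : ContinuousOn h (geom K)) (h1 : ∀ w ∈ geom K, h w ≠ 0)
    (U : E → V → ℝ) (hU : ∀ x, x ≠ 0 → ContinuousAt U x)
    (hUK : ∀ w ∈ geom K, (∃ v, 0 < U (h w) v) ∧ ∀ v, 0 < U (h w) v → w v ≠ 0)
    (hp : ∃ δ > 0, ∀ L : Finset (List E), (∀ l ∈ L, l.length = j ∧ Sm δ l ∧ ∀ x ∈ l, x ∈ h '' geom K) →
      ∃ p : E, ∀ l ∈ L, ∀ x ∈ convexHull ℝ {x | x ∈ p :: l}, x ≠ 0 ∧ (∃ v, 0 < U x v) ∧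
        (Finset.univ.filter (fun v => 0 < U x v)) ∈ K) : Ac k K j := by
  intro z hz hz0
  obtain ⟨δ, hδ, hp⟩ := hp
  have hKc := geom_compact hK
  have hKh : IsCompact (h '' geom K) := hKc.image_of_continuousOn hh
  obtain ⟨κ, hκ, hκ'⟩ := exists_kappa hKh U (fun x hx => by
    obtain ⟨w, hw, rfl⟩ := hx
    exact (hU _ (h1 w hw)).continuousWithinAt) (fun x hx => by
    obtain ⟨w, hw, rfl⟩ := hx
    exact (hUK w hw).1)
  obtain ⟨δ', hδ', hδU⟩ := unif_near hKh U (fun x hx => by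
    obtain ⟨w, hw, rfl⟩ := hx
    exact hU _ (h1 w hw)) (half_pos hκ)
  obtain ⟨δ1, hδ1, hδh⟩ := unif_on hKc h hh (lt_min hδ hδ')
  obtain ⟨M1, hM1⟩ := exists_M j 1 hδ1
  set e : V → V → ℝ := fun v => Pi.single v 1 with he
  set lam : E → V := fun x => lab (U x) with hlam
  -- first stage
  have st1 : ∀ m ≤ j, ∀ K' ⊆ K, IsLowerSet K' → ∀ c ∈ sp k (fun l : List V => l.length = m ∧ l.toFinset ∈ K'),
      mp h (sdi k M1 m (mp e c)) ∈ sp k (fun l => l.length = m ∧ (∃ A ∈ K', ∀ x ∈ l, x ∈ h '' sim A) ∧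
        Sm (min δ δ') l) := by
    intro m hm K' hK' hK'l c hc
    refine mp_mem ?_ (sdi_vert k hm hM1 K' hc)
    rintro l ⟨a1, ⟨_, ⟨A, hA, rfl⟩, a2⟩, a3⟩
    refine ⟨by simp [a1], ⟨A, hA, ?_⟩, ?_⟩
    · intro x hx
      obtain ⟨w, hw, rfl⟩ := List.mem_map.1 hx
      exact ⟨w, a2 w hw, rfl⟩
    · intro x hx y hy
      obtain ⟨w, hw, rfl⟩ := List.mem_map.1 hx
      obtain ⟨w', hw', rfl⟩ := List.mem_map.1 hy
      exact (hδh w (sim_sub_geom hK (hK' hA) (a2 w hw)) w' (sim_sub_geom hK (hK' hA) (a2 w' hw'))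
        (a3 w hw w' hw')).le
  set b : ℕ → ℕ → Ch k V →ₗ[k] Ch k V := fun M2 m =>
    mp lam ∘ₗ sdi k M2 m ∘ₗ mp h ∘ₗ sdi k M1 m ∘ₗ mp e with hb
  -- carrier
  have car : ∀ M2, ∃ y ∈ chn k K (j + 1), bd y = z - b M2 j z := by
    intro M2
    refine carrier hK (fun l => l.length ≤ j ∧ l.toFinset ∈ K)
      (fun l l' hs hl => ⟨hs.length_le.trans hl.1, hK (toFinset_sub hs) hl.2⟩) (b M2) ?_ ?_ ?_ j
      (fun l hl hl' => ⟨hl.le, hl'⟩) z hz hz0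
    · simp only [hb, LinearMap.comp_apply]
      rw [mp_single, sdi_len_zero, sdi_len_zero, mp_single, mp_single]
      rfl
    · rintro l ⟨hl1, hl2⟩
      have s1 := st1 l.length hl1 (Set.Iic l.toFinset) (fun A hA => hK hA hl2) (isLowerSet_Iic _)
        (Finsupp.single l 1) (single_mem_sp ⟨rfl, Set.mem_Iic.2 le_rfl⟩ 1)
      simp only [hb, LinearMap.comp_apply]
      refine map_sp (f := mp lam ∘ₗ sdi k M2 l.length) ?_ s1
      rintro l1 ⟨b1, ⟨A, hA, b2⟩, b3⟩
      rw [LinearMap.comp_apply]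
      by_cases hne : l1 = []
      · subst hne
        have : l.length = 0 := by simpa using b1.symm
        rw [this, sdi_len_zero, mp_single]
        exact single_mem_sp ⟨by simp, by simp⟩ 1
      obtain ⟨x0, hx0⟩ := List.exists_mem_of_ne_nil l1 hne
      obtain ⟨w0, hw0, hw0x⟩ := b2 x0 hx0
      have hw0K := sim_sub_geom hK (hK hA hl2 : A ∈ K) hw0
      have s2 := sdi_mem (k := k) {Metric.closedBall x0 δ'} (by rintro _ rfl; exact convex_closedBall _ _)
        (le_refl l.length) (le_min hδ.le hδ'.le) M2 (c := Finsupp.single l1 1) (single_mem_sp ⟨b1,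
          ⟨_, rfl, fun x hx => Metric.mem_closedBall.2 ((b3 x hx x0 hx0).trans (min_le_right _ _))⟩, b3⟩ 1)
      refine mp_mem ?_ s2
      rintro l2 ⟨c1, ⟨_, rfl, c2⟩, c3⟩
      refine ⟨by simp [c1], ?_⟩
      intro v hv
      obtain ⟨x, hx, rfl⟩ := List.mem_map.1 hv
      have c4 := hδU x0 ⟨w0, hw0K, hw0x⟩ x (by rw [dist_comm]; exact Metric.mem_closedBall.1 (c2 x hx))
      have c5 := lab_near' c4 (hκ' x0 ⟨w0, hw0K, hw0x⟩)
      rw [← hw0x] at c5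
      have c6 := (hUK w0 hw0K).2 _ c5
      have c7 : lab (U x) ∈ A := by
        by_contra hc
        exact c6 (hw0.2.2 _ hc)
      exact List.mem_toFinset.1 (hA c7)
    · intro m l hl
      simp only [hb, LinearMap.comp_apply]
      have q1 : mp e (Finsupp.single l (1 : k)) ∈ sp k (fun l => l.length = m + 1) := by
        rw [mp_single]; exact single_mem_sp (by simp [hl]) 1
      have q2 : mp h (sdi k M1 (m + 1) (mp e (Finsupp.single l (1 : k)))) ∈
          sp k (fun l => l.length = m + 1) :=
        mp_mem (fun l hl => by simp [hl]) (sdi_len M1 _ q1)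
      rw [bd_mp, bd_sdi M2 m q2, bd_mp, bd_sdi M1 m q1, bd_mp, bd_single]
  -- the cycle y
  set y : Ch k E := mp h (sdi k M1 j (mp e z)) with hy
  have hy1 := st1 j le_rfl K subset_rfl hK z hz
  rw [← hy] at hy1
  have hylen : y ∈ sp k (fun l => l.length = j) := sp_mono (fun l hl => hl.1) hy1
  have hybd : bd y = 0 := by
    rcases j with _ | j
    · exact bd_len_zero hylen
    · have q1 : mp e z ∈ sp k (fun l => l.length = j + 1) :=
        mp_mem (fun l hl => by simp [hl.1]) hz
      rw [hy, bd_mp, bd_sdi M1 j q1, bd_mp, hz0]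
      simp
  obtain ⟨p, hp⟩ := hp y.support (by
    intro l hl
    rw [sp, Finsupp.mem_supported] at hy1
    obtain ⟨d1, ⟨A, hA, d2⟩, d3⟩ := hy1 hl
    refine ⟨d1, fun x hx y hy => (d3 x hx y hy).trans (min_le_left _ _), fun x hx => ?_⟩
    obtain ⟨w, hw, rfl⟩ := d2 x hx
    exact ⟨w, sim_sub_geom hK hA hw, rfl⟩)
  set Z : Set E := ⋃ l ∈ (y.support : Set (List E)), convexHull ℝ {x | x ∈ p :: l} with hZ
  have hZc : IsCompact Z := (Finset.finite_toSet _).isCompact_biUnion fun l _ => hull_compact _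
  have hZ' : ∀ x ∈ Z, x ≠ 0 ∧ (∃ v, 0 < U x v) ∧
        (Finset.univ.filter (fun v => 0 < U x v)) ∈ K := by
    intro x hx
    obtain ⟨l, hl, hx⟩ := Set.mem_iUnion₂.1 hx
    exact hp l hl x hx
  obtain ⟨κ1, hκ1, hκ1'⟩ := exists_kappa hZc U (fun x hx =>
    (hU _ (hZ' x hx).1).continuousWithinAt) (fun x hx => (hZ' x hx).2.1)
  obtain ⟨δ2, hδ2, hδU⟩ := unif_near hZc U (fun x hx => hU _ (hZ' x hx).1) hκ1
  set Wc : Ch k E := cone p y with hWc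
  obtain ⟨D0, hD0, hWD⟩ := exists_Sm Wc
  obtain ⟨M2, hM2⟩ := exists_M (j + 1) D0 hδ2
  have hW1 : Wc ∈ sp k (fun l => l.length = j + 1 ∧
      (∃ C ∈ (fun l : List E => convexHull ℝ {x | x ∈ p :: l}) '' (y.support : Set (List E)), ∀ x ∈ l, x ∈ C)) := by
    refine cone_mem (P := fun l => l.length = j ∧ l ∈ y.support) ?_ ?_
    · rintro l ⟨g1, g2⟩
      exact ⟨by simp [g1], _, ⟨l, g2, rfl⟩, fun x hx => subset_convexHull ℝ _ hx⟩
    · rw [sp, Finsupp.mem_supported] at hylen ⊢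
      exact fun l hl => ⟨hylen hl, hl⟩
  have hW2 := sdi_mem (k := k) ((fun l : List E => convexHull ℝ {x | x ∈ p :: l}) '' (y.support : Set (List E)))
    (by rintro _ ⟨l, _, rfl⟩; exact convex_convexHull ℝ _) (le_refl (j + 1)) hD0 M2 (c := Wc) (by
      rw [sp, Finsupp.mem_supported] at hW1 hWD ⊢
      exact fun l hl => ⟨(hW1 hl).1, (hW1 hl).2, hWD hl⟩)
  have ht : mp lam (sdi k M2 (j + 1) Wc) ∈ chn k K (j + 1) := by
    refine mp_mem ?_ hW2
    rintro l ⟨g1, ⟨_, ⟨l', hl', rfl⟩, g2⟩, g3⟩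
    refine ⟨by simp [g1], ?_⟩
    have hne : l ≠ [] := by rintro rfl; simp at g1
    obtain ⟨x0, hx0⟩ := List.exists_mem_of_ne_nil l hne
    have hxZ : ∀ x ∈ l, x ∈ Z := fun x hx => Set.mem_biUnion hl' (g2 x hx)
    refine hK ?_ (hZ' x0 (hxZ x0 hx0)).2.2
    intro v hv
    obtain ⟨x, hx, rfl⟩ := List.mem_map.1 (List.mem_toFinset.1 hv)
    rw [Finset.mem_filter]
    exact ⟨Finset.mem_univ _, lab_near (hδU x0 (hxZ x0 hx0) x ((g3 x0 hx0 x hx).trans hM2))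
      (hκ1' x (hxZ x hx))⟩
  have htbd : bd (mp lam (sdi k M2 (j + 1) Wc)) = b M2 j z := by
    have q : Wc ∈ sp k (fun l => l.length = j + 1) := sp_mono (fun l hl => hl.1) hW1
    rw [bd_mp, bd_sdi M2 j q, hWc, bd_cone, hybd, map_zero, sub_zero]
    rfl
  obtain ⟨y', hy', hy'bd⟩ := car M2
  refine ⟨y' + mp lam (sdi k M2 (j + 1) Wc), Submodule.add_mem _ hy' ht, ?_⟩
  rw [map_add, hy'bd, htbd, sub_add_cancel]

end partC2
end Tvb

namespace Tvb

set_option linter.unusedSectionVars false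

section partC3
variable {V : Type*} [Fintype V] [DecidableEq V]
variable {E : Type*} [NormedAddCommGroup E] [NormedSpace ℝ E] [FiniteDimensional ℝ E]

lemma hull_cons {p : E} {l : List E} (hl : l ≠ []) {x : E} (hx : x ∈ convexHull ℝ {x | x ∈ p :: l}) :
    ∃ y ∈ convexHull ℝ {x | x ∈ l}, ∃ a b : ℝ, 0 ≤ a ∧ 0 ≤ b ∧ a + b = 1 ∧ a • p + b • y = x := by
  have e : {x | x ∈ p :: l} = insert p {x | x ∈ l} := by ext; simp
  have hne : {x | x ∈ l}.Nonempty := List.exists_mem_of_ne_nil l hl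
  rw [e, convexHull_insert hne] at hx
  simp only [convexJoin, Set.mem_singleton_iff, Set.iUnion_iUnion_eq_left, Set.mem_iUnion] at hx
  obtain ⟨y, hy, a, b, ha, hb, hab, hx⟩ := hx
  exact ⟨y, hy, a, b, ha, hb, hab, hx⟩

lemma hull_nil {p x : E} (hx : x ∈ convexHull ℝ {x | x ∈ p :: []}) : x = p := by
  have e : {x | x ∈ p :: []} = {p} := by ext; simp
  rw [e, convexHull_singleton] at hx
  exact hx

lemma hull_near {l : List E} {δ : ℝ} (h : Sm δ l) {x0 : E} (hx0 : x0 ∈ l) {y : E}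
    (hy : y ∈ convexHull ℝ {x | x ∈ l}) : dist y x0 ≤ δ := by
  have : convexHull ℝ {x | x ∈ l} ⊆ Metric.closedBall x0 δ :=
    convexHull_min (fun x hx => Metric.mem_closedBall.2 (h x hx x0 hx0)) (convex_closedBall _ _)
  exact Metric.mem_closedBall.1 (this hy)

lemma contAt_G {g : E → V → ℝ} (hg : ContinuousOn g (Metric.sphere 0 1)) {x : E} (hx : x ≠ 0) :
    ContinuousAt (fun x => g (‖x‖⁻¹ • x)) x := by
  have ho : IsOpen {x : E | x ≠ 0} := isOpen_ne
  refine ContinuousOn.continuousAt (s := {x : E | x ≠ 0}) ?_ (ho.mem_nhds hx)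
  refine hg.comp ?_ ?_
  · refine ContinuousOn.smul (ContinuousOn.inv₀ continuous_norm.continuousOn ?_) continuousOn_id
    intro x hx; exact norm_ne_zero_iff.2 hx
  · intro x hx
    have : ‖x‖ ≠ 0 := norm_ne_zero_iff.2 hx
    simp [norm_smul, this]

lemma norm_normalize {x : E} (hx : x ≠ 0) : ‖(‖x‖⁻¹ • x)‖ = 1 := by
  have : ‖x‖ ≠ 0 := norm_ne_zero_iff.2 hx
  simp [norm_smul, this]

lemma sphere_T1 (k : Type*) [Field k] [Nonempty V] {S : Set (Finset V)} (hS : IsLowerSet S)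
    (h : (V → ℝ) → E) (g : E → V → ℝ) (hh : ContinuousOn h (geom S))
    (hg : ContinuousOn g (Metric.sphere 0 1)) (hm : ∀ w ∈ geom S, ‖h w‖ = 1)
    (gm : ∀ x, ‖x‖ = 1 → g x ∈ geom S) (gh : ∀ w ∈ geom S, g (h w) = w)
    (j : ℕ) (hj : j + 1 ≤ Module.finrank ℝ E) : Ac k S j := by
  have key : ∀ w ∈ geom S, (∃ v, 0 < w v) := by
    intro w hw
    by_contra hc
    push Not at hc
    have := Finset.sum_nonpos (s := Finset.univ) (fun v _ => hc v)
    rw [hw.2.1] at this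
    linarith
  refine transfer k hS j h hh (fun w hw h0 => by have := hm w hw; simp [h0] at this)
    (fun x => g (‖x‖⁻¹ • x)) (fun x hx => contAt_G hg hx) ?_ ?_
  · intro w hw
    have : g (‖h w‖⁻¹ • h w) = w := by rw [hm w hw, inv_one, one_smul, gh w hw]
    simp only [this]
    exact ⟨key w hw, fun v hv => hv.ne'⟩
  · refine ⟨1 / 2, by norm_num, fun L hL => ?_⟩
    classical
    have hp : ∃ p : E, ∀ l ∈ L, p ∉ Submodule.span ℝ {x | x ∈ l} := by
      by_contra hc
      push Not at hc
      refine Subspace.biUnion_ne_univ_of_top_notMem (k := ℝ) (E := E)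
        (s := L.image (fun l => Submodule.span ℝ {x | x ∈ l})) ?_ ?_
      · rw [Finset.mem_image]
        rintro ⟨l, hl, hlt⟩
        have e : {x | x ∈ l} = (l.toFinset : Set E) := by ext; simp
        have h1 := finrank_span_finset_le_card (R := ℝ) (M := E) l.toFinset
        rw [e] at hlt
        have h2 := List.toFinset_card_le l
        rw [Set.finrank, hlt, finrank_top] at h1
        have := (hL l hl).1
        omega
      · rw [Set.eq_univ_iff_forall]
        intro p
        obtain ⟨l, hl, hp⟩ := hc p
        exact Set.mem_biUnion (Finset.mem_image_of_mem _ hl) hp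
    obtain ⟨p, hp⟩ := hp
    refine ⟨p, fun l hl x hx => ?_⟩
    have hx0 : x ≠ 0 := by
      by_cases hne : l = []
      · subst hne
        rw [hull_nil hx]
        rintro rfl
        exact hp _ hl (Submodule.zero_mem _)
      · obtain ⟨y, hy, a, b, ha, hb, hab, rfl⟩ := hull_cons hne hx
        intro h0
        have hys : y ∈ Submodule.span ℝ {x | x ∈ l} :=
          convexHull_min Submodule.subset_span (Submodule.convex _) hy
        by_cases ha0 : a = 0
        · subst ha0
          have hb1 : b = 1 := by linarith
          subst hb1
          have hy0 : y = 0 := by simpa using h0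
          obtain ⟨x0, hx0⟩ := List.exists_mem_of_ne_nil l hne
          have h1 := hull_near (hL l hl).2.1 hx0 hy
          obtain ⟨w, hw, rfl⟩ := (hL l hl).2.2 x0 hx0
          rw [hy0, dist_zero_left, hm w hw] at h1
          norm_num at h1
        · apply hp l hl
          have : p = a⁻¹ • (-(b • y)) := by
            rw [eq_inv_smul_iff₀ ha0]
            exact eq_neg_of_add_eq_zero_left h0
          rw [this]
          exact Submodule.smul_mem _ _ (Submodule.neg_mem _ (Submodule.smul_mem _ _ hys))
    have hG := gm _ (norm_normalize hx0)
    refine ⟨hx0, key _ hG, hS ?_ hG.2.2⟩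
    intro v hv
    rw [Finset.mem_filter] at hv
    exact mem_wsupp.2 (ne_of_gt hv.2)

/-- the label weights used for the complement of an open star -/
noncomputable def uw (σ : Finset V) (hσ : σ.Nonempty) (w : V → ℝ) (v : V) : ℝ :=
  w v - if v ∈ σ then σ.inf' hσ w else 0

lemma uw_cont (σ : Finset V) (hσ : σ.Nonempty) : Continuous (uw σ hσ) := by
  refine continuous_pi fun v => (continuous_apply v).sub ?_
  split_ifs
  · exact Continuous.finset_inf'_apply hσ (fun i _ => continuous_apply i)
  · exact continuous_const

lemma uw_le {σ : Finset V} (hσ : σ.Nonempty) {w : V → ℝ} (hw : ∀ v, 0 ≤ w v) (v : V) :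
    uw σ hσ w v ≤ w v := by
  unfold uw
  split_ifs
  · have : 0 ≤ σ.inf' hσ w := Finset.le_inf' hσ _ (fun i _ => hw i)
    linarith
  · linarith

lemma uw_min {σ : Finset V} (hσ : σ.Nonempty) (w : V → ℝ) : ∃ v ∈ σ, uw σ hσ w v = 0 := by
  obtain ⟨v, hv, h⟩ := Finset.exists_mem_eq_inf' hσ w
  exact ⟨v, hv, by simp [uw, hv, h]⟩

/-- barycenter of a face -/
noncomputable def bary (σ : Finset V) (v : V) : ℝ := if v ∈ σ then (σ.card : ℝ)⁻¹ else 0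

lemma bary_mem {S : Set (Finset V)} {σ : Finset V} (hσ : σ.Nonempty) (h : σ ∈ S) : bary σ ∈ geom S := by
  have hc : (σ.card : ℝ) ≠ 0 := by simpa using hσ.ne_empty
  refine ⟨fun v => ?_, ?_, ?_⟩
  · unfold bary; split_ifs <;> positivity
  · simp [bary, hc]
  · have : wsupp (bary σ) = σ := by
      ext v
      rw [mem_wsupp, bary]
      split_ifs with hv <;> simp [hv, hc]
    rwa [this]

lemma bary_supp {σ : Finset V} (hσ : σ.Nonempty) : wsupp (bary σ) = σ := by
  have hc : (σ.card : ℝ) ≠ 0 := by simpa using hσ.ne_empty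
  ext v
  rw [mem_wsupp, bary]
  split_ifs with hv <;> simp [hv, hc]

lemma uw_pos {S : Set (Finset V)} {σ : Finset V} (hσ : σ.Nonempty) {w : V → ℝ} (hw : w ∈ geom S)
    (hne : w ≠ bary σ) : ∃ v, 0 < uw σ hσ w v := by
  by_contra hc
  push Not at hc
  apply hne
  have h1 : ∀ v, w v = if v ∈ σ then σ.inf' hσ w else 0 := by
    intro v
    have := hc v
    unfold uw at this
    split_ifs at this ⊢ with hv
    · exact le_antisymm (by linarith) (Finset.inf'_le _ hv)
    · exact le_antisymm (by linarith) (hw.1 v)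
  have h2 := hw.2.1
  rw [Finset.sum_congr rfl (fun v _ => h1 v)] at h2
  have hc : (σ.card : ℝ) ≠ 0 := by simpa using hσ.ne_empty
  simp only [Finset.sum_ite_mem, Finset.univ_inter, Finset.sum_const, nsmul_eq_mul] at h2
  funext v
  rw [h1 v, bary, eq_inv_of_mul_eq_one_right h2]

lemma sphere_T2 (k : Type*) [Field k] [Nonempty V] {S : Set (Finset V)} (hS : IsLowerSet S)
    (h : (V → ℝ) → E) (g : E → V → ℝ) (hh : ContinuousOn h (geom S))
    (hg : ContinuousOn g (Metric.sphere 0 1)) (hm : ∀ w ∈ geom S, ‖h w‖ = 1)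
    (gm : ∀ x, ‖x‖ = 1 → g x ∈ geom S) (gh : ∀ w ∈ geom S, g (h w) = w)
    (hgx : ∀ x, ‖x‖ = 1 → h (g x) = x)
    (σ : Finset V) (hσS : σ ∈ S) (hσ : σ.Nonempty) (j : ℕ) : Ac k {A | A ∈ S ∧ ¬ σ ⊆ A} j := by
  set K : Set (Finset V) := {A | A ∈ S ∧ ¬ σ ⊆ A} with hKd
  have hK : IsLowerSet K := fun A B hBA hA => ⟨hS hBA hA.1, fun h => hA.2 (h.trans hBA)⟩
  have hKS : geom K ⊆ geom S := fun w hw => ⟨hw.1, hw.2.1, hw.2.2.1⟩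
  have hβK : bary σ ∉ geom K := by
    intro hc
    have := hc.2.2.2
    rw [bary_supp hσ] at this
    exact this subset_rfl
  have hβ := bary_mem hσ hσS
  set q := h (bary σ) with hq
  have hq1 : ‖q‖ = 1 := hm _ hβ
  have hhK : ContinuousOn h (geom K) := hh.mono hKS
  have hKh : IsCompact (h '' geom K) := (geom_compact hK).image_of_continuousOn hhK
  obtain ⟨η, hη, hη'⟩ : ∃ η > 0, ∀ w ∈ geom K, η ≤ dist (h w) q := by
    have hqn : q ∉ h '' geom K := by
      rintro ⟨w, hw, hwq⟩
      have := gh w (hKS hw)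
      rw [hwq, hq, gh _ hβ] at this
      rw [← this] at hw
      exact hβK hw
    have ho : (h '' geom K)ᶜ ∈ nhds q := hKh.isClosed.isOpen_compl.mem_nhds hqn
    obtain ⟨η, hη, hsub⟩ := Metric.mem_nhds_iff.1 ho
    refine ⟨η, hη, fun w hw => ?_⟩
    by_contra hc
    push Not at hc
    exact hsub (Metric.mem_ball.2 hc) ⟨w, hw, rfl⟩
  refine transfer k hK j h hhK (fun w hw h0 => by have := hm w (hKS hw); simp [h0] at this)
    (fun x => uw σ hσ (g (‖x‖⁻¹ • x)))
    (fun x hx => ((uw_cont σ hσ).continuousAt).comp (f := fun x => g (‖x‖⁻¹ • x)) (contAt_G hg hx)) ?_ ?_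
  · intro w hw
    have : g (‖h w‖⁻¹ • h w) = w := by rw [hm w (hKS hw), inv_one, one_smul, gh w (hKS hw)]
    simp only [this]
    refine ⟨uw_pos hσ (hKS hw) (fun hc => hβK (hc ▸ hw)), fun v hv => ?_⟩
    exact (lt_of_lt_of_le hv (uw_le hσ hw.1 v)).ne'
  · refine ⟨η / 3, by positivity, fun L hL => ⟨-q, fun l hl x hx => ?_⟩⟩
    have hxq : ∀ s : ℝ, 0 ≤ s → x ≠ s • q := by
      intro s hs hxs
      have hq0 : q ≠ 0 := by rintro h0; rw [h0] at hq1; simp at hq1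
      by_cases hne : l = []
      · subst hne
        rw [hull_nil hx] at hxs
        have : (s + 1) • q = 0 := by rw [add_smul, ← hxs, one_smul]; simp
        rcases smul_eq_zero.1 this with h | h
        · linarith
        · exact hq0 h
      · obtain ⟨y, hy, a, b, ha, hb, hab, hxy⟩ := hull_cons hne hx
        have h1 : b • y = (s + a) • q := by
          rw [add_smul, ← hxs, ← hxy]; simp
        by_cases hb0 : b = 0
        · rw [hb0, zero_smul] at h1
          rcases smul_eq_zero.1 h1.symm with h | h
          · linarith
          · exact hq0 h
        · obtain ⟨c, hc, hyc⟩ : ∃ c : ℝ, 0 ≤ c ∧ y = c • q := by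
            refine ⟨b⁻¹ * (s + a), by positivity, ?_⟩
            rw [mul_smul, ← h1, inv_smul_smul₀ hb0]
          obtain ⟨x0, hx0⟩ := List.exists_mem_of_ne_nil l hne
          have h2 := hull_near (hL l hl).2.1 hx0 hy
          obtain ⟨w, hw, rfl⟩ := (hL l hl).2.2 x0 hx0
          have h3 := hη' w hw
          have h4 : |c - 1| ≤ η / 3 := by
            have : |‖y‖ - ‖h w‖| ≤ ‖y - h w‖ := abs_norm_sub_norm_le _ _
            rw [hm w (hKS hw), hyc, norm_smul, hq1, mul_one, Real.norm_of_nonneg hc, ← hyc,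
              ← dist_eq_norm] at this
            exact this.trans h2
          have h5 : dist y q = |c - 1| := by
            rw [dist_eq_norm, hyc]
            have : c • q - q = (c - 1) • q := by rw [sub_smul, one_smul]
            rw [this, norm_smul, hq1, mul_one, Real.norm_eq_abs]
          have h6 := dist_triangle (h w) y q
          rw [dist_comm (h w) y] at h6
          linarith
    have hx0 : x ≠ 0 := by simpa using hxq 0 le_rfl
    have hG := gm _ (norm_normalize hx0)
    have hGb : g (‖x‖⁻¹ • x) ≠ bary σ := by
      intro hc
      have h1 := hgx _ (norm_normalize hx0)
      rw [hc, ← hq] at h1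
      refine hxq ‖x‖ (norm_nonneg _) ?_
      rw [h1, smul_inv_smul₀ (norm_ne_zero_iff.2 hx0)]
    refine ⟨hx0, uw_pos hσ hG hGb, hS ?_ hG.2.2, ?_⟩
    · intro v hv
      rw [Finset.mem_filter] at hv
      exact mem_wsupp.2 (lt_of_lt_of_le hv.2 (uw_le hσ hG.1 v)).ne'
    · intro hsub
      obtain ⟨v, hv, h0⟩ := uw_min hσ (g (‖x‖⁻¹ • x))
      have := hsub hv
      rw [Finset.mem_filter, h0] at this
      exact lt_irrefl _ this.2

end partC3
end Tvb

namespace Tvb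

set_option linter.unusedSectionVars false

section partE
variable {k : Type*} [Field k] {V : Type*} [Fintype V] [DecidableEq V] {G : Type*} [Fintype G] [DecidableEq G]

/-- the color `i` part of a set of colored vertices -/
def sl (A : Finset (Option V × G)) (i : G) : Finset V := Finset.univ.filter (fun v => (some v, i) ∈ A)

@[simp] lemma mem_sl {A : Finset (Option V × G)} {i : G} {v : V} : v ∈ sl A i ↔ (some v, i) ∈ A := by
  simp [sl]

/-- a set of vertices colored by `i` -/
def tc (τ : Finset V) (i : G) : Finset (Option V × G) := τ.image (fun v => (some v, i))

@[simp] lemma mem_tc {τ : Finset V} {i : G} {x : Option V × G} :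
    x ∈ tc τ i ↔ ∃ v ∈ τ, (some v, i) = x := by simp [tc]

lemma tc_card (τ : Finset V) (i : G) : (tc τ i).card = τ.card :=
  Finset.card_image_of_injective _ (fun a b h => by simpa using h)

lemma sl_union_tc (A : Finset (Option V × G)) (τ : Finset V) (i : G) :
    sl (A ∪ tc τ i) i = sl A i ∪ τ := by
  ext v; simp

lemma color_step {K : Set (Finset (Option V × G))} (hK : IsLowerSet K) (i : G) {j : ℕ}
    (h0 : Ac k {A | A ∈ K ∧ sl A i = ∅} j)
    (hl : ∀ τ : Finset V, τ.Nonempty → ∀ i', i' + τ.card = j →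
      Ac k {A | A ∪ tc τ i ∈ K ∧ sl A i = ∅} i') : Ac k K j := by
  have key : ∀ c : ℕ, ∀ Q : Finset (Finset V), Q.card = c → ∅ ∈ Q →
      (∀ A ∈ Q, ∀ B ⊆ A, B ∈ Q) → Ac k {A | A ∈ K ∧ sl A i ∈ Q} j := by
    intro c
    induction c with
    | zero => intro Q hQ h; rw [Finset.card_eq_zero.1 hQ] at h; simp at h
    | succ c ih =>
      intro Q hQ hQ0 hQl
      obtain ⟨τ, hτ, hmax⟩ := Finset.exists_max_image Q Finset.card ⟨_, hQ0⟩
      rcases τ.eq_empty_or_nonempty with rfl | hne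
      · have : Q = {∅} := by
          ext A
          rw [Finset.mem_singleton]
          refine ⟨fun hA => ?_, fun hA => hA ▸ hQ0⟩
          have := hmax A hA
          simpa using this
        rw [this]
        convert h0 using 3
        simp
      · have hsup : ∀ A ∈ Q, τ ⊆ A → τ = A := fun A hA h => Finset.eq_of_subset_of_card_le h (hmax A hA)
        refine Ac_del (τ := tc τ i) ?_ ?_ ?_ ?_
        · intro A B hBA hA
          refine ⟨hK hBA hA.1, hQl _ hA.2 _ ?_⟩
          intro v hv
          rw [mem_sl] at hv ⊢
          exact hBA hv
        · obtain ⟨v, hv⟩ := hne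
          exact ⟨(some v, i), by simp [hv]⟩
        · convert ih (Q.erase τ) (by rw [Finset.card_erase_of_mem hτ, hQ]; rfl)
            (Finset.mem_erase.2 ⟨hne.ne_empty.symm, hQ0⟩) ?_ using 1
          · ext A
            have : tc τ i ⊆ A ↔ τ ⊆ sl A i := by
              constructor
              · intro h v hv
                rw [mem_sl]; exact h (by simp [hv])
              · intro h x hx
                obtain ⟨v, hv, rfl⟩ := mem_tc.1 hx
                exact mem_sl.1 (h hv)
            simp only [Set.mem_ofPred_eq, Finset.mem_erase, this]
            constructor
            · rintro ⟨⟨h1, h2⟩, h3⟩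
              exact ⟨h1, fun h => h3 h.symm.subset, h2⟩
            · rintro ⟨h1, h2, h3⟩
              exact ⟨⟨h1, h3⟩, fun h => h2 (hsup _ h3 h).symm⟩
          · intro A hA B hBA
            rw [Finset.mem_erase] at hA ⊢
            refine ⟨?_, hQl A hA.2 B hBA⟩
            rintro rfl
            exact hA.1 (hsup A hA.2 hBA).symm
        · intro i' hi'
          rw [tc_card] at hi'
          convert hl τ hne i' hi' using 1
          ext A
          simp only [Set.mem_ofPred_eq, sl_union_tc]
          constructor
          · rintro ⟨⟨h1, h2⟩, h3⟩
            refine ⟨h1, ?_⟩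
            have h4 := hsup _ h2 Finset.subset_union_right
            rw [Finset.eq_empty_iff_forall_notMem]
            intro v hv
            have hv' : v ∈ τ := by rw [h4]; exact Finset.mem_union_left _ hv
            exact Finset.disjoint_left.1 h3 (mem_sl.1 hv) (by simp [hv'])
          · rintro ⟨h1, h2⟩
            refine ⟨⟨h1, by rw [h2, Finset.empty_union]; exact hτ⟩, ?_⟩
            rw [Finset.disjoint_right]
            intro x hx hxA
            obtain ⟨v, hv, rfl⟩ := mem_tc.1 hx
            have := mem_sl.2 hxA
            rw [h2] at this
            simp at this
  convert key _ Finset.univ rfl (Finset.mem_univ _) (fun _ _ _ _ => Finset.mem_univ _) using 1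
  ext A; simp

/-- deleted join of copies (colors in `J`) of `S` minus `U` -/
def XX (S : Set (Finset V)) (J : Finset G) (U : Finset V) : Set (Finset (Option V × G)) :=
  {A | (∀ x ∈ A, x.2 ∈ J ∧ ∃ v, x.1 = some v ∧ v ∉ U) ∧ (∀ i, sl A i ∈ S) ∧
    ∀ v i j, (some v, i) ∈ A → (some v, j) ∈ A → i = j}

/-- cone over the `i`-th copy -/
def CC (S : Set (Finset V)) (i : G) : Set (Finset (Option V × G)) :=
  {A | (∀ x ∈ A, x.2 = i) ∧ sl A i ∈ S}

lemma sl_mono {A B : Finset (Option V × G)} (h : A ⊆ B) (i : G) : sl A i ⊆ sl B i := by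
  intro v hv
  rw [mem_sl] at hv ⊢
  exact h hv

lemma XX_lower {S : Set (Finset V)} (hS : IsLowerSet S) (J : Finset G) (U : Finset V) :
    IsLowerSet (XX S J U) := fun A B hBA hA =>
  ⟨fun x hx => hA.1 x (hBA hx), fun i => hS (sl_mono hBA i) (hA.2.1 i),
    fun v i i' h1 h2 => hA.2.2 v i i' (hBA h1) (hBA h2)⟩

lemma CC_lower {S : Set (Finset V)} (hS : IsLowerSet S) (i : G) : IsLowerSet (CC S i) :=
  fun A B hBA hA => ⟨fun x hx => hA.1 x (hBA hx), hS (sl_mono hBA i) hA.2⟩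

lemma CC_Ac {S : Set (Finset V)} (i : G) (j : ℕ) : Ac k (CC S i) j := by
  refine Ac_cone (none, i) ?_ j
  rintro A ⟨h1, h2⟩
  refine ⟨?_, ?_⟩
  · intro x hx
    rcases Finset.mem_insert.1 hx with rfl | hx
    · rfl
    · exact h1 x hx
  · have : sl (insert (none, i) A) i = sl A i := by ext v; simp
    rwa [this]

lemma XX_single [Nonempty V] {S : Set (Finset V)} (h0 : ∅ ∈ S) (hS : IsLowerSet S) (i : G) (U : Finset V) {j : ℕ}
    (h : Ac k {A | A ∈ S ∧ Disjoint A U} j) : Ac k (XX S {i} U) j := by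
  refine Ac_image (fun v => (some v, i)) (fun x => x.1.getD (Classical.arbitrary V)) ?_ ?_ ?_ h
  · rintro A ⟨hA, hAU⟩
    have hsl : ∀ i', sl (A.image (fun v => ((some v, i) : Option V × G))) i' ⊆ A := by
      intro i' v hv
      simp only [mem_sl, Finset.mem_image] at hv
      obtain ⟨a, ha, he⟩ := hv
      simp only [Prod.mk.injEq, Option.some.injEq] at he
      exact he.1 ▸ ha
    refine ⟨?_, fun i' => hS (hsl i') hA, ?_⟩
    · intro x hx
      obtain ⟨v, hv, rfl⟩ := Finset.mem_image.1 hx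
      exact ⟨by simp, v, rfl, Finset.disjoint_left.1 hAU hv⟩
    · intro v i1 i2 h1 h2
      obtain ⟨a, _, ha⟩ := Finset.mem_image.1 h1
      obtain ⟨b, _, hb⟩ := Finset.mem_image.1 h2
      simp only [Prod.mk.injEq] at ha hb
      exact ha.2.symm.trans hb.2
  · rintro A ⟨h1, h2, h3⟩
    have : A.image (fun x => x.1.getD (Classical.arbitrary V)) = sl A i := by
      ext v
      simp only [Finset.mem_image, mem_sl]
      constructor
      · rintro ⟨⟨o, i'⟩, hx, rfl⟩
        obtain ⟨h4, w, hw, _⟩ := h1 _ hx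
        simp only at h4 hw
        rw [Finset.mem_singleton] at h4
        subst h4 hw
        exact hx
      · intro hv
        exact ⟨_, hv, rfl⟩
    rw [this]
    refine ⟨h2 i, ?_⟩
    rw [Finset.disjoint_left]
    intro v hv hvU
    obtain ⟨_, w, hw, hwU⟩ := h1 _ (mem_sl.1 hv)
    simp only [Option.some.injEq] at hw
    exact hwU (hw ▸ hvU)
  · rintro A ⟨h1, h2, h3⟩ ⟨o, i'⟩ hx
    obtain ⟨h4, w, hw, _⟩ := h1 _ hx
    simp only at h4 hw
    rw [Finset.mem_singleton] at h4
    subst h4 hw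
    rfl

lemma XX_link {S : Set (Finset V)} (hS : IsLowerSet S) {i : G} {J : Finset G} (hi : i ∉ J)
    {τ U : Finset V} (hτ : τ ∈ S) (hτU : Disjoint τ U) :
    {A | A ∪ tc τ i ∈ XX S (insert i J) U ∧ sl A i = ∅} = XX S J (U ∪ τ) := by
  ext A
  constructor
  · rintro ⟨⟨h1, h2, h3⟩, h4⟩
    refine ⟨?_, fun i' => hS (sl_mono Finset.subset_union_left i') (h2 i'),
      fun v a b ha hb => h3 v a b (Finset.mem_union_left _ ha) (Finset.mem_union_left _ hb)⟩
    rintro ⟨o, i'⟩ hx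
    obtain ⟨h5, v, hv, hvU⟩ := h1 _ (Finset.mem_union_left _ hx)
    simp only at h5 hv
    subst hv
    have hne : i' ≠ i := by
      rintro rfl
      have := mem_sl.2 hx
      rw [h4] at this
      simp at this
    refine ⟨(Finset.mem_insert.1 h5).resolve_left hne, v, rfl, ?_⟩
    rw [Finset.mem_union]
    rintro (h | h)
    · exact hvU h
    · exact hne (h3 v i' i (Finset.mem_union_left _ hx) (Finset.mem_union_right _ (by simp [h])))
  · rintro ⟨h1, h2, h3⟩
    have h4 : sl A i = ∅ := by
      rw [Finset.eq_empty_iff_forall_notMem]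
      intro v hv
      exact hi (h1 _ (mem_sl.1 hv)).1
    have hvd : ∀ v i', (some v, i') ∈ A → v ∉ τ := by
      intro v i' hv hvτ
      obtain ⟨_, w, hw, hwU⟩ := h1 _ hv
      simp only [Option.some.injEq] at hw
      subst hw
      exact hwU (Finset.mem_union_right _ hvτ)
    refine ⟨⟨?_, ?_, ?_⟩, h4⟩
    · intro x hx
      rcases Finset.mem_union.1 hx with hx | hx
      · obtain ⟨h5, v, hv, hvU⟩ := h1 _ hx
        exact ⟨Finset.mem_insert_of_mem h5, v, hv, fun h => hvU (Finset.mem_union_left _ h)⟩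
      · obtain ⟨v, hv, rfl⟩ := mem_tc.1 hx
        exact ⟨by simp, v, rfl, Finset.disjoint_left.1 hτU hv⟩
    · intro i'
      by_cases hii : i' = i
      · subst hii
        rw [sl_union_tc, h4, Finset.empty_union]; exact hτ
      · have : sl (A ∪ tc τ i) i' = sl A i' := by
          ext v
          simp [Ne.symm hii]
        rw [this]; exact h2 i'
    · intro v a b ha hb
      rcases Finset.mem_union.1 ha with ha | ha <;> rcases Finset.mem_union.1 hb with hb | hb
      · exact h3 v a b ha hb
      · obtain ⟨w, hw, he⟩ := mem_tc.1 hb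
        simp only [Prod.mk.injEq, Option.some.injEq] at he
        exact absurd (he.1 ▸ hw) (hvd v a ha)
      · obtain ⟨w, hw, he⟩ := mem_tc.1 ha
        simp only [Prod.mk.injEq, Option.some.injEq] at he
        exact absurd (he.1 ▸ hw) (hvd v b hb)
      · obtain ⟨w, hw, he⟩ := mem_tc.1 ha
        obtain ⟨w', hw', he'⟩ := mem_tc.1 hb
        simp only [Prod.mk.injEq] at he he'
        exact he.2.symm.trans he'.2

lemma XX_link_empty {S : Set (Finset V)} (hS : IsLowerSet S) {i : G} {J : Finset G}
    {τ U : Finset V} (h : ¬ (τ ∈ S ∧ Disjoint τ U)) :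
    {A | A ∪ tc τ i ∈ XX S J U ∧ sl A i = ∅} = ∅ := by
  rw [Set.eq_empty_iff_forall_notMem]
  rintro A ⟨⟨h1, h2, h3⟩, h4⟩
  apply h
  refine ⟨?_, ?_⟩
  · have := h2 i
    rwa [sl_union_tc, h4, Finset.empty_union] at this
  · rw [Finset.disjoint_left]
    intro v hv hvU
    obtain ⟨_, w, hw, hwU⟩ := h1 (some v, i) (Finset.mem_union_right _ (by simp [hv]))
    simp only [Option.some.injEq] at hw
    exact hwU (hw ▸ hvU)

lemma XX_restrict {S : Set (Finset V)} {i : G} {J : Finset G} (hi : i ∉ J)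
    {U : Finset V} : {A | A ∈ XX S (insert i J) U ∧ sl A i = ∅} = XX S J U := by
  ext A
  constructor
  · rintro ⟨⟨h1, h2, h3⟩, h4⟩
    refine ⟨?_, h2, h3⟩
    rintro ⟨o, i'⟩ hx
    obtain ⟨h5, v, hv, hvU⟩ := h1 _ hx
    simp only at h5 hv
    subst hv
    have hne : i' ≠ i := by
      rintro rfl
      have := mem_sl.2 hx
      rw [h4] at this
      simp at this
    exact ⟨(Finset.mem_insert.1 h5).resolve_left hne, v, rfl, hvU⟩
  · rintro ⟨h1, h2, h3⟩
    have h4 : sl A i = ∅ := by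
      rw [Finset.eq_empty_iff_forall_notMem]
      intro v hv
      exact hi (h1 _ (mem_sl.1 hv)).1
    exact ⟨⟨fun x hx => ⟨Finset.mem_insert_of_mem (h1 x hx).1, (h1 x hx).2⟩, h2, h3⟩, h4⟩

variable [Nonempty V] {S : Set (Finset V)} {n : ℕ}

lemma XX_Ac (h0 : ∅ ∈ S) (hS : IsLowerSet S)
    (HU : ∀ U : Finset V, U.Nonempty → ∀ j, j + U.card ≤ n → Ac k {A | A ∈ S ∧ Disjoint A U} j)
    (J : Finset G) (hJ : J.Nonempty) : ∀ (U : Finset V), U.Nonempty → ∀ j, j + U.card ≤ n →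
      Ac k (XX S J U) j := by
  induction hJ using Finset.Nonempty.cons_induction with
  | singleton i => intro U hU j hj; exact XX_single h0 hS i U (HU U hU j hj)
  | cons i J hi hJ ih =>
    intro U hU j hj
    rw [Finset.cons_eq_insert]
    refine color_step (XX_lower hS _ _) i ?_ ?_
    · rw [XX_restrict hi]; exact ih U hU j hj
    · intro τ hτ i' hi'
      by_cases hc : τ ∈ S ∧ Disjoint τ U
      · rw [XX_link hS hi hc.1 hc.2]
        refine ih _ (hU.mono Finset.subset_union_left) i' ?_
        have := Finset.card_union_le U τ
        omega
      · rw [XX_link_empty hS hc]; exact Ac_empty _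

lemma YY_Ac (h0 : ∅ ∈ S) (hS : IsLowerSet S)
    (HU : ∀ U : Finset V, U.Nonempty → ∀ j, j + U.card ≤ n → Ac k {A | A ∈ S ∧ Disjoint A U} j)
    (i0 : G) (J : Finset G) (hi0 : i0 ∉ J) : ∀ j ≤ n, Ac k (XX S (insert i0 J) ∅ ∪ CC S i0) j := by
  induction J using Finset.induction_on with
  | empty =>
    intro j hj
    have : XX S (insert i0 ∅) ∅ ∪ CC S i0 = CC S i0 := by
      rw [Set.union_eq_right]
      rintro A ⟨h1, h2, h3⟩
      exact ⟨fun x hx => by simpa using (h1 x hx).1, h2 i0⟩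
    rw [this]
    exact CC_Ac i0 j
  | insert i J hi ih =>
    intro j hj
    rw [Finset.mem_insert, not_or] at hi0
    have hi' : i ∉ insert i0 J := by
      rw [Finset.mem_insert, not_or]; exact ⟨Ne.symm hi0.1, hi⟩
    rw [Finset.insert_comm]
    refine color_step ((XX_lower hS _ _).union (CC_lower hS _)) i ?_ ?_
    · convert ih hi0.2 j hj using 1
      rw [← XX_restrict hi']
      ext A
      simp only [Set.mem_union, Set.mem_ofPred_eq]
      have : A ∈ CC S i0 → sl A i = ∅ := by
        rintro ⟨h1, h2⟩
        rw [Finset.eq_empty_iff_forall_notMem]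
        intro v hv
        exact hi0.1 (h1 _ (mem_sl.1 hv)).symm
      tauto
    · intro τ hτ i' hii
      have e : {A | A ∪ tc τ i ∈ XX S (insert i (insert i0 J)) ∅ ∪ CC S i0 ∧ sl A i = ∅} =
          {A | A ∪ tc τ i ∈ XX S (insert i (insert i0 J)) ∅ ∧ sl A i = ∅} := by
        ext A
        simp only [Set.mem_union, Set.mem_ofPred_eq]
        have : ¬ (A ∪ tc τ i ∈ CC S i0) := by
          rintro ⟨h1, h2⟩
          obtain ⟨v, hv⟩ := hτ
          exact hi0.1 (h1 (some v, i) (Finset.mem_union_right _ (by simp [hv]))).symm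
        tauto
      rw [e]
      by_cases hc : τ ∈ S ∧ Disjoint τ ∅
      · rw [XX_link hS hi' hc.1 hc.2, Finset.empty_union]
        exact XX_Ac h0 hS HU _ (Finset.insert_nonempty _ _) τ hτ i' (by omega)
      · rw [XX_link_empty hS hc]; exact Ac_empty _

/-- the deleted join with cones -/
def XP (S : Set (Finset V)) (G : Type*) [Fintype G] [DecidableEq G] : Set (Finset (Option V × G)) :=
  {A | A ∈ XX S Finset.univ ∅ ∨ ∃ i, A ∈ CC S i}

lemma XP_lower (hS : IsLowerSet S) : IsLowerSet (XP S G) := by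
  rintro A B hBA (h | ⟨i, h⟩)
  · exact Or.inl (XX_lower hS _ _ hBA h)
  · exact Or.inr ⟨i, CC_lower hS _ hBA h⟩

lemma XP_Ac [Nonempty G] (h0 : ∅ ∈ S) (hS : IsLowerSet S)
    (HS : ∀ j, j + 1 ≤ n → Ac k S j)
    (HU : ∀ U : Finset V, U.Nonempty → ∀ j, j + U.card ≤ n → Ac k {A | A ∈ S ∧ Disjoint A U} j)
    (j : ℕ) (hj : j ≤ n) : Ac k (XP S G) j := by
  have key : ∀ I : Finset G, I.Nonempty → Ac k {A | A ∈ XX S Finset.univ ∅ ∨ ∃ i ∈ I, A ∈ CC S i} j := by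
    intro I hI
    induction hI using Finset.Nonempty.cons_induction with
    | singleton i0 =>
      convert YY_Ac h0 hS HU i0 (Finset.univ.erase i0) (Finset.notMem_erase _ _) j hj using 1
      rw [Finset.insert_erase (Finset.mem_univ _)]
      ext A; simp
    | cons i I hi hI ih =>
      have e : {A | A ∈ XX S Finset.univ ∅ ∨ ∃ i' ∈ Finset.cons i I hi, A ∈ CC S i'} =
          {A | A ∈ XX S Finset.univ ∅ ∨ ∃ i ∈ I, A ∈ CC S i} ∪ CC S i := by
        ext A
        simp only [Set.mem_ofPred_eq, Set.mem_union, Finset.mem_cons]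
        constructor
        · rintro (h | ⟨a, rfl | ha, h⟩)
          · exact Or.inl (Or.inl h)
          · exact Or.inr h
          · exact Or.inl (Or.inr ⟨a, ha, h⟩)
        · rintro ((h | ⟨a, ha, h⟩) | h)
          · exact Or.inl h
          · exact Or.inr ⟨a, Or.inr ha, h⟩
          · exact Or.inr ⟨i, Or.inl rfl, h⟩
      rw [e]
      refine Ac_union ?_ (CC_lower hS i) ih (CC_Ac i j) ?_
      · rintro A B hBA (h | ⟨i, hi, h⟩)
        · exact Or.inl (XX_lower hS _ _ hBA h)
        · exact Or.inr ⟨i, hi, CC_lower hS _ hBA h⟩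
      · intro i' hi'
        have e2 : {A | A ∈ XX S Finset.univ ∅ ∨ ∃ i ∈ I, A ∈ CC S i} ∩ CC S i = XX S {i} ∅ := by
          ext A
          constructor
          · rintro ⟨(⟨h1, h2, h3⟩ | ⟨a, ha, h1⟩), h4⟩
            · exact ⟨fun x hx => ⟨by simpa using h4.1 x hx, (h1 x hx).2⟩, h2, h3⟩
            · have : A = ∅ := by
                rw [Finset.eq_empty_iff_forall_notMem]
                intro x hx
                have := h1.1 x hx
                have h6 := h4.1 x hx
                exact hi (h6 ▸ this ▸ ha)
              subst this
              refine ⟨by simp, fun i' => ?_, by simp⟩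
              have : sl (∅ : Finset (Option V × G)) i' = ∅ := by ext; simp
              rw [this]; exact h0
          · rintro ⟨h1, h2, h3⟩
            refine ⟨Or.inl ⟨fun x hx => ⟨Finset.mem_univ _, (h1 x hx).2⟩, h2, h3⟩, ?_, h2 i⟩
            intro x hx
            simpa using (h1 x hx).1
        rw [e2]
        refine XX_single h0 hS i ∅ ?_
        convert HS i' (by omega) using 1
        ext A; simp
  convert key Finset.univ Finset.univ_nonempty using 1
  ext A; simp [XP]

end partE
end Tvb

namespace Tvb
set_option linter.unusedSectionVars false

/-! ### The group algebra acting on chains -/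

section galg

variable {k : Type*} [Field k] {Ω Ω' : Type*} {G : Type*} [Fintype G] [DecidableEq G] [AddCommGroup G]

lemma ga_ext {M : Type*} [AddCommGroup M] [Module k M] {f g : AddMonoidAlgebra k G →ₗ[k] M}
    (h : ∀ a, f (AddMonoidAlgebra.single a 1) = g (AddMonoidAlgebra.single a 1)) (u) : f u = g u := by
  induction u using AddMonoidAlgebra.induction_on with
  | of m => exact h m
  | add x y hx hy => rw [map_add, map_add, hx, hy]
  | smul r x hx => rw [map_smul, map_smul, hx]

/-- the linear functional on the group algebra with given values -/
noncomputable def fn (φ : G → k) : AddMonoidAlgebra k G →ₗ[k] k where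
  toFun u := ∑ a, u.coeff a * φ a
  map_add' u v := by simp [add_mul, Finset.sum_add_distrib]
  map_smul' r u := by simp [mul_assoc, Finset.mul_sum]

lemma fn_single (φ : G → k) (a : G) (r : k) : fn φ (AddMonoidAlgebra.single a r) = r * φ a := by
  simp [fn, Finsupp.single_apply]

/-- bilinear form on the group algebra with given values -/
noncomputable def bil (w : G → G → k) : AddMonoidAlgebra k G →ₗ[k] AddMonoidAlgebra k G →ₗ[k] k :=
  LinearMap.mk₂ k (fun u v => ∑ a, u.coeff a * fn (w a) v)
    (by intros; simp [add_mul, Finset.sum_add_distrib])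
    (by intros; simp [mul_assoc, Finset.mul_sum])
    (by intros; simp [mul_add, Finset.sum_add_distrib])
    (by intros; simp only [map_smul, smul_eq_mul, Finset.mul_sum]; exact Finset.sum_congr rfl (fun _ _ => by ring))

lemma bil_apply (w : G → G → k) (u v) : bil w u v = ∑ a, u.coeff a * fn (w a) v := rfl

lemma bil_single (w : G → G → k) (a b : G) :
    bil w (AddMonoidAlgebra.single a 1) (AddMonoidAlgebra.single b 1) = w a b := by
  simp [bil_apply, fn_single, Finsupp.single_apply]

lemma bil_ext {f g : AddMonoidAlgebra k G →ₗ[k] AddMonoidAlgebra k G →ₗ[k] k}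
    (h : ∀ a b, f (AddMonoidAlgebra.single a 1) (AddMonoidAlgebra.single b 1) =
      g (AddMonoidAlgebra.single a 1) (AddMonoidAlgebra.single b 1)) (u v) : f u v = g u v := by
  have : f u = g u := ga_ext (fun a => LinearMap.ext (ga_ext (fun b => h a b))) u
  rw [this]

lemma bil_add_eq (φ : G → k) (u v) : bil (fun a b => φ (a + b)) u v = fn φ (u * v) := by
  refine bil_ext (g := LinearMap.mk₂ k (fun u v => fn φ (u * v)) ?_ ?_ ?_ ?_) ?_ u v
  · intros; rw [add_mul, map_add]
  · intros; rw [smul_mul_assoc, map_smul]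
  · intros; rw [mul_add, map_add]
  · intros; rw [mul_smul_comm, map_smul]
  · intro a b
    rw [bil_single, LinearMap.mk₂_apply, AddMonoidAlgebra.single_mul_single, fn_single]; simp

lemma bil_snd (φ : G → k) (u v) : bil (fun _ b => φ b) u v = fn 1 u * fn φ v := by
  rw [bil_apply, ← Finset.sum_mul]
  simp [fn]

lemma bil_map {G' : Type*} [Fintype G'] [DecidableEq G'] [AddCommGroup G'] (χ : G →+ G')
    (w : G' → G' → k) (u v) : bil (fun a b => w (χ a) (χ b)) u v =
      bil w (AddMonoidAlgebra.mapDomainAlgHom k k χ u) (AddMonoidAlgebra.mapDomainAlgHom k k χ v) := by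
  refine bil_ext (g := (bil w).compl₁₂ (AddMonoidAlgebra.mapDomainAlgHom k k χ).toLinearMap
    (AddMonoidAlgebra.mapDomainAlgHom k k χ).toLinearMap) ?_ u v
  intro a b
  simp [bil_single]

/-- the action of the group algebra on chains induced by an action on points -/
noncomputable def rh (τ : G → Ω → Ω) : AddMonoidAlgebra k G →ₗ[k] (Ch k Ω →ₗ[k] Ch k Ω) where
  toFun u := ∑ a, u.coeff a • mp (τ a)
  map_add' u v := by simp [add_smul, Finset.sum_add_distrib]
  map_smul' r u := by simp [smul_smul, Finset.smul_sum]

lemma rh_apply (τ : G → Ω → Ω) (u : AddMonoidAlgebra k G) (c : Ch k Ω) :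
    rh τ u c = ∑ a, u.coeff a • mp (τ a) c := by
  show (∑ a, u.coeff a • mp (τ a)) c = _
  simp

lemma rh_single (τ : G → Ω → Ω) (a : G) :
    rh τ (AddMonoidAlgebra.single a (1 : k)) = mp (τ a) := by
  show (∑ b, (AddMonoidAlgebra.single a (1 : k)).coeff b • mp (τ b)) = _
  simp [Finsupp.single_apply]

lemma rh_mul {τ : G → Ω → Ω} (hτ : ∀ a b x, τ (a + b) x = τ a (τ b x)) (u v : AddMonoidAlgebra k G)
    (c : Ch k Ω) : rh τ (u * v) c = rh τ u (rh τ v c) := by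
  have h1 : ∀ a, rh τ (AddMonoidAlgebra.single a 1 * v) c = rh τ (AddMonoidAlgebra.single a 1) (rh τ v c) := by
    intro a
    have := ga_ext (f := (rh τ).flip c ∘ₗ LinearMap.mulLeft k (AddMonoidAlgebra.single a 1))
      (g := (rh τ (AddMonoidAlgebra.single a 1)) ∘ₗ (rh τ).flip c) (fun b => by
        simp only [LinearMap.comp_apply, LinearMap.mulLeft_apply, LinearMap.flip_apply,
          AddMonoidAlgebra.single_mul_single, mul_one, rh_single, mp_mp]
        congr 1
        congr 1
        funext x
        exact hτ a b x) v
    exact this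
  exact ga_ext (f := (rh τ).flip c ∘ₗ LinearMap.mulRight k v)
      (g := (rh τ).flip (rh τ v c)) (fun a => h1 a) u

lemma rh_comm {τ : G → Ω → Ω} {τ' : G → Ω' → Ω'} {L : Ch k Ω →ₗ[k] Ch k Ω'} {c : Ch k Ω}
    (h : ∀ a, L (mp (τ a) c) = mp (τ' a) (L c)) (u : AddMonoidAlgebra k G) :
    L (rh τ u c) = rh τ' u (L c) := by
  simp [rh_apply, h]

lemma rh_mem {τ : G → Ω → Ω} {P : List Ω → Prop} (hP : ∀ a l, P l → P (l.map (τ a)))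
    (u : AddMonoidAlgebra k G) {c : Ch k Ω} (hc : c ∈ sp k P) : rh τ u c ∈ sp k P := by
  rw [rh_apply]
  exact Submodule.sum_mem _ (fun a _ => Submodule.smul_mem _ _ (mp_mem (hP a) hc))

/-- functional on lists of length 1 -/
noncomputable def f1 (q : Ω → k) : Ch k Ω →ₗ[k] k :=
  Finsupp.linearCombination k (fun l => match l with
    | [x] => q x
    | _ => 0)

/-- functional on lists of length 2 -/
noncomputable def f2 (m : Ω → Ω → k) : Ch k Ω →ₗ[k] k :=
  Finsupp.linearCombination k (fun l => match l with
    | [x, y] => m x y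
    | _ => 0)

/-- the coboundary of a 1-cochain -/
def dm (m : Ω → Ω → k) (x y z : Ω) : k := m y z - m x z + m x y

/-- cap product with the coboundary of a 1-cochain -/
noncomputable def cap2 (m : Ω → Ω → k) : Ch k Ω →ₗ[k] Ch k Ω :=
  Finsupp.linearCombination k (fun l => match l with
    | x :: y :: z :: l => dm m x y z • Finsupp.single (z :: l) 1
    | _ => 0)

/-- cap product with the coboundary of a 0-cochain -/
noncomputable def cap1 (s : Ω → k) : Ch k Ω →ₗ[k] Ch k Ω :=
  Finsupp.linearCombination k (fun l => match l with
    | x :: y :: l => (s y - s x) • Finsupp.single (y :: l) 1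
    | _ => 0)

@[simp] lemma f1_single (q : Ω → k) (x : Ω) (a : k) : f1 q (Finsupp.single [x] a) = a * q x := by
  simp [f1]

@[simp] lemma f2_single (q : Ω → Ω → k) (x y : Ω) (a : k) :
    f2 q (Finsupp.single [x, y] a) = a * q x y := by
  simp [f2]

@[simp] lemma cap2_single (m : Ω → Ω → k) (x y z : Ω) (l : List Ω) (a : k) :
    cap2 m (Finsupp.single (x :: y :: z :: l) a) = a • dm m x y z • Finsupp.single (z :: l) 1 := by
  simp [cap2]

@[simp] lemma cap1_single (s : Ω → k) (x y : Ω) (l : List Ω) (a : k) :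
    cap1 s (Finsupp.single (x :: y :: l) a) = a • (s y - s x) • Finsupp.single (y :: l) 1 := by
  simp [cap1]

lemma len_succ {n : ℕ} {l : List Ω} (h : l.length = n + 1) : ∃ x l', l = x :: l' ∧ l'.length = n := by
  cases l with
  | nil => simp at h
  | cons x l' => exact ⟨x, l', rfl, by simpa using h⟩

lemma cap2_cone3 (m : Ω → Ω → k) (x y z : Ω) (c : Ch k Ω) :
    cap2 m (cone x (cone y (cone z c))) = dm m x y z • cone z c := by
  have : cap2 m ∘ₗ cone x ∘ₗ cone y ∘ₗ cone z = dm m x y z • (cone z : Ch k Ω →ₗ[k] Ch k Ω) := by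
    apply ch_ext
    intro l
    simp
  exact congrArg (fun f => f c) this

lemma cap1_cone2 (s : Ω → k) (x y : Ω) (c : Ch k Ω) :
    cap1 s (cone x (cone y c)) = (s y - s x) • cone y c := by
  have : cap1 s ∘ₗ cone x ∘ₗ cone y = (s y - s x) • (cone y : Ch k Ω →ₗ[k] Ch k Ω) := by
    apply ch_ext
    intro l
    simp
  exact congrArg (fun f => f c) this

lemma bd_cap2 (m : Ω → Ω → k) {j : ℕ} {c : Ch k Ω} (hc : c ∈ sp k (fun l => l.length = j + 4)) :
    bd (cap2 m c) = cap2 m (bd c) := by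
  refine eq_on_sp (f := bd ∘ₗ cap2 m) (g := cap2 m ∘ₗ bd) (fun l hl => ?_) hc
  obtain ⟨x, l, rfl, hl'⟩ := len_succ hl; clear hl; have hl := hl'; clear hl'
  obtain ⟨y, l, rfl, hl'⟩ := len_succ hl; clear hl; have hl := hl'; clear hl'
  obtain ⟨z, l, rfl, hl'⟩ := len_succ hl; clear hl; have hl := hl'; clear hl'
  obtain ⟨u, l, rfl, hl'⟩ := len_succ hl; clear hl; have hl := hl'; clear hl'
  simp only [LinearMap.comp_apply, cap2_single, bd_single, one_smul, map_smul]
  simp only [bdL, map_sub, cone_single, cap2_single, cap2_cone3, one_smul]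
  simp only [dm, smul_sub, add_smul, sub_smul]
  abel

lemma bd_cap1 (s : Ω → k) {j : ℕ} {c : Ch k Ω} (hc : c ∈ sp k (fun l => l.length = j + 3)) :
    bd (cap1 s c) = - cap1 s (bd c) := by
  refine eq_on_sp (f := bd ∘ₗ cap1 s) (g := - (cap1 s ∘ₗ bd)) (fun l hl => ?_) hc
  obtain ⟨x, l, rfl, hl'⟩ := len_succ hl; clear hl; have hl := hl'; clear hl'
  obtain ⟨y, l, rfl, hl'⟩ := len_succ hl; clear hl; have hl := hl'; clear hl'
  obtain ⟨z, l, rfl, hl'⟩ := len_succ hl; clear hl; have hl := hl'; clear hl'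
  simp only [LinearMap.neg_apply, LinearMap.comp_apply, cap1_single, bd_single, one_smul, map_smul]
  simp only [bdL, map_sub, cone_single, cap1_single, cap1_cone2, one_smul]
  simp only [smul_sub, sub_smul]
  abel

lemma cap2_mem (m : Ω → Ω → k) {j : ℕ} {c : Ch k Ω} (hc : c ∈ sp k (fun l => l.length = j + 3)) :
    cap2 m c ∈ sp k (fun l => l.length = j + 1) := by
  refine map_sp (fun l hl => ?_) hc
  obtain ⟨x, l, rfl, hl'⟩ := len_succ hl; clear hl; have hl := hl'; clear hl'
  obtain ⟨y, l, rfl, hl'⟩ := len_succ hl; clear hl; have hl := hl'; clear hl'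
  obtain ⟨z, l, rfl, hl'⟩ := len_succ hl; clear hl; have hl := hl'; clear hl'
  rw [cap2_single, one_smul]
  exact Submodule.smul_mem _ _ (single_mem_sp (by simpa using hl) 1)

lemma cap1_mem (s : Ω → k) {j : ℕ} {c : Ch k Ω} (hc : c ∈ sp k (fun l => l.length = j + 2)) :
    cap1 s c ∈ sp k (fun l => l.length = j + 1) := by
  refine map_sp (fun l hl => ?_) hc
  obtain ⟨x, l, rfl, hl'⟩ := len_succ hl; clear hl; have hl := hl'; clear hl'
  obtain ⟨y, l, rfl, hl'⟩ := len_succ hl; clear hl; have hl := hl'; clear hl'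
  rw [cap1_single, one_smul]
  exact Submodule.smul_mem _ _ (single_mem_sp (by simpa using hl) 1)

lemma cap2_mp {m : Ω → Ω → k} {φ : Ω → Ω} (h : ∀ x y z, dm m (φ x) (φ y) (φ z) = dm m x y z)
    (c : Ch k Ω) : cap2 m (mp φ c) = mp φ (cap2 m c) := by
  have : cap2 m ∘ₗ mp φ = mp φ ∘ₗ cap2 m := by
    apply ch_ext
    intro l
    rcases l with _ | ⟨x, _ | ⟨y, _ | ⟨z, l⟩⟩⟩
    · simp [cap2]
    · simp [cap2]
    · simp [cap2]
    · simp [h]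
  exact congrArg (fun f => f c) this

lemma cap1_mp {s : Ω → k} {φ : Ω → Ω} (h : ∀ x y, s (φ y) - s (φ x) = s y - s x)
    (c : Ch k Ω) : cap1 s (mp φ c) = mp φ (cap1 s c) := by
  have : cap1 s ∘ₗ mp φ = mp φ ∘ₗ cap1 s := by
    apply ch_ext
    intro l
    rcases l with _ | ⟨x, _ | ⟨y, l⟩⟩
    · simp [cap1]
    · simp [cap1]
    · simp [h]
  exact congrArg (fun f => f c) this

lemma f1_one {c : Ch k Ω} (hc : c ∈ sp k (fun l => l.length = 1)) {r : k}
    (h : bd c = Finsupp.single [] r) : f1 1 c = r := by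
  have : bd c = (Finsupp.lsingle [] ∘ₗ f1 1 : Ch k Ω →ₗ[k] Ch k Ω) c := by
    refine eq_on_sp (fun l hl => ?_) hc
    obtain ⟨x, l, rfl, hl'⟩ := len_succ hl; clear hl; have hl := hl'; clear hl'
    obtain rfl : l = [] := List.length_eq_zero_iff.1 hl
    simp [bd_single, bdL]
  rw [this] at h
  simpa using Finsupp.single_injective _ h

lemma bd_eq_f1 {c : Ch k Ω} (hc : c ∈ sp k (fun l => l.length = 1)) :
    bd c = Finsupp.single [] (f1 1 c) := by
  refine eq_on_sp (g := Finsupp.lsingle [] ∘ₗ f1 1) (fun l hl => ?_) hc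
  obtain ⟨x, l, rfl, hl'⟩ := len_succ hl; clear hl; have hl := hl'; clear hl'
  obtain rfl : l = [] := List.length_eq_zero_iff.1 hl
  simp [bd_single, bdL]

/-- the constant for two-step caps -/
lemma odd_const {τ : G → Ω → Ω} {u v : AddMonoidAlgebra k G} (huv : u * v = 0) (hu : fn 1 u = 0)
    {m : Ω → Ω → k} {q : G → Ω → k} {w : G → G → k}
    (hm : ∀ a x y, m (τ a x) (τ a y) = m x y + q a x - q a y)
    (hq : ∀ a b x, q a (τ b x) = q (a + b) x - q b x + w a b)
    {z0 z1 z2 : Ch k Ω} (h0 : z0 ∈ sp k (fun l => l.length = 1))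
    (h1 : z1 ∈ sp k (fun l => l.length = 2)) (h2 : z2 ∈ sp k (fun l => l.length = 3))
    {c : k} (b0 : bd z0 = Finsupp.single [] c) (b1 : bd z1 = rh τ v z0) (b2 : bd z2 = rh τ u z1) :
    bd (cap2 m z2) = Finsupp.single [] (- (c * bil w u v)) := by
  rw [bd_eq_f1 (cap2_mem m (j := 0) h2)]
  congr 1
  have e1 : f1 1 (cap2 m z2) = f2 m (bd z2) := by
    refine eq_on_sp (f := f1 1 ∘ₗ cap2 m) (g := f2 m ∘ₗ bd) (fun l hl => ?_) h2
    obtain ⟨x, l, rfl, hl'⟩ := len_succ hl; clear hl; have hl := hl'; clear hl'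
    obtain ⟨y, l, rfl, hl'⟩ := len_succ hl; clear hl; have hl := hl'; clear hl'
    obtain ⟨z, l, rfl, hl'⟩ := len_succ hl; clear hl; have hl := hl'; clear hl'
    obtain rfl : l = [] := List.length_eq_zero_iff.1 hl
    simp [bd_single, bdL, dm]
    ring
  have e2 : ∀ a, f2 m (mp (τ a) z1) = f2 m z1 - f1 (q a) (bd z1) := by
    intro a
    refine eq_on_sp (f := f2 m ∘ₗ mp (τ a)) (g := f2 m - f1 (q a) ∘ₗ bd) (fun l hl => ?_) h1
    obtain ⟨x, l, rfl, hl'⟩ := len_succ hl; clear hl; have hl := hl'; clear hl'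
    obtain ⟨y, l, rfl, hl'⟩ := len_succ hl; clear hl; have hl := hl'; clear hl'
    obtain rfl : l = [] := List.length_eq_zero_iff.1 hl
    simp [bd_single, bdL, hm]
    ring
  have e3 : ∀ a b, f1 (q a) (mp (τ b) z0) = f1 (q (a + b)) z0 - f1 (q b) z0 + w a b * c := by
    intro a b
    rw [← f1_one h0 b0]
    refine eq_on_sp (f := f1 (q a) ∘ₗ mp (τ b)) (g := f1 (q (a + b)) - f1 (q b) + w a b • f1 1)
      (fun l hl => ?_) h0
    obtain ⟨x, l, rfl, hl'⟩ := len_succ hl; clear hl; have hl := hl'; clear hl'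
    obtain rfl : l = [] := List.length_eq_zero_iff.1 hl
    simp [hq]
  have hu' : ∑ a, u.coeff a = 0 := by simpa [fn] using hu
  have e4 : ∀ a, f1 (q a) (rh τ v z0) =
      fn (fun b => f1 (q (a + b)) z0) v - fn (fun b => f1 (q b) z0) v + fn (w a) v * c := by
    intro a
    rw [rh_apply, map_sum]
    simp only [map_smul, e3, smul_eq_mul, fn, LinearMap.coe_mk, AddHom.coe_mk, Finset.sum_mul]
    rw [← Finset.sum_sub_distrib, ← Finset.sum_add_distrib]
    exact Finset.sum_congr rfl (fun _ _ => by ring)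
  rw [e1, b2, rh_apply, map_sum]
  simp only [map_smul, e2, smul_eq_mul, b1, e4]
  have k1 := bil_add_eq (fun b => f1 (q b) z0) u v
  rw [huv, map_zero] at k1
  have k2 := bil_snd (fun b => f1 (q b) z0) u v
  rw [hu, zero_mul] at k2
  rw [bil_apply] at k1 k2 ⊢
  have : ∀ a, u.coeff a * (f2 m z1 - (fn (fun b => f1 (q (a + b)) z0) v - fn (fun b => f1 (q b) z0) v
      + fn (w a) v * c)) = u.coeff a * f2 m z1 - u.coeff a * fn (fun b => f1 (q (a + b)) z0) v +
      u.coeff a * fn (fun b => f1 (q b) z0) v - c * (u.coeff a * fn (w a) v) := fun a => by ring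
  simp only [this, Finset.sum_sub_distrib, Finset.sum_add_distrib, k1, k2, ← Finset.sum_mul, hu',
    ← Finset.mul_sum]
  ring

/-- the constant for one-step caps -/
lemma even_const {τ : G → Ω → Ω} {v : AddMonoidAlgebra k G} (hv : fn 1 v = 0)
    {s : Ω → k} {χ : G → k} (hs : ∀ a x, s (τ a x) = s x + χ a)
    {z0 z1 : Ch k Ω} (h0 : z0 ∈ sp k (fun l => l.length = 1))
    (h1 : z1 ∈ sp k (fun l => l.length = 2))
    {c : k} (b0 : bd z0 = Finsupp.single [] c) (b1 : bd z1 = rh τ v z0) :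
    bd (cap1 s z1) = Finsupp.single [] (c * fn χ v) := by
  rw [bd_eq_f1 (cap1_mem s (j := 0) h1)]
  congr 1
  have e1 : f1 1 (cap1 s z1) = f1 s (bd z1) := by
    refine eq_on_sp (f := f1 1 ∘ₗ cap1 s) (g := f1 s ∘ₗ bd) (fun l hl => ?_) h1
    obtain ⟨x, l, rfl, hl'⟩ := len_succ hl; clear hl; have hl := hl'; clear hl'
    obtain ⟨y, l, rfl, hl'⟩ := len_succ hl; clear hl; have hl := hl'; clear hl'
    obtain rfl : l = [] := List.length_eq_zero_iff.1 hl
    simp [bd_single, bdL]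
  have e3 : ∀ b, f1 s (mp (τ b) z0) = f1 s z0 + χ b * c := by
    intro b
    rw [← f1_one h0 b0]
    refine eq_on_sp (f := f1 s ∘ₗ mp (τ b)) (g := f1 s + χ b • f1 1)
      (fun l hl => ?_) h0
    obtain ⟨x, l, rfl, hl'⟩ := len_succ hl; clear hl; have hl := hl'; clear hl'
    obtain rfl : l = [] := List.length_eq_zero_iff.1 hl
    simp [hs]
  have hv' : ∑ a, v.coeff a = 0 := by simpa [fn] using hv
  rw [e1, b1, rh_apply, map_sum]
  simp only [map_smul, e3, smul_eq_mul, mul_add, Finset.sum_add_distrib, ← Finset.sum_mul, hv', fn,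
    LinearMap.coe_mk, AddHom.coe_mk, Finset.mul_sum]
  rw [zero_mul, zero_add]
  exact Finset.sum_congr rfl (fun _ _ => by ring)

end galg

end Tvb

namespace Tvb
set_option linter.unusedSectionVars false

section seqs

variable {k : Type*} [Field k] {Ω Ω' : Type*} {G : Type*} [Fintype G] [DecidableEq G] [AddCommGroup G]

lemma fn1_mul (u v : AddMonoidAlgebra k G) : fn 1 (u * v) = fn 1 u * fn 1 v := by
  rw [← bil_add_eq, ← bil_snd]; rfl

/-- sequences of chains forming a (twisted) resolution -/
def SeqP (τ : G → Ω → Ω) (u v : AddMonoidAlgebra k G) (n : ℕ) (c : k) (z : ℕ → Ch k Ω) : Prop :=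
  (∀ j ≤ n, z j ∈ sp k (fun l => l.length = j + 1)) ∧ bd (z 0) = Finsupp.single [] c ∧
    ∀ j < n, bd (z (j + 1)) = rh τ (if Even j then v else u) (z j)

lemma step_odd {τ : G → Ω → Ω} {u v : AddMonoidAlgebra k G} (huv : u * v = 0) (hu : fn 1 u = 0)
    {m : Ω → Ω → k} {q : G → Ω → k} {w : G → G → k}
    (hm : ∀ a x y, m (τ a x) (τ a y) = m x y + q a x - q a y)
    (hq : ∀ a b x, q a (τ b x) = q (a + b) x - q b x + w a b) {n : ℕ} {c : k} {z : ℕ → Ch k Ω}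
    (hz : SeqP τ u v (n + 2) c z) :
    SeqP τ u v n (- (c * bil w u v)) (fun j => cap2 m (z (j + 2))) := by
  obtain ⟨h1, h2, h3⟩ := hz
  refine ⟨fun j hj => cap2_mem m (h1 (j + 2) (by omega)), ?_, ?_⟩
  · have b1 := h3 0 (by omega)
    have b2 := h3 1 (by omega)
    rw [if_pos (by decide)] at b1
    rw [if_neg (by decide)] at b2
    exact odd_const huv hu hm hq (h1 0 (by omega)) (h1 1 (by omega)) (h1 2 (by omega)) h2 b1 b2
  · intro j hj
    have b := h3 (j + 2) (by omega)
    have hdm : ∀ a x y z, dm m (τ a x) (τ a y) (τ a z) = dm m x y z := by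
      intro a x y z; simp only [dm, hm]; ring
    have hE : Even (j + 2) ↔ Even j := by
      rw [Nat.even_add]; simp
    show bd (cap2 m (z (j + 1 + 2))) = _
    rw [bd_cap2 m (h1 (j + 1 + 2) (by omega)), show j + 1 + 2 = j + 2 + 1 by ring, b,
      rh_comm (τ' := τ) (fun a => cap2_mp (hdm a) _)]
    simp only [hE]

lemma step_even [CharP k 2] {τ : G → Ω → Ω} {v : AddMonoidAlgebra k G} (hv : fn 1 v = 0)
    {s : Ω → k} {χ : G → k} (hs : ∀ a x, s (τ a x) = s x + χ a) {n : ℕ} {c : k} {z : ℕ → Ch k Ω}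
    (hz : SeqP τ v v (n + 1) c z) :
    SeqP τ v v n (c * fn χ v) (fun j => cap1 s (z (j + 1))) := by
  obtain ⟨h1, h2, h3⟩ := hz
  simp only [ite_self] at h3
  refine ⟨fun j hj => cap1_mem s (h1 (j + 1) (by omega)), ?_, ?_⟩
  · exact even_const hv hs (h1 0 (by omega)) (h1 1 (by omega)) h2 (h3 0 (by omega))
  · intro j hj
    have b := h3 (j + 1) (by omega)
    have hds : ∀ a x y, s (τ a y) - s (τ a x) = s y - s x := by
      intro a x y; simp only [hs]; ring
    have hneg : ∀ x : Ch k Ω, - x = x := by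
      intro x
      have : (-1 : k) = 1 := by
        have : (2 : k) = 0 := CharP.cast_eq_zero k 2
        linear_combination -this
      calc - x = (-1 : k) • x := by simp
        _ = x := by rw [this, one_smul]
    show bd (cap1 s (z (j + 1 + 1))) = _
    rw [bd_cap1 s (h1 (j + 1 + 1) (by omega)), b, hneg,
      rh_comm (τ' := τ) (fun a => cap1_mp (hds a) _), ite_self]

/-- the final contradiction -/
lemma seq_kill {ι : Type*} (t : ℕ) {τ : G → Ω → Ω} {u v : AddMonoidAlgebra k G}
    (κ : ι → Ch k Ω →ₗ[k] Ch k Ω) (Sml : ι → List Ω → Prop)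
    (hκ : ∀ i l, ∃ e : k, κ i (Finsupp.single l 1) = Finsupp.single (l.drop t) e)
    (hs : ∀ i l, Sml i l → Sml i (l.drop t))
    (h0 : ∀ i l, Sml i l → κ i (Finsupp.single l 1) = 0)
    (step : ∀ i n c z, SeqP τ u v (n + t) c z → c ≠ 0 →
      ∃ c', c' ≠ 0 ∧ SeqP τ u v n c' (fun j => κ i (z (j + t)))) :
    ∀ (is : List ι) (c : k) (z : ℕ → Ch k Ω), c ≠ 0 → SeqP τ u v (is.length * t) c z →
      z (is.length * t) ∈ sp k (fun l => ∃ i ∈ is, Sml i l) → False := by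
  intro is
  induction is with
  | nil =>
    intro c z hc hz hzs
    have : z 0 = 0 := by
      have := eq_on_sp (f := LinearMap.id) (g := 0) (fun l hl => by simp at hl) hzs
      simpa using this
    have h := hz.2.1
    rw [this, map_zero] at h
    exact hc (by simpa using h.symm)
  | cons i is ih =>
    intro c z hc hz hzs
    rw [List.length_cons, Nat.succ_mul] at hz hzs
    obtain ⟨c', hc', hz'⟩ := step i _ c z hz hc
    refine ih c' _ hc' hz' ?_
    refine map_sp (fun l hl => ?_) hzs
    obtain ⟨i', hi', hl⟩ := hl
    rcases List.mem_cons.1 hi' with rfl | hi'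
    · rw [h0 _ _ hl]; exact Submodule.zero_mem _
    · obtain ⟨e, he⟩ := hκ i l
      rw [he]
      exact single_mem_sp ⟨i', hi', hs _ _ hl⟩ e

lemma exists_seq {W : Type*} [DecidableEq W] {K : Set (Finset W)} (hK : IsLowerSet K) (hK0 : ∅ ∈ K)
    {τ : G → W → W} (hτ : ∀ a b x, τ (a + b) x = τ a (τ b x)) (hKτ : ∀ a, ∀ A ∈ K, A.image (τ a) ∈ K)
    {u v : AddMonoidAlgebra k G} (huv : u * v = 0) (hv : fn 1 v = 0) (n : ℕ)
    (hA : ∀ j ≤ n, Ac k K j) :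
    ∃ z : ℕ → Ch k W, (∀ j ≤ n, z j ∈ chn k K (j + 1)) ∧ bd (z 0) = Finsupp.single [] 1 ∧
      ∀ j < n, bd (z (j + 1)) = rh τ (if Even j then v else u) (z j) := by
  have hrh : ∀ (j : ℕ) (x : AddMonoidAlgebra k G) (c : Ch k W), c ∈ chn k K j → rh τ x c ∈ chn k K j := by
    intro j x c hc
    refine rh_mem (fun a l hl => ⟨by simp [hl.1], ?_⟩) x hc
    have := hKτ a _ hl.2
    convert this using 1
    ext y; simp
  induction n with
  | zero =>
    obtain ⟨z, hz, hb⟩ := hA 0 le_rfl (Finsupp.single [] 1) (single_mem_sp ⟨rfl, by simpa using hK0⟩ 1) bd_nil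
    refine ⟨fun _ => z, ?_, hb, by intro j hj; omega⟩
    intro j hj
    obtain rfl : j = 0 := by omega
    exact hz
  | succ n ih =>
    obtain ⟨z, h1, h2, h3⟩ := ih (fun j hj => hA j (by omega))
    have hcyc : bd (rh τ (if Even n then v else u) (z n)) = 0 := by
      rw [rh_comm (τ' := τ) (fun a => bd_mp (τ a) _)]
      rcases n with _ | n
      · rw [h2, if_pos (by decide), rh_apply]
        have hv' : ∑ a, v.coeff a = 0 := by simpa [fn] using hv
        simp only [mp_single, List.map_nil, ← Finset.sum_smul, hv', zero_smul]
      · rw [h3 n (by omega), ← rh_mul hτ]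
        have : (if Even (n + 1) then v else u) * (if Even n then v else u) = 0 := by
          by_cases hn : Even n
          · rw [if_pos hn, if_neg (by rw [Nat.even_add_one]; simpa using hn), huv]
          · rw [if_neg hn, if_pos (by rw [Nat.even_add_one]; exact hn), mul_comm, huv]
        rw [this]; simp
    obtain ⟨y, hy, hb⟩ := hA (n + 1) le_rfl _ (hrh _ _ _ (h1 n le_rfl)) hcyc
    refine ⟨Function.update z (n + 1) y, ?_, ?_, ?_⟩
    · intro j hj
      rcases Nat.lt_or_ge j (n + 1) with h | h
      · rw [Function.update_of_ne (by omega)]; exact h1 j (by omega)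
      · obtain rfl : j = n + 1 := by omega
        simpa using hy
    · rw [Function.update_of_ne (by omega)]; exact h2
    · intro j hj
      rcases Nat.lt_or_ge j n with h | h
      · rw [Function.update_of_ne (by omega), Function.update_of_ne (by omega)]; exact h3 j h
      · obtain rfl : j = n := by omega
        rw [Function.update_self, Function.update_of_ne (by omega), hb]

end seqs

end Tvb

namespace Tvb
set_option linter.unusedSectionVars false

section consts

variable {k : Type*} [Field k] {p : ℕ} [hp : Fact p.Prime] [Algebra (ZMod p) k] {s : ℕ}

lemma amap (c : ZMod p) : algebraMap (ZMod p) k c = (c.val : k) := by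
  conv_lhs => rw [← ZMod.natCast_zmod_val c]
  rw [map_natCast]

/-- the carry of addition mod p -/
def cr (a b : ZMod p) : ℕ := (a.val + b.val) / p

lemma cr_eq (a b : ZMod p) : (a + b).val + p * cr a b = a.val + b.val := by
  rw [ZMod.val_add, cr]; exact Nat.mod_add_div _ _

lemma cr_sum (b : ZMod p) : ∑ a : ZMod p, cr a b = b.val := by
  have h : ∑ a : ZMod p, ((a + b).val + p * cr a b) = ∑ a : ZMod p, (a.val + b.val) :=
    Finset.sum_congr rfl (fun a _ => cr_eq a b)
  rw [Finset.sum_add_distrib, Finset.sum_add_distrib, ← Finset.mul_sum,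
    show ∑ a : ZMod p, (a + b).val = ∑ a : ZMod p, a.val from
      Equiv.sum_comp (Equiv.addRight b) (fun a : ZMod p => a.val)] at h
  have h2 : ∑ a : ZMod p, b.val = p * b.val := by simp [ZMod.card]
  rw [h2] at h
  exact Nat.eq_of_mul_eq_mul_left hp.out.pos (Nat.add_left_cancel h)

lemma charK : CharP k p := charP_of_injective_algebraMap (algebraMap (ZMod p) k).injective p

lemma charGA {G : Type*} [AddCommGroup G] : CharP (AddMonoidAlgebra k G) p := by
  have : CharP k p := charK
  exact charP_of_injective_algebraMap (algebraMap k (AddMonoidAlgebra k G)).injective p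

/-- the nilpotent element -/
noncomputable def NN (α : Fin s → k) : AddMonoidAlgebra k (Fin s → ZMod p) :=
  ∑ l, α l • (AddMonoidAlgebra.single (Pi.single l 1) 1 - 1)

lemma NN_pow (α : Fin s → k) : (NN (p := p) α) ^ p = 0 := by
  have : CharP (AddMonoidAlgebra k (Fin s → ZMod p)) p := charGA
  rw [NN, sum_pow_char]
  refine Finset.sum_eq_zero (fun l _ => ?_)
  rw [smul_pow, sub_pow_char, AddMonoidAlgebra.single_pow, ← Nat.cast_smul_eq_nsmul (ZMod p)]
  simp [AddMonoidAlgebra.one_def]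

lemma fn_NN (φ : (Fin s → ZMod p) → k) (α : Fin s → k) :
    fn φ (NN α) = ∑ l, α l * (φ (Pi.single l 1) - φ 0) := by
  rw [NN, map_sum]
  refine Finset.sum_congr rfl (fun l _ => ?_)
  rw [map_smul, map_sub, AddMonoidAlgebra.one_def, fn_single, fn_single]
  simp

lemma fn1_NN (α : Fin s → k) : fn 1 (NN (p := p) α) = 0 := by
  rw [fn_NN]; simp

lemma NN_mul (α : Fin s → k) : NN (p := p) α ^ (p - 1) * NN α = 0 := by
  rw [← pow_succ, Nat.sub_add_cancel hp.out.one_le, NN_pow]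

lemma fn1_NN_pow (α : Fin s → k) : fn 1 (NN (p := p) α ^ (p - 1)) = 0 := by
  have : p - 1 = (p - 2) + 1 := by have := hp.out.two_le; omega
  rw [this, pow_succ, fn1_mul, fn1_NN, mul_zero]

/-- sum of all group elements -/
noncomputable def sg (k : Type*) [Field k] (p : ℕ) [Fact p.Prime] : AddMonoidAlgebra k (ZMod p) :=
  ∑ j : ZMod p, AddMonoidAlgebra.single j 1

lemma sg_mul (x : AddMonoidAlgebra k (ZMod p)) : sg k p * x = fn 1 x • sg k p := by
  refine ga_ext (f := LinearMap.mulLeft k (sg k p)) (g := (fn 1).smulRight (sg k p)) (fun a => ?_) x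
  simp only [LinearMap.mulLeft_apply, LinearMap.smulRight_apply, fn_single, Pi.one_apply, mul_one, one_smul]
  rw [sg, Finset.sum_mul]
  simp only [AddMonoidAlgebra.single_mul_single, mul_one]
  exact Equiv.sum_comp (Equiv.addRight a) (fun j => AddMonoidAlgebra.single j (1 : k))

lemma geo_pow : (AddMonoidAlgebra.single (1 : ZMod p) (1 : k) - 1) ^ (p - 1) = sg k p := by
  have : CharP k p := charK
  have h : ((Polynomial.X : Polynomial k) - 1) ^ (p - 1) = ∑ i ∈ Finset.range p, Polynomial.X ^ i := by
    have hne : (Polynomial.X : Polynomial k) - 1 ≠ 0 := by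
      simpa using Polynomial.X_sub_C_ne_zero (1 : k)
    apply mul_left_cancel₀ hne
    rw [mul_geom_sum, ← pow_succ', Nat.sub_add_cancel hp.out.one_le, sub_pow_char, one_pow]
  have h2 := congrArg (Polynomial.aeval (AddMonoidAlgebra.single (1 : ZMod p) (1 : k))) h
  simp only [map_pow, map_sub, Polynomial.aeval_X, map_one, map_sum] at h2
  rw [h2, sg]
  refine Finset.sum_nbij' (fun i => (i : ZMod p)) (fun j => j.val) ?_ ?_ ?_ ?_ ?_
  · simp
  · intro j _; simpa using ZMod.val_lt j
  · intro i hi; exact ZMod.val_cast_of_lt (by simpa using hi)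
  · intro j _; simp
  · intro i _; simp [AddMonoidAlgebra.single_pow]

lemma bil_sg (c : ZMod p) :
    bil (fun a b : ZMod p => -((cr a b : ℕ) : k)) (sg k p) (AddMonoidAlgebra.single c 1) =
      - algebraMap (ZMod p) k c := by
  rw [sg, map_sum, LinearMap.sum_apply]
  simp only [bil_single]
  rw [amap, ← cr_sum c, Finset.sum_neg_distrib, Nat.cast_sum]

lemma fn1_pow (x : AddMonoidAlgebra k (ZMod p)) (n : ℕ) : fn 1 (x ^ n) = (fn 1 x) ^ n := by
  induction n with
  | zero => simp [AddMonoidAlgebra.one_def, fn_single]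
  | succ n ih => rw [pow_succ, fn1_mul, ih, pow_succ]

lemma exists_B (c : ZMod p) : ∃ B : AddMonoidAlgebra k (ZMod p),
    AddMonoidAlgebra.single c (1 : k) - 1 = (AddMonoidAlgebra.single (1 : ZMod p) (1 : k) - 1) * B ∧
      fn 1 B = algebraMap (ZMod p) k c := by
  refine ⟨∑ i ∈ Finset.range c.val, AddMonoidAlgebra.single (1 : ZMod p) (1 : k) ^ i, ?_, ?_⟩
  · rw [mul_geom_sum, AddMonoidAlgebra.single_pow]
    simp
  · rw [map_sum, amap]
    simp [AddMonoidAlgebra.single_pow, fn_single]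

/-- the value of the carry cocycle -/
lemma bil_NN (χ : (Fin s → ZMod p) →+ ZMod p) (α : Fin s → k) :
    bil (fun a b => -((cr (χ a) (χ b) : ℕ) : k)) (NN α ^ (p - 1)) (NN α) =
      - (∑ l, α l * algebraMap (ZMod p) k (χ (Pi.single l 1))) ^ p := by
  rw [bil_map χ (fun a b => -((cr a b : ℕ) : k))]
  have hN : AddMonoidAlgebra.mapDomainAlgHom k k χ (NN α) =
      ∑ l, α l • (AddMonoidAlgebra.single (χ (Pi.single l 1)) 1 - 1) := by
    rw [NN, map_sum]
    refine Finset.sum_congr rfl (fun l _ => ?_)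
    rw [map_smul, map_sub, map_one]
    simp
  rw [map_pow, hN]
  choose B hB1 hB2 using fun c => exists_B (k := k) (p := p) c
  have h1 : ∑ l, α l • (AddMonoidAlgebra.single (χ (Pi.single l 1)) (1 : k) - 1) =
      (AddMonoidAlgebra.single (1 : ZMod p) (1 : k) - 1) * ∑ l, α l • B (χ (Pi.single l 1)) := by
    rw [Finset.mul_sum]
    refine Finset.sum_congr rfl (fun l _ => ?_)
    rw [hB1, mul_smul_comm]
  have h2 : (∑ l, α l • (AddMonoidAlgebra.single (χ (Pi.single l 1)) (1 : k) - 1)) ^ (p - 1) =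
      (∑ l, α l * algebraMap (ZMod p) k (χ (Pi.single l 1))) ^ (p - 1) • sg k p := by
    rw [h1, mul_pow, geo_pow, sg_mul, fn1_pow, map_sum]
    simp [hB2]
  rw [h2, map_smul, LinearMap.smul_apply, map_sum]
  have h3 : ∀ l, bil (fun a b : ZMod p => -((cr a b : ℕ) : k)) (sg k p)
      (α l • (AddMonoidAlgebra.single (χ (Pi.single l 1)) 1 - 1)) =
      - (α l * algebraMap (ZMod p) k (χ (Pi.single l 1))) := by
    intro l
    rw [map_smul, map_sub, AddMonoidAlgebra.one_def, bil_sg, bil_sg]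
    simp
  simp only [h3, Finset.sum_neg_distrib, smul_eq_mul, mul_neg]
  rw [← pow_succ, Nat.sub_add_cancel hp.out.one_le]

end consts

end Tvb

namespace Tvb
set_option linter.unusedSectionVars false

section testmap

variable {V : Type*} [Fintype V] [DecidableEq V] {G : Type*} [Fintype G] [DecidableEq G] [AddCommGroup G]
  {S : Set (Finset V)} {d : ℕ}

/-- mass of a color -/
noncomputable def lam (w : Option V × G → ℝ) (g : G) : ℝ := ∑ v, w (some v, g)

/-- normalized part of a color -/
noncomputable def yv (w : Option V × G → ℝ) (g : G) : V → ℝ := fun v => w (some v, g) / lam w g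

/-- the test map -/
noncomputable def YY (f : (V → ℝ) → Fin d → ℝ) (w : Option V × G → ℝ) (g : G) : Option (Fin d) → ℝ
  | none => lam w g + w (none, g)
  | some j => lam w g * f (yv w g) j

/-- translation of weights -/
def act (a : G) (w : Option V × G → ℝ) : Option V × G → ℝ := fun x => w (x.1, x.2 - a)

lemma act_add (a b : G) (w : Option V × G → ℝ) : act (a + b) w = act a (act b w) := by
  funext x
  simp only [act]
  congr 2
  abel

lemma YY_act (f : (V → ℝ) → Fin d → ℝ) (a : G) (w : Option V × G → ℝ) (g : G) (j) :
    YY f (act a w) g j = YY f w (g - a) j := by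
  cases j <;> rfl

lemma XP_sl (hS : IsLowerSet S) {A : Finset (Option V × G)} (hA : A ∈ XP S G) (g : G) : sl A g ∈ S := by
  rcases hA with h | ⟨i, h⟩
  · exact h.2.1 g
  · refine hS ?_ h.2
    intro v hv
    rw [mem_sl] at hv ⊢
    have := h.1 _ hv
    simp only at this
    rw [← this]; exact hv

lemma lam_nonneg {w : Option V × G → ℝ} (hw : w ∈ geom (XP S G)) (g : G) : 0 ≤ lam w g :=
  Finset.sum_nonneg (fun _ _ => hw.1 _)

lemma wsupp_yv {w : Option V × G → ℝ} {g : G} (h : lam w g ≠ 0) :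
    wsupp (yv w g) = sl (wsupp w) g := by
  ext v
  simp [yv, h]

lemma yv_mem (hS : IsLowerSet S) {w : Option V × G → ℝ} (hw : w ∈ geom (XP S G)) {g : G}
    (h : lam w g ≠ 0) : yv w g ∈ geom S := by
  refine ⟨fun v => div_nonneg (hw.1 _) (lam_nonneg hw g), ?_, ?_⟩
  · simp only [yv]
    rw [← Finset.sum_div]
    exact div_self h
  · rw [wsupp_yv h]
    exact XP_sl hS hw.2.2 g

lemma lam_cont (g : G) : Continuous (fun w : Option V × G → ℝ => lam w g) := by
  unfold lam; fun_prop

lemma YY_cont (hS : IsLowerSet S) {f : (V → ℝ) → Fin d → ℝ} (hf : ContinuousOn f (geom S)) (g : G) (j) :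
    ContinuousOn (fun w => YY f w g j) (geom (XP S G)) := by
  cases j with
  | none =>
    exact ((lam_cont g).add (continuous_apply _)).continuousOn
  | some j =>
    intro w0 hw0
    show ContinuousWithinAt (fun w => lam w g * f (yv w g) j) _ _
    by_cases h : lam w0 g = 0
    · obtain ⟨B, hB⟩ := (geom_compact hS).exists_bound_of_continuousOn hf
      have hbound : ∀ w ∈ geom (XP S G), ‖lam w g * f (yv w g) j‖ ≤ lam w g * B := by
        intro w hw
        by_cases h' : lam w g = 0
        · simp [h']
        · rw [norm_mul, Real.norm_of_nonneg (lam_nonneg hw g)]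
          exact mul_le_mul_of_nonneg_left ((norm_le_pi_norm _ j).trans (hB _ (yv_mem hS hw h')))
            (lam_nonneg hw g)
      rw [ContinuousWithinAt, h, zero_mul]
      refine squeeze_zero_norm' (a := fun w => lam w g * B) ?_ ?_
      · filter_upwards [self_mem_nhdsWithin] with w hw using hbound w hw
      · have : Continuous (fun w : Option V × G → ℝ => lam w g * B) := (lam_cont g).mul continuous_const
        have h2 := this.tendsto w0
        rw [h, zero_mul] at h2
        exact h2.mono_left nhdsWithin_le_nhds
    · have hnh : {w : Option V × G → ℝ | lam w g ≠ 0} ∈ nhds w0 :=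
        (lam_cont g).continuousAt.eventually_ne h
      have h1 : ContinuousWithinAt (fun w => yv w g) (geom (XP S G) ∩ {w | lam w g ≠ 0}) w0 := by
        apply ContinuousAt.continuousWithinAt
        rw [continuousAt_pi]
        intro v
        exact (continuous_apply _).continuousAt.div (lam_cont g).continuousAt h
      have h2 : ContinuousWithinAt (fun w => f (yv w g)) (geom (XP S G) ∩ {w | lam w g ≠ 0}) w0 :=
        ContinuousWithinAt.comp (f := fun w : Option V × G → ℝ => yv w g) (g := f) (t := geom S)
          (hf _ (yv_mem hS hw0 h)) h1 (fun w hw => yv_mem hS hw.1 hw.2)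
      have h3 : ContinuousWithinAt (fun w => f (yv w g)) (geom (XP S G)) w0 :=
        (continuousWithinAt_inter hnh).1 h2
      exact (lam_cont g).continuousWithinAt.mul ((continuous_apply j).continuousAt.comp_continuousWithinAt h3)

lemma sum_w {w : Option V × G → ℝ} (f : (V → ℝ) → Fin d → ℝ) : ∑ g, YY f w g none = ∑ x, w x := by
  rw [Fintype.sum_prod_type_right]
  refine Finset.sum_congr rfl (fun g _ => ?_)
  rw [Fintype.sum_option, add_comm]; rfl

/-- a point where the test map is constant gives a Tverberg point -/
lemma tverberg_of_const [Nontrivial G] (hS : IsLowerSet S) {f : (V → ℝ) → Fin d → ℝ}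
    {w : Option V × G → ℝ} (hw : w ∈ geom (XP S G)) (hY : ∀ j g g', YY f w g j = YY f w g' j) :
    ∃ u : G → V → ℝ, (∀ g, u g ∈ geom S) ∧ (∀ g g', g ≠ g' → Disjoint (wsupp (u g)) (wsupp (u g'))) ∧
      ∀ g g', f (u g) = f (u g') := by
  have hpos : ∀ g, YY f w g none ≠ 0 := by
    intro g h0
    have := sum_w (w := w) f
    rw [hw.2.1, Finset.sum_congr rfl (fun g' _ => (hY none g' g).trans h0)] at this
    simp at this
  rcases hw.2.2 with hX | ⟨i, hC⟩
  · have hnone : ∀ g, w (none, g) = 0 := by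
      intro g
      by_contra h
      obtain ⟨v, hv, _⟩ := (hX.1 (none, g) (by simpa using h)).2
      simp at hv
    have hlam : ∀ g, lam w g ≠ 0 := by
      intro g h
      apply hpos g
      simp [YY, h, hnone]
    refine ⟨fun g => yv w g, fun g => yv_mem hS hw (hlam g), ?_, ?_⟩
    · intro g g' hgg
      rw [wsupp_yv (hlam g), wsupp_yv (hlam g'), Finset.disjoint_left]
      intro v hv hv'
      exact hgg (hX.2.2 v g g' (mem_sl.1 hv) (mem_sl.1 hv'))
    · intro g g'
      funext j
      have h1 : lam w g = lam w g' := by simpa [YY, hnone] using hY none g g'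
      have h2 : lam w g * f (yv w g) j = lam w g' * f (yv w g') j := hY (some j) g g'
      rw [← h1] at h2
      exact mul_left_cancel₀ (hlam g) h2
  · exfalso
    obtain ⟨g, hg⟩ := exists_ne i
    have h0 : ∀ o, w (o, g) = 0 := by
      intro o
      by_contra h
      exact hg (hC.1 (o, g) (by simpa using h))
    apply hpos g
    simp [YY, lam, h0]

/-- invariance of the complex under translation -/
lemma sl_shift (A : Finset (Option V × G)) (a i : G) :
    sl (A.image (fun x => (x.1, x.2 + a))) i = sl A (i - a) := by
  ext v
  simp only [mem_sl, Finset.mem_image, Prod.mk.injEq, Prod.exists]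
  constructor
  · rintro ⟨o, g, h, rfl, rfl⟩
    simpa using h
  · intro h
    exact ⟨some v, i - a, h, rfl, by simp⟩

lemma XP_shift {A : Finset (Option V × G)} (hA : A ∈ XP S G) (a : G) :
    A.image (fun x => (x.1, x.2 + a)) ∈ XP S G := by
  rcases hA with h | ⟨i, h⟩
  · left
    refine ⟨?_, fun i => by rw [sl_shift]; exact h.2.1 _, ?_⟩
    · intro x hx
      obtain ⟨y, hy, rfl⟩ := Finset.mem_image.1 hx
      exact ⟨Finset.mem_univ _, (h.1 y hy).2⟩
    · intro v i i' h1 h2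
      rw [← mem_sl, sl_shift, mem_sl] at h1 h2
      have := h.2.2 v _ _ h1 h2
      simpa using this
  · right
    refine ⟨i + a, ?_, ?_⟩
    · intro x hx
      obtain ⟨y, hy, rfl⟩ := Finset.mem_image.1 hx
      simp [h.1 y hy]
    · rw [sl_shift]; simpa using h.2

lemma wsupp_act (a : G) (w : Option V × G → ℝ) :
    wsupp (act a w) = (wsupp w).image (fun x => (x.1, x.2 + a)) := by
  ext ⟨o, g⟩
  simp only [mem_wsupp, act, Finset.mem_image, Prod.mk.injEq, Prod.exists]
  constructor
  · intro h; exact ⟨o, g - a, h, rfl, by simp⟩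
  · rintro ⟨o', g', h, rfl, rfl⟩; simpa using h

lemma act_mem {w : Option V × G → ℝ} (hw : w ∈ geom (XP S G)) (a : G) : act a w ∈ geom (XP S G) := by
  refine ⟨fun x => hw.1 _, ?_, ?_⟩
  · rw [← hw.2.1]
    exact Equiv.sum_comp ((Equiv.refl (Option V)).prodCongr (Equiv.subRight a)) w
  · rw [wsupp_act]; exact XP_shift hw.2.2 a

/-- each vertex has at most one color in a face -/
lemma XP_unique {A : Finset (Option V × G)} (hA : A ∈ XP S G) {o : Option V} {g g' : G}
    (h : (o, g) ∈ A) (h' : (o, g') ∈ A) : g = g' := by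
  rcases hA with hX | ⟨i, hC⟩
  · obtain ⟨v, hv, _⟩ := (hX.1 _ h).2
    simp only at hv
    subst hv
    exact hX.2.2 v g g' h h'
  · exact (hC.1 _ h).trans (hC.1 _ h').symm

/-- an equivariant (discontinuous) coloring of points -/
lemma exists_gam : ∃ γ : (Option V × G → ℝ) → G,
    ∀ w ∈ geom (XP S G), ∀ a, γ (act a w) = γ w + a := by
  classical
  have hne : ∀ w ∈ geom (XP S G), ∃ o g, w (o, g) ≠ 0 := by
    intro w hw
    by_contra h
    push Not at h
    have := hw.2.1
    rw [Finset.sum_eq_zero (fun x _ => h x.1 x.2)] at this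
    simp at this
  let P : (Option V × G → ℝ) → Set (Option V) := fun w => {o | ∃ g, w (o, g) ≠ 0}
  let ch : Set (Option V) → Option V := fun s => if h : s.Nonempty then h.some else none
  have hch : ∀ s : Set (Option V), s.Nonempty → ch s ∈ s := by
    intro s hs
    simp only [ch, dif_pos hs]
    exact hs.some_mem
  let γ : (Option V × G → ℝ) → G := fun w => if h : ∃ g, w (ch (P w), g) ≠ 0 then h.choose else 0
  have hγ : ∀ w ∈ geom (XP S G), w (ch (P w), γ w) ≠ 0 := by
    intro w hw
    have h : ∃ g, w (ch (P w), g) ≠ 0 := hch (P w) (hne w hw)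
    simp only [γ, dif_pos h]
    exact h.choose_spec
  refine ⟨γ, fun w hw a => ?_⟩
  have hP : P (act a w) = P w := by
    ext o
    constructor
    · rintro ⟨g, hg⟩; exact ⟨g - a, hg⟩
    · rintro ⟨g, hg⟩; exact ⟨g + a, by simpa [act] using hg⟩
  have h1 := hγ _ (act_mem hw a)
  rw [hP] at h1
  have h2 := hγ _ hw
  have h1' : w (ch (P w), γ (act a w) - a) ≠ 0 := h1
  have := XP_unique hw.2.2 (mem_wsupp.2 h1') (mem_wsupp.2 h2)
  rw [← this]; abel

end testmap

end Tvb

namespace Tvb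
set_option linter.unusedSectionVars false

section push

variable {k : Type*} [Field k] {V : Type*} [Fintype V] [DecidableEq V] [Nonempty V]
  {G : Type*} [Fintype G] [DecidableEq G] [AddCommGroup G] {S : Set (Finset V)}

/-- the realization of `XP` as a type -/
abbrev XT (S : Set (Finset V)) (G : Type*) [Fintype G] [DecidableEq G] :=
  {w : Option V × G → ℝ // w ∈ geom (XP S G)}

/-- the action on the realization -/
def actX (a : G) (x : XT S G) : XT S G := ⟨act a x.1, act_mem x.2 a⟩

lemma push_seq (hS : IsLowerSet S) (h0 : ∅ ∈ S) {u v : AddMonoidAlgebra k G} (huv : u * v = 0)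
    (hv : fn 1 v = 0) (n : ℕ) (hA : ∀ j ≤ n, Ac k (XP S G) j) {δ : ℝ} (hδ : 0 < δ) :
    ∃ z : ℕ → Ch k (XT S G), SeqP actX u v n 1 z ∧
      z n ∈ sp k (fun l => ∀ x ∈ l, ∀ y ∈ l, dist x.1 y.1 ≤ δ) := by
  have hX0 : (∅ : Finset (Option V × G)) ∈ XP S G := by
    right
    refine ⟨0, by simp, ?_⟩
    have : sl (∅ : Finset (Option V × G)) 0 = ∅ := by ext v; simp
    rw [this]; exact h0
  obtain ⟨z, z1, z2, z3⟩ := exists_seq (XP_lower hS) hX0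
    (τ := fun a x => ((x.1, x.2 + a) : Option V × G))
    (fun a b x => Prod.ext rfl (by simp only; abel)) (fun a A hA => XP_shift hA a) huv hv n hA
  obtain ⟨M, hM⟩ := exists_M (n + 1) 1 hδ
  have hne : (Pi.single (none, 0) 1 : Option V × G → ℝ) ∈ geom (XP S G) := by
    refine sim_sub_geom (XP_lower hS) (A := {(none, 0)}) ?_ (single_mem_sim (by simp))
    right
    refine ⟨0, by simp, ?_⟩
    have : sl ({(none, 0)} : Finset (Option V × G)) 0 = ∅ := by ext v; simp
    rw [this]; exact h0
  classical
  let ret : (Option V × G → ℝ) → XT S G := fun w => if h : w ∈ geom (XP S G) then ⟨w, h⟩ else ⟨_, hne⟩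
  have hret : ∀ w (h : w ∈ geom (XP S G)), ret w = ⟨w, h⟩ := fun w h => by simp only [ret, dif_pos h]
  let e : Option V × G → (Option V × G → ℝ) := fun x => Pi.single x 1
  let zz : ℕ → Ch k (Option V × G → ℝ) := fun j => sdi k M (j + 1) (mp e (z j))
  have hlen : ∀ j ≤ n, mp e (z j) ∈ sp k (fun l => l.length = j + 1) := fun j hj =>
    mp_mem (fun l hl => by simp [hl.1]) (z1 j hj)
  have hzz : ∀ j ≤ n, zz j ∈ sp k (fun l => l.length = j + 1 ∧ (∀ x ∈ l, x ∈ geom (XP S G)) ∧ Sm δ l) := by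
    intro j hj
    refine sp_mono ?_ (sdi_vert k (j := n + 1) (m := j + 1) (by omega) hM (XP S G) (z1 j hj))
    rintro l ⟨h1, ⟨_, ⟨A, hA, rfl⟩, h2⟩, h3⟩
    exact ⟨h1, fun x hx => sim_sub_geom (XP_lower hS) hA (h2 x hx), h3⟩
  have hact : ∀ a x, e (x.1, x.2 + a) = act a (e x) := by
    intro a x
    funext y
    simp only [e, act, Pi.single_apply]
    congr 1
    rw [eq_iff_iff]
    constructor
    · rintro rfl; simp
    · rintro rfl; simp
  have hzb0 : bd (zz 0) = Finsupp.single [] 1 := by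
    simp only [zz]
    rw [bd_sdi M 0 (hlen 0 (by omega)), sdi_len_zero, bd_mp, z2]
    simp
  have hzb : ∀ j < n, bd (zz (j + 1)) = rh act (if Even j then v else u) (zz j) := by
    intro j hj
    simp only [zz]
    rw [bd_sdi M (j + 1) (hlen (j + 1) (by omega)), bd_mp, z3 j hj]
    refine rh_comm (L := sdi k M (j + 1) ∘ₗ mp e) (fun a => ?_) _
    simp only [LinearMap.comp_apply]
    have := mp_sdi (k := k) (LinearMap.funLeft ℝ ℝ (fun x : Option V × G => (x.1, x.2 - a))) M (j + 1) (mp e (z j))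
    have h2 : (⇑(LinearMap.funLeft ℝ ℝ (fun x : Option V × G => (x.1, x.2 - a)))) = act a := by
      funext w; rfl
    rw [h2] at this
    rw [this, mp_mp, mp_mp]
    congr 2
    congr 1
    funext x
    exact hact a x
  refine ⟨fun j => mp ret (zz j), ⟨?_, ?_, ?_⟩, ?_⟩
  · intro j hj
    exact mp_mem (fun l hl => by simp [hl.1]) (hzz j hj)
  · show bd (mp ret (zz 0)) = _
    rw [bd_mp, hzb0]; simp
  · intro j hj
    show bd (mp ret (zz (j + 1))) = _
    rw [bd_mp, hzb j hj]
    refine rh_comm (fun a => ?_) _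
    refine eq_on_sp (f := mp ret ∘ₗ mp (act a)) (g := mp (actX a) ∘ₗ mp ret) (fun l hl => ?_) (hzz j hj.le)
    simp only [LinearMap.comp_apply, mp_single, List.map_map]
    congr 1
    refine List.map_congr_left (fun x hx => ?_)
    simp only [Function.comp_apply]
    rw [hret x (hl.2.1 x hx), hret _ (act_mem (hl.2.1 x hx) a)]
    rfl
  · refine mp_mem (fun l hl => ?_) (hzz n le_rfl)
    intro x hx y hy
    obtain ⟨x', hx', rfl⟩ := List.mem_map.1 hx
    obtain ⟨y', hy', rfl⟩ := List.mem_map.1 hy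
    rw [hret x' (hl.2.1 x' hx'), hret y' (hl.2.1 y' hy')]
    exact hl.2.2 x' hx' y' hy'

end push

end Tvb

namespace Tvb
set_option linter.unusedSectionVars false

section kill

lemma z2_cases : ∀ c : ZMod 2, c = 0 ∨ c = 1 := by decide

lemma z2_add : (1 : ZMod 2) + 1 = 0 := by decide

variable {k : Type*} [Field k] {p : ℕ} [hp : Fact p.Prime] [Algebra (ZMod p) k] {s : ℕ} {Ω : Type*}

/-- the character of `ZMod p` -/
noncomputable def ec (p : ℕ) [Fact p.Prime] (c : ZMod p) : ℂ :=
  Complex.exp (((c.val : ℝ) / p * (2 * Real.pi) : ℝ) * Complex.I)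

lemma round_quarter {d : ℝ} (h : 0 < Real.cos (2 * Real.pi * d)) : |d - round d| < 1 / 3 := by
  by_contra hc
  push Not at hc
  have h1 := abs_sub_round d
  have h2 : Real.cos (2 * Real.pi * d) = Real.cos (2 * Real.pi * |d - round d|) := by
    have e1 : Real.cos (2 * Real.pi * |d - round d|) = Real.cos (|2 * Real.pi * (d - round d)|) := by
      rw [abs_mul, abs_of_pos Real.two_pi_pos]
    rw [e1, Real.cos_abs, mul_sub, mul_comm _ ((round d : ℤ) : ℝ), Real.cos_sub_int_mul_two_pi]
  rw [h2] at h
  have := Real.cos_nonpos_of_pi_div_two_le_of_le (x := 2 * Real.pi * |d - round d|)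
    (by nlinarith [Real.pi_pos]) (by nlinarith [Real.pi_pos])
  linarith

lemma theta_exists {G : Type*} [AddCommGroup G] (τ : G → Ω → Ω) (χ : G →+ ZMod p) (F : Ω → ℂ) (γ : Ω → G)
    (hγ : ∀ a x, γ (τ a x) = γ x + a) (hF : ∀ a x, F (τ a x) = ec p (χ a) * F x) :
    ∃ (Θ : Ω → ℝ) (q : G → Ω → ℤ), (∀ a x, Θ (τ a x) = Θ x + ((χ a).val : ℝ) / p + q a x) ∧
      ∀ x y, 0 < (F y * (starRingEnd ℂ) (F x)).re → |(Θ y - Θ x) - round (Θ y - Θ x)| < 1 / 3 := by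
  classical
  have hp0 : (p : ℝ) ≠ 0 := by exact_mod_cast hp.out.ne_zero
  let Θ : Ω → ℝ := fun x => if F x = 0 then ((χ (γ x)).val : ℝ) / p else (F x).arg / (2 * Real.pi)
  have hex : ∀ a x, ∃ q : ℤ, Θ (τ a x) = Θ x + ((χ a).val : ℝ) / p + q := by
    intro a x
    by_cases h : F x = 0
    · have h' : F (τ a x) = 0 := by rw [hF, h, mul_zero]
      refine ⟨-(cr (χ (γ x)) (χ a) : ℕ), ?_⟩
      simp only [Θ, if_pos h, if_pos h', hγ, map_add]
      have := cr_eq (χ (γ x)) (χ a)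
      have h2 : (((χ (γ x) + χ a).val : ℝ) + p * (cr (χ (γ x)) (χ a) : ℕ)) = (χ (γ x)).val + (χ a).val := by
        exact_mod_cast this
      push_cast
      field_simp
      linarith
    · have hne : ec p (χ a) ≠ 0 := Complex.exp_ne_zero _
      have h' : F (τ a x) ≠ 0 := by rw [hF]; exact mul_ne_zero hne h
      simp only [Θ, if_neg h, if_neg h']
      have hn : ‖F (τ a x)‖ = ‖F x‖ := by
        rw [hF, norm_mul, ec, Complex.norm_exp_ofReal_mul_I, one_mul]
      have e1 := Complex.norm_mul_exp_arg_mul_I (F (τ a x))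
      have e2 := Complex.norm_mul_exp_arg_mul_I (F x)
      have h3 : Complex.exp ((F (τ a x)).arg * Complex.I) =
          Complex.exp ((((χ a).val : ℝ) / p * (2 * Real.pi) : ℝ) * Complex.I + (F x).arg * Complex.I) := by
        rw [Complex.exp_add]
        have hx : (‖F x‖ : ℂ) ≠ 0 := by exact_mod_cast norm_ne_zero_iff.2 h
        apply mul_left_cancel₀ hx
        calc (‖F x‖ : ℂ) * Complex.exp ((F (τ a x)).arg * Complex.I) = F (τ a x) := by rw [← hn]; exact e1
          _ = ec p (χ a) * F x := hF a x
          _ = ec p (χ a) * (‖F x‖ * Complex.exp ((F x).arg * Complex.I)) := by rw [e2]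
          _ = _ := by rw [ec]; ring
      obtain ⟨n, hn⟩ := Complex.exp_eq_exp_iff_exists_int.1 h3
      refine ⟨n, ?_⟩
      have h4 : (F (τ a x)).arg = ((χ a).val : ℝ) / p * (2 * Real.pi) + (F x).arg + n * (2 * Real.pi) := by
        have := congrArg Complex.im hn
        simpa using this
      rw [h4]
      have := Real.pi_ne_zero
      field_simp
      ring
  choose q hq using hex
  refine ⟨Θ, q, hq, fun x y hxy => round_quarter ?_⟩
  have hx : F x ≠ 0 := by rintro h; simp [h] at hxy
  have hy : F y ≠ 0 := by rintro h; simp [h] at hxy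
  simp only [Θ, if_neg hx, if_neg hy]
  have e : 2 * Real.pi * ((F y).arg / (2 * Real.pi) - (F x).arg / (2 * Real.pi)) = (F y).arg - (F x).arg := by
    have := Real.pi_ne_zero
    field_simp
  rw [e, Real.cos_sub, Complex.cos_arg hx, Complex.cos_arg hy, Complex.sin_arg, Complex.sin_arg]
  have nx := norm_pos_iff.2 hx
  have ny := norm_pos_iff.2 hy
  have h5 : (F y).re / ‖F y‖ * ((F x).re / ‖F x‖) + (F y).im / ‖F y‖ * ((F x).im / ‖F x‖)
      = ((F y) * (starRingEnd ℂ) (F x)).re / (‖F y‖ * ‖F x‖) := by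
    simp only [Complex.mul_re, Complex.conj_re, Complex.conj_im]
    field_simp
    ring
  rw [h5]
  positivity

/-- nonvanishing of the Euler constants -/
def chc (α : Fin s → k) (χ : (Fin s → ZMod p) →+ ZMod p) : k :=
  ∑ l, α l * algebraMap (ZMod p) k (χ (Pi.single l 1))

lemma kill_odd {ι : Type*} (α : Fin s → k) (τ : (Fin s → ZMod p) → Ω → Ω)
    (hτ : ∀ a b x, τ (a + b) x = τ a (τ b x))
    (χ : ι → ((Fin s → ZMod p) →+ ZMod p)) (hχ : ∀ i, chc α (χ i) ≠ 0) (F : ι → Ω → ℂ)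
    (γ : Ω → (Fin s → ZMod p)) (hγ : ∀ a x, γ (τ a x) = γ x + a)
    (hF : ∀ i a x, F i (τ a x) = ec p (χ i a) * F i x) (is : List ι) (z : ℕ → Ch k Ω)
    (hz : SeqP τ (NN α ^ (p - 1)) (NN α) (is.length * 2) 1 z)
    (hzs : z (is.length * 2) ∈ sp k (fun l => ∃ i ∈ is, ∀ x ∈ l, ∀ y ∈ l,
      0 < (F i y * (starRingEnd ℂ) (F i x)).re)) : False := by
  have hp0 : (p : ℝ) ≠ 0 := by exact_mod_cast hp.out.ne_zero
  choose Θ q hq hΘ using fun i => theta_exists τ (χ i) (F i) γ hγ (hF i)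
  let m : ι → Ω → Ω → k := fun i x y => -((round (Θ i y - Θ i x) : ℤ) : k)
  refine seq_kill 2 (fun i => cap2 (m i)) (fun i l => ∀ x ∈ l, ∀ y ∈ l,
      0 < (F i y * (starRingEnd ℂ) (F i x)).re) ?_ ?_ ?_ ?_ is 1 z one_ne_zero hz hzs
  · rintro i (_ | ⟨x, _ | ⟨y, _ | ⟨w, l⟩⟩⟩)
    · exact ⟨0, by simp [cap2]⟩
    · exact ⟨0, by simp [cap2]⟩
    · exact ⟨0, by simp [cap2]⟩
    · exact ⟨dm (m i) x y w, by simp⟩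
  · intro i l hl x hx y hy
    exact hl x (List.mem_of_mem_drop hx) y (List.mem_of_mem_drop hy)
  · rintro i (_ | ⟨x, _ | ⟨y, _ | ⟨w, l⟩⟩⟩) hl
    · simp [cap2]
    · simp [cap2]
    · simp [cap2]
    · have h1 := hΘ i x y (hl x (by simp) y (by simp))
      have h2 := hΘ i x w (hl x (by simp) w (by simp))
      have h3 := hΘ i y w (hl y (by simp) w (by simp))
      have h4 : round (Θ i w - Θ i y) - round (Θ i w - Θ i x) + round (Θ i y - Θ i x) = 0 := by
        rw [abs_lt] at h1 h2 h3
        have l1 : ((round (Θ i w - Θ i y) - round (Θ i w - Θ i x) + round (Θ i y - Θ i x) : ℤ) : ℝ) < 1 := by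
          push_cast; linarith
        have l2 : (-1 : ℝ) < ((round (Θ i w - Θ i y) - round (Θ i w - Θ i x) + round (Θ i y - Θ i x) : ℤ) : ℝ) := by
          push_cast; linarith
        have l3 : round (Θ i w - Θ i y) - round (Θ i w - Θ i x) + round (Θ i y - Θ i x) < 1 := by exact_mod_cast l1
        have l4 : -1 < round (Θ i w - Θ i y) - round (Θ i w - Θ i x) + round (Θ i y - Θ i x) := by exact_mod_cast l2
        omega
      have h5 : dm (m i) x y w = 0 := by
        have := congrArg (fun n : ℤ => -(n : k)) h4
        simp only [dm, m]
        push_cast at this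
        linear_combination this
      simp [h5]
  · intro i n c z hz hc
    have h1 := NN_mul (p := p) α
    have h2 := fn1_NN_pow (p := p) α
    have h3 := fun hm hq => step_odd h1 h2 (m := m i) (q := fun a x => (q i a x : k))
      (w := fun a b => -((cr (χ i a) (χ i b) : ℕ) : k)) hm hq hz
    refine ⟨_, ?_, h3 ?_ ?_⟩
    clear h3
    · rw [bil_NN]
      exact neg_ne_zero.2 (mul_ne_zero hc (neg_ne_zero.2 (pow_ne_zero p (hχ i))))
    · intro a x y
      have : Θ i (τ a y) - Θ i (τ a x) = (Θ i y - Θ i x) + ((q i a y - q i a x : ℤ) : ℝ) := by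
        rw [hq, hq]; push_cast; ring
      simp only [m]
      rw [this, round_add_intCast]
      push_cast
      ring
    · intro a b x
      have h1 := hq i a (τ b x)
      have h2 := hq i b x
      have h3 := hq i (a + b) x
      rw [hτ, h1, h2, map_add] at h3
      have h4 : (((χ i a + χ i b).val : ℝ) + p * (cr (χ i a) (χ i b) : ℕ)) = (χ i a).val + (χ i b).val := by
        exact_mod_cast cr_eq (χ i a) (χ i b)
      have h5 : q i a (τ b x) = q i (a + b) x - q i b x - (cr (χ i a) (χ i b) : ℕ) := by
        have h6 : ((q i a (τ b x) : ℤ) : ℝ) = ((q i (a + b) x - q i b x - (cr (χ i a) (χ i b) : ℕ) : ℤ) : ℝ) := by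
          push_cast
          field_simp at h3
          have : (p : ℝ) * (q i a (τ b x)) = p * (q i (a + b) x - q i b x - (cr (χ i a) (χ i b) : ℕ)) := by
            linarith
          exact mul_left_cancel₀ hp0 this
        exact_mod_cast h6
      rw [h5]
      push_cast
      ring

lemma kill_even {ι : Type*} (hp2 : p = 2) (α : Fin s → k) (τ : (Fin s → ZMod p) → Ω → Ω)
    (χ : ι → ((Fin s → ZMod p) →+ ZMod p)) (hχ : ∀ i, chc α (χ i) ≠ 0) (F : ι → Ω → ℂ)
    (γ : Ω → (Fin s → ZMod p)) (hγ : ∀ a x, γ (τ a x) = γ x + a)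
    (hF : ∀ i a x, F i (τ a x) = ec p (χ i a) * F i x) (hFr : ∀ i x, (F i x).im = 0)
    (is : List ι) (z : ℕ → Ch k Ω)
    (hz : SeqP τ (NN α ^ (p - 1)) (NN α) (is.length * 1) 1 z)
    (hzs : z (is.length * 1) ∈ sp k (fun l => ∃ i ∈ is, ∀ x ∈ l, ∀ y ∈ l,
      0 < (F i y * (starRingEnd ℂ) (F i x)).re)) : False := by
  have hch : CharP k p := charK
  subst hp2
  simp only [Nat.add_one_sub_one, pow_one] at hz
  classical
  let S : ι → Ω → ZMod 2 := fun i x => if 0 < (F i x).re then 0 else if (F i x).re < 0 then 1 else χ i (γ x)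
  have hS : ∀ i a x, S i (τ a x) = S i x + χ i a := by
    intro i a x
    have hc : ∀ c : ZMod 2, c = 0 ∨ c = 1 := z2_cases
    have h11 : (1 : ZMod 2) + 1 = 0 := z2_add
    rcases hc (χ i a) with h | h
    · have : F i (τ a x) = F i x := by rw [hF, h]; simp [ec]
      simp only [S, this, hγ, map_add, h, add_zero]
    · have : F i (τ a x) = - F i x := by
        rw [hF, h, ec]
        have : (((1 : ZMod 2).val : ℝ) / (2 : ℕ) * (2 * Real.pi) : ℝ) = Real.pi := by
          have : (1 : ZMod 2).val = 1 := rfl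
          rw [this]; push_cast; ring
        rw [this, Complex.exp_pi_mul_I]; ring
      simp only [S, this, hγ, map_add, h, Complex.neg_re]
      rcases lt_trichotomy (F i x).re 0 with h0 | h0 | h0
      · rw [if_pos (by linarith), if_neg (by linarith), if_pos h0, h11]
      · simp [h0]
      · rw [if_neg (by linarith), if_pos (by linarith), if_pos h0, zero_add]
  refine seq_kill 1 (fun i => cap1 (fun x => algebraMap (ZMod 2) k (S i x))) (fun i l => ∀ x ∈ l, ∀ y ∈ l,
      0 < (F i y * (starRingEnd ℂ) (F i x)).re) ?_ ?_ ?_ ?_ is 1 z one_ne_zero hz hzs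
  · rintro i (_ | ⟨x, _ | ⟨y, l⟩⟩)
    · exact ⟨0, by simp [cap1]⟩
    · exact ⟨0, by simp [cap1]⟩
    · exact ⟨algebraMap (ZMod 2) k (S i y) - algebraMap (ZMod 2) k (S i x), by simp⟩
  · intro i l hl x hx y hy
    exact hl x (List.mem_of_mem_drop hx) y (List.mem_of_mem_drop hy)
  · rintro i (_ | ⟨x, _ | ⟨y, l⟩⟩) hl
    · simp [cap1]
    · simp [cap1]
    · have h1 := hl x (by simp) y (by simp)
      simp only [Complex.mul_re, Complex.conj_re, Complex.conj_im, hFr, zero_mul, sub_zero] at h1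
      have h5 : S i y = S i x := by
        simp only [S]
        rcases lt_trichotomy (F i x).re 0 with h0 | h0 | h0
        · have : (F i y).re < 0 := by by_contra h; push Not at h; nlinarith
          rw [if_neg (by linarith), if_pos this, if_neg (by linarith), if_pos h0]
        · simp [h0] at h1
        · have : 0 < (F i y).re := by by_contra h; push Not at h; nlinarith
          rw [if_pos this, if_pos h0]
      simp [h5]
  · intro i n c z hz hc
    refine ⟨_, ?_, step_even (fn1_NN α) (s := fun x => algebraMap (ZMod 2) k (S i x))
      (χ := fun a => algebraMap (ZMod 2) k (χ i a)) (fun a x => ?_) hz⟩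
    · rw [fn_NN]
      refine mul_ne_zero hc ?_
      simpa [chc] using hχ i
    · rw [hS, map_add]

end kill

end Tvb

namespace Tvb
set_option linter.unusedSectionVars false

lemma zmod_neg_two {p : ℕ} (h : p = 2) (x : ZMod p) : -x = x := by
  subst h; revert x; decide

section fourier

variable {p : ℕ} [hp : Fact p.Prime] {s : ℕ}

lemma ec_eq (c : ZMod p) : ec p c = ZMod.stdAddChar c := by
  have := ZMod.stdAddChar_coe (N := p) (c.val : ℤ)
  rw [Int.cast_natCast, ZMod.natCast_zmod_val] at this
  rw [this, ec]
  congr 1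
  push_cast
  ring

/-- pairing with a vector -/
def dot (c : Fin s → ZMod p) : (Fin s → ZMod p) →+ ZMod p where
  toFun g := c ⬝ᵥ g
  map_zero' := by simp
  map_add' := by intros; simp [dotProduct_add]

lemma dot_apply (c g : Fin s → ZMod p) : dot c g = c ⬝ᵥ g := rfl

lemma orth (x : Fin s → ZMod p) :
    ∑ c : Fin s → ZMod p, (ZMod.stdAddChar (c ⬝ᵥ x) : ℂ) = if x = 0 then ((p : ℂ) ^ s) else 0 := by
  split_ifs with h
  · subst h
    simp [ZMod.card]
  · let φ : AddChar (Fin s → ZMod p) ℂ := ZMod.stdAddChar.compAddMonoidHom (dot x)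
    have hφ : ∀ c, φ c = (ZMod.stdAddChar (c ⬝ᵥ x) : ℂ) := fun c => by
      rw [dotProduct_comm]; rfl
    have h1 : φ ≠ 0 := by
      intro h0
      apply h
      funext l
      have := DFunLike.congr_fun h0 (Pi.single l 1)
      rw [hφ, AddChar.zero_apply] at this
      have h2 : (ZMod.stdAddChar (Pi.single l 1 ⬝ᵥ x) : ℂ) = ZMod.stdAddChar (0 : ZMod p) := by simpa using this
      have h3 := ZMod.injective_stdAddChar h2
      simpa using h3
    rw [← AddChar.sum_eq_zero_iff_ne_zero.2 h1]
    exact Finset.sum_congr rfl (fun c _ => (hφ c).symm)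

lemma const_of_fourier (y : (Fin s → ZMod p) → ℝ)
    (h : ∀ c : Fin s → ZMod p, c ≠ 0 → ∑ g, ec p (dot c g) * (y g : ℂ) = 0) (g g') : y g = y g' := by
  have key : ∀ b, ((p : ℂ) ^ s) * (y b : ℂ) = ∑ g, (y g : ℂ) := by
    intro b
    have h1 : ∑ c : Fin s → ZMod p, (ZMod.stdAddChar (- (c ⬝ᵥ b)) : ℂ) * ∑ g, ec p (dot c g) * (y g : ℂ)
        = ∑ g, (y g : ℂ) := by
      rw [Finset.sum_eq_single 0]
      · simp [ec_eq, dot_apply]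
      · intro c _ hc
        rw [h c hc, mul_zero]
      · simp
    rw [← h1]
    simp_rw [Finset.mul_sum]
    rw [Finset.sum_comm]
    have h2 : ∀ g : Fin s → ZMod p, ∑ c : Fin s → ZMod p,
        (ZMod.stdAddChar (- (c ⬝ᵥ b)) : ℂ) * (ec p (dot c g) * (y g : ℂ)) =
        if g = b then ((p : ℂ) ^ s) * y b else 0 := by
      intro g
      have h3 : ∀ c : Fin s → ZMod p, (ZMod.stdAddChar (- (c ⬝ᵥ b)) : ℂ) * (ec p (dot c g) * (y g : ℂ))
          = ZMod.stdAddChar (c ⬝ᵥ (g - b)) * (y g : ℂ) := by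
        intro c
        rw [ec_eq, dot_apply, ← mul_assoc, ← AddChar.map_add_eq_mul, dotProduct_sub]
        congr 2
        ring
      rw [Finset.sum_congr rfl (fun c _ => h3 c), ← Finset.sum_mul, orth]
      by_cases hgb : g = b
      · subst hgb; simp
      · rw [if_neg (sub_ne_zero.2 hgb), if_neg hgb, zero_mul]
    rw [Finset.sum_congr rfl (fun g _ => h2 g)]
    simp
  have hp0 : ((p : ℂ) ^ s) ≠ 0 := pow_ne_zero _ (by exact_mod_cast hp.out.ne_zero)
  have := mul_left_cancel₀ hp0 ((key g).trans (key g').symm)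
  exact_mod_cast this

lemma half_system (h2 : p ≠ 2) : ∃ H : Finset (Fin s → ZMod p), 0 ∉ H ∧
    (∀ c, c ≠ 0 → c ∈ H ∨ -c ∈ H) ∧ H.card * 2 = p ^ s - 1 := by
  classical
  let e := Fintype.equivFin (Fin s → ZMod p)
  have hodd : ∀ c : Fin s → ZMod p, c = -c → c = 0 := by
    intro c hc
    funext l
    have h1 : c l = - c l := congrFun hc l
    have : Fact (2 < p) := ⟨lt_of_le_of_ne hp.out.two_le (Ne.symm h2)⟩
    exact (ZMod.neg_eq_self_iff (c l)).1 h1.symm |>.resolve_right (fun h => by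
      have := hp.out.eq_two_or_odd
      omega)
  let H : Finset (Fin s → ZMod p) := Finset.univ.filter (fun c => e c < e (-c))
  have h0 : (0 : Fin s → ZMod p) ∉ H := by simp [H]
  have hor : ∀ c, c ≠ 0 → c ∈ H ∨ -c ∈ H := by
    intro c hc
    simp only [H, Finset.mem_filter, Finset.mem_univ, true_and, neg_neg]
    exact lt_or_gt_of_ne (fun h => hc (hodd c (e.injective h)))
  refine ⟨H, h0, hor, ?_⟩
  have hd : Disjoint H (H.image Neg.neg) := by
    rw [Finset.disjoint_left]
    intro c hc hc'
    obtain ⟨b, hb, rfl⟩ := Finset.mem_image.1 hc'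
    simp only [H, Finset.mem_filter, Finset.mem_univ, true_and, neg_neg] at hc hb
    exact lt_asymm hc hb
  have hu : H ∪ H.image Neg.neg = Finset.univ.erase 0 := by
    ext c
    simp only [Finset.mem_union, Finset.mem_image, Finset.mem_erase, Finset.mem_univ, and_true]
    constructor
    · rintro (h | ⟨b, hb, rfl⟩) h'
      · subst h'; exact h0 h
      · rw [neg_eq_zero] at h'; subst h'; exact h0 hb
    · intro h
      rcases hor c h with h | h
      · exact Or.inl h
      · exact Or.inr ⟨-c, h, neg_neg c⟩
  have := congrArg Finset.card hu
  rw [Finset.card_union_of_disjoint hd, Finset.card_image_of_injective _ neg_injective,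
    Finset.card_erase_of_mem (Finset.mem_univ _), Finset.card_univ, Fintype.card_fun, ZMod.card,
    Fintype.card_fin] at this
  omega

end fourier

section mainG

variable {k : Type*} [Field k] {p : ℕ} [hp : Fact p.Prime] [Algebra (ZMod p) k] {s : ℕ}
  {V : Type*} [Fintype V] [DecidableEq V] [Nonempty V] {S : Set (Finset V)} {d : ℕ}

/-- Fourier components of the test map -/
noncomputable def FF (f : (V → ℝ) → Fin d → ℝ) (c : Fin s → ZMod p) (j : Option (Fin d))
    (w : Option V × (Fin s → ZMod p) → ℝ) : ℂ := ∑ g, ec p (dot c g) * (YY f w g j : ℂ)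

lemma FF_act (f : (V → ℝ) → Fin d → ℝ) (c : Fin s → ZMod p) (j : Option (Fin d)) (a)
    (w : Option V × (Fin s → ZMod p) → ℝ) : FF f c j (act a w) = ec p (dot c a) * FF f c j w := by
  rw [FF, FF, Finset.mul_sum, ← Equiv.sum_comp (Equiv.addRight a)]
  refine Finset.sum_congr rfl (fun g _ => ?_)
  simp only [Equiv.coe_addRight, YY_act, add_sub_cancel_right, ec_eq, map_add, AddChar.map_add_eq_mul]
  ring

lemma FF_neg (f : (V → ℝ) → Fin d → ℝ) (c : Fin s → ZMod p) (j : Option (Fin d))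
    (w : Option V × (Fin s → ZMod p) → ℝ) : FF f (-c) j w = (starRingEnd ℂ) (FF f c j w) := by
  rw [FF, FF, map_sum]
  refine Finset.sum_congr rfl (fun g _ => ?_)
  rw [map_mul, Complex.conj_ofReal, ec_eq, ec_eq, ← AddChar.map_neg_eq_conj, dot_apply, dot_apply, neg_dotProduct]

lemma FF_cont (hS : IsLowerSet S) {f : (V → ℝ) → Fin d → ℝ} (hf : ContinuousOn f (geom S))
    (c : Fin s → ZMod p) (j : Option (Fin d)) :
    ContinuousOn (fun w => FF f c j w) (geom (XP S (Fin s → ZMod p))) := by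
  unfold FF
  refine continuousOn_finsetSum _ (fun g _ => continuousOn_const.mul ?_)
  exact Complex.continuous_ofReal.comp_continuousOn (YY_cont hS hf g j)

lemma re_pos {x y z : ℂ} {κ : ℝ} (hκ : 0 < κ) (hz : κ ≤ ‖z‖) (hx : ‖x - z‖ < κ / 4) (hy : ‖y - z‖ < κ / 4) :
    0 < (y * (starRingEnd ℂ) x).re := by
  have h := Complex.normSq_sub y x
  rw [Complex.normSq_eq_norm_sq, Complex.normSq_eq_norm_sq, Complex.normSq_eq_norm_sq] at h
  have h1 : ‖y - x‖ < κ / 2 := by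
    have : y - x = (y - z) - (x - z) := by ring
    rw [this]
    exact (norm_sub_le _ _).trans_lt (by linarith)
  have h2 : 3 * κ / 4 < ‖y‖ := by
    have := norm_sub_norm_le z y
    rw [norm_sub_rev] at this
    linarith
  nlinarith [norm_nonneg (y - x), norm_nonneg x]

lemma chc_ne {α : Fin s → k} (hα : LinearIndependent (ZMod p) α) {c : Fin s → ZMod p} (hc : c ≠ 0) :
    chc α (dot c) ≠ 0 := by
  intro h
  apply hc
  funext l
  refine Fintype.linearIndependent_iff.1 hα c ?_ l
  rw [← h, chc]
  refine Finset.sum_congr rfl (fun l _ => ?_)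
  rw [dot_apply, dotProduct_single, mul_one, Algebra.smul_def, mul_comm]

theorem main_G {α : Fin s → k} (hα : LinearIndependent (ZMod p) α) (hs : s ≠ 0)
    (hS : IsLowerSet S) (h0 : ∅ ∈ S) {f : (V → ℝ) → Fin d → ℝ} (hf : ContinuousOn f (geom S))
    (hA : ∀ j ≤ (d + 1) * (p ^ s - 1), Ac k (XP S (Fin s → ZMod p)) j) :
    ∃ u : (Fin s → ZMod p) → V → ℝ, (∀ g, u g ∈ geom S) ∧
      (∀ g g', g ≠ g' → Disjoint (wsupp (u g)) (wsupp (u g'))) ∧ ∀ g g', f (u g) = f (u g') := by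
  classical
  have hnt : Nonempty (Fin s) := ⟨⟨0, Nat.pos_of_ne_zero hs⟩⟩
  by_contra hcon
  have hps : 0 < p ^ s - 1 := by
    have := Nat.one_lt_pow hs hp.out.one_lt
    omega
  obtain ⟨t, H, hH0, hH, hcard, ht⟩ : ∃ (t : ℕ) (H : Finset (Fin s → ZMod p)), 0 ∉ H ∧
      (∀ c, c ≠ 0 → c ∈ H ∨ -c ∈ H) ∧ H.card * t = p ^ s - 1 ∧ (t = 2 ∨ (t = 1 ∧ p = 2)) := by
    by_cases h2 : p = 2
    · refine ⟨1, Finset.univ.erase 0, by simp, fun c hc => Or.inl (by simp [hc]), ?_, Or.inr ⟨rfl, h2⟩⟩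
      rw [Finset.card_erase_of_mem (Finset.mem_univ _), Finset.card_univ, Fintype.card_fun, ZMod.card,
        Fintype.card_fin, mul_one]
    · obtain ⟨H, h1, h3, h4⟩ := half_system (s := s) h2
      exact ⟨2, H, h1, h3, h4, Or.inl rfl⟩
  have hHne : H.Nonempty := by
    rw [Finset.nonempty_iff_ne_empty]
    rintro rfl
    simp at hcard
    omega
  obtain ⟨c0, hc0⟩ := hHne
  have hne : Nonempty (H × Option (Fin d)) := ⟨(⟨c0, hc0⟩, none)⟩
  let F : H × Option (Fin d) → (Option V × (Fin s → ZMod p) → ℝ) → ℂ := fun i w => FF f i.1.1 i.2 w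
  have hZ : IsCompact (geom (XP S (Fin s → ZMod p))) := geom_compact (XP_lower hS)
  have hFc : ∀ i, ContinuousOn (F i) (geom (XP S (Fin s → ZMod p))) := fun i => FF_cont hS hf _ _
  have hpos : ∀ w ∈ geom (XP S (Fin s → ZMod p)), ∃ i, 0 < ‖F i w‖ := by
    intro w hw
    by_contra hall
    push Not at hall
    have hz : ∀ i, F i w = 0 := fun i => norm_le_zero_iff.1 (hall i)
    apply hcon
    refine tverberg_of_const hS hw (fun j g g' => const_of_fourier (fun g => YY f w g j) ?_ g g')
    intro c hc
    show FF f c j w = 0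
    rcases hH c hc with h | h
    · exact hz (⟨c, h⟩, j)
    · have h1 : FF f (-c) j w = 0 := hz (⟨-c, h⟩, j)
      have := FF_neg f (-c) j w
      rw [neg_neg, h1, map_zero] at this
      exact this
  obtain ⟨κ, hκ, hκ'⟩ := exists_kappa hZ (fun w i => ‖F i w‖) (continuousOn_pi.2 fun i => (hFc i).norm) hpos
  obtain ⟨δ, hδ, hδ'⟩ := unif_on hZ (fun w i => F i w) (continuousOn_pi.2 hFc) (ε := κ / 4) (by positivity)
  have hNu := NN_mul (p := p) α
  have hNv := fn1_NN (p := p) α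
  obtain ⟨z, hz, hzs⟩ := push_seq hS h0 hNu hNv _ hA hδ
  obtain ⟨γ, hγ⟩ := exists_gam (S := S) (G := Fin s → ZMod p)
  let is : List (H × Option (Fin d)) := Finset.univ.toList
  have hlen : is.length * t = (d + 1) * (p ^ s - 1) := by
    simp only [is, Finset.length_toList, Finset.card_univ, Fintype.card_prod, Fintype.card_coe,
      Fintype.card_option, Fintype.card_fin]
    rw [← hcard]; ring
  have hsm : z (is.length * t) ∈ sp k (fun l => ∃ i ∈ is, ∀ x ∈ l, ∀ y ∈ l,
      0 < (F i y.1 * (starRingEnd ℂ) (F i x.1)).re) := by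
    rw [hlen]
    refine sp_mono ?_ hzs
    intro l hl
    cases l with
    | nil => exact ⟨hne.some, by simp [is], by simp⟩
    | cons x0 l =>
      obtain ⟨i, hi⟩ := hκ' x0.1 x0.2
      have hcl : ∀ x ∈ x0 :: l, ‖F i x.1 - F i x0.1‖ < κ / 4 := by
        intro x hx
        have h1 := hδ' x.1 x.2 x0.1 x0.2 (hl x hx x0 (by simp))
        rw [← dist_eq_norm]
        exact lt_of_le_of_lt (dist_le_pi_dist (fun i => F i x.1) (fun i => F i x0.1) i) h1
      exact ⟨i, by simp [is], fun x hx y hy => re_pos hκ hi (hcl x hx) (hcl y hy)⟩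
  rw [← hlen] at hz
  have hχ : ∀ i : H × Option (Fin d), chc α (dot i.1.1) ≠ 0 := fun i => chc_ne hα (fun h => hH0 (h ▸ i.1.2))
  let τ : (Fin s → ZMod p) → XT S (Fin s → ZMod p) → XT S (Fin s → ZMod p) := actX
  have hτ : ∀ a b x, τ (a + b) x = τ a (τ b x) := fun a b x => Subtype.ext (act_add a b x.1)
  have hγ' : ∀ a x, γ (τ a x).1 = γ x.1 + a := fun a x => hγ x.1 x.2 a
  have hF' : ∀ (i : H × Option (Fin d)) a (x : XT S (Fin s → ZMod p)),
      F i (τ a x).1 = ec p (dot i.1.1 a) * F i x.1 := fun i a x => FF_act f i.1.1 i.2 a x.1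
  change SeqP τ _ _ _ _ _ at hz
  rcases ht with rfl | ⟨rfl, hp2⟩
  · have K := kill_odd α τ hτ (fun i : H × Option (Fin d) => dot i.1.1) hχ
      (fun i x => F i x.1) (fun x => γ x.1)
    have K1 := K hγ'
    have K2 := K1 hF' is z
    have K3 := K2 hz
    exact K3 hsm
  · have K := kill_even hp2 α τ (fun i : H × Option (Fin d) => dot i.1.1) hχ
      (fun i x => F i x.1) (fun x => γ x.1)
    have K1 := K hγ'
    have hr : ∀ (i : H × Option (Fin d)) (x : XT S (Fin s → ZMod p)), (F i x.1).im = 0 := by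
      intro i x
      rw [← Complex.conj_eq_iff_im]
      show (starRingEnd ℂ) (FF f i.1.1 i.2 x.1) = FF f i.1.1 i.2 x.1
      rw [← FF_neg]
      congr 1
      funext l
      rw [Pi.neg_apply]
      exact zmod_neg_two hp2 (i.1.1 l)
    have K2 := K1 hF' hr is z
    have K3 := K2 hz
    exact K3 hsm

end mainG

end Tvb

namespace Tvb
set_option linter.unusedSectionVars false

section absmain

variable {V : Type*} [Fintype V] [DecidableEq V] [Nonempty V]

theorem main_abs {S : Set (Finset V)} {d r : ℕ} (hr : IsPrimePow r) (hS : IsLowerSet S) (h0 : ∅ ∈ S)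
    (h : (V → ℝ) → EuclideanSpace ℝ (Fin ((d + 1) * (r - 1))))
    (g : EuclideanSpace ℝ (Fin ((d + 1) * (r - 1))) → V → ℝ) (hh : ContinuousOn h (geom S))
    (hg : ContinuousOn g (Metric.sphere 0 1)) (hm : ∀ w ∈ geom S, ‖h w‖ = 1)
    (gm : ∀ x, ‖x‖ = 1 → g x ∈ geom S) (gh : ∀ w ∈ geom S, g (h w) = w)
    (hgx : ∀ x, ‖x‖ = 1 → h (g x) = x) {f : (V → ℝ) → Fin d → ℝ} (hf : ContinuousOn f (geom S)) :
    ∃ u : Fin r → V → ℝ, (∀ i, u i ∈ geom S) ∧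
      (∀ i j, i ≠ j → Disjoint (wsupp (u i)) (wsupp (u j))) ∧ ∀ i j, f (u i) = f (u j) := by
  obtain ⟨p, s, hp, hs, rfl⟩ := hr
  have hpp : Fact p.Prime := ⟨hp.nat_prime⟩
  let k := GaloisField p s
  have hfr : Module.finrank (ZMod p) k = s := GaloisField.finrank p hs.ne'
  let b := Module.finBasisOfFinrankEq (ZMod p) k hfr
  have T1 : ∀ j, j + 1 ≤ (d + 1) * (p ^ s - 1) → Ac k S j := fun j hj =>
    sphere_T1 k hS h g hh hg hm gm gh j (by simpa using hj)
  have T2 : ∀ σ ∈ S, σ.Nonempty → ∀ j, Ac k {A | A ∈ S ∧ ¬ σ ⊆ A} j := fun σ hσ hne j =>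
    sphere_T2 k hS h g hh hg hm gm gh hgx σ hσ hne j
  have HA : ∀ j ≤ (d + 1) * (p ^ s - 1), Ac k (XP S (Fin s → ZMod p)) j :=
    XP_Ac h0 hS T1 (fun U hU j hj => Ac_sdiff hS T1 T2 U hU j hj)
  obtain ⟨u, u1, u2, u3⟩ := main_G b.linearIndependent hs.ne' hS h0 hf HA
  have hcard : Fintype.card (Fin s → ZMod p) = p ^ s := by
    rw [Fintype.card_fun, ZMod.card, Fintype.card_fin]
  let e := (Fintype.equivFinOfCardEq hcard).symm
  exact ⟨fun i => u (e i), fun i => u1 _, fun i j hij => u2 _ _ (fun hc => hij (e.injective hc)), fun i j => u3 _ _⟩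

end absmain

section geo

variable {N : ℕ} (S : SimplicialComplex ℝ (Fin N → ℝ))

/-- vertices of a geometric complex -/
abbrev VT := {x : Fin N → ℝ // {x} ∈ S.faces}

/-- forgetting that a point is a vertex -/
def vemb : VT S ↪ (Fin N → ℝ) := Function.Embedding.subtype _

/-- the abstract complex -/
def abK : Set (Finset (VT S)) := {A | A = ∅ ∨ A.map (vemb S) ∈ S.faces}

lemma abK_lower : IsLowerSet (abK S) := by
  intro A B hBA hA
  by_cases hB : B = ∅
  · exact Or.inl hB
  · right
    rcases hA with rfl | hA
    · exact absurd (Finset.subset_empty.1 hBA) hB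
    · exact S.down_closed hA (Finset.map_subset_map.2 hBA)
        (Finset.map_nonempty.2 (Finset.nonempty_iff_ne_empty.2 hB))

variable [Fintype (VT S)]

/-- the realization map -/
noncomputable def RR (w : VT S → ℝ) : Fin N → ℝ := ∑ v, w v • v.1

variable {S}

lemma wsupp_ne {w : VT S → ℝ} (hw : w ∈ geom (abK S)) : (wsupp w).Nonempty := by
  rw [Finset.nonempty_iff_ne_empty]
  intro h
  have h1 := hw.2.1
  rw [Finset.sum_eq_zero] at h1
  · simp at h1
  · intro v _
    by_contra hv
    have : v ∈ wsupp w := mem_wsupp.2 hv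
    rw [h] at this
    simp at this

lemma wsupp_face {w : VT S → ℝ} (hw : w ∈ geom (abK S)) : (wsupp w).map (vemb S) ∈ S.faces :=
  hw.2.2.resolve_left (Finset.nonempty_iff_ne_empty.1 (wsupp_ne hw))

lemma RR_mem {w : VT S → ℝ} (hw : w ∈ geom (abK S)) :
    RR S w ∈ convexHull ℝ (((wsupp w).map (vemb S) : Finset (Fin N → ℝ)) : Set (Fin N → ℝ)) := by
  have h1 : RR S w = ∑ v ∈ wsupp w, w v • v.1 := by
    rw [RR]
    symm
    apply Finset.sum_subset (Finset.subset_univ _)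
    intro v _ hv
    have : w v = 0 := by by_contra h; exact hv (mem_wsupp.2 h)
    rw [this, zero_smul]
  have h2 : ∑ v ∈ wsupp w, w v = 1 := by
    rw [← hw.2.1]
    apply Finset.sum_subset (Finset.subset_univ _)
    intro v _ hv
    by_contra h; exact hv (mem_wsupp.2 h)
  rw [h1]
  refine (convex_convexHull ℝ _).sum_mem (fun v _ => hw.1 v) h2 (fun v hv => subset_convexHull ℝ _ ?_)
  simp only [Finset.coe_map, Set.mem_image, Finset.mem_coe]
  exact ⟨v, hv, rfl⟩

lemma RR_space {w : VT S → ℝ} (hw : w ∈ geom (abK S)) : RR S w ∈ S.space :=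
  SimplicialComplex.mem_space_iff.2 ⟨_, wsupp_face hw, RR_mem hw⟩

lemma weights_of_mem {s : Finset (Fin N → ℝ)} (hs : s ∈ S.faces) {x : Fin N → ℝ}
    (hx : x ∈ convexHull ℝ (s : Set (Fin N → ℝ))) :
    ∃ w : VT S → ℝ, w ∈ geom (abK S) ∧ (wsupp w).map (vemb S) ⊆ s ∧ RR S w = x := by
  classical
  rw [Finset.convexHull_eq, Set.mem_ofPred_eq] at hx
  obtain ⟨c, c0, c1, cx⟩ := hx
  have hvert : ∀ y ∈ s, {y} ∈ S.faces := fun y hy =>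
    S.down_closed hs (Finset.singleton_subset_iff.2 hy) (Finset.singleton_nonempty y)
  let w : VT S → ℝ := fun v => if v.1 ∈ s then c v.1 else 0
  let A : Finset (VT S) := Finset.univ.filter (fun v => v.1 ∈ s)
  have hAm : A.map (vemb S) = s := by
    ext y
    simp only [A, Finset.mem_map, Finset.mem_filter, Finset.mem_univ, true_and]
    constructor
    · rintro ⟨v, hv, rfl⟩; exact hv
    · intro hy; exact ⟨⟨y, hvert y hy⟩, hy, rfl⟩
  have hsub : wsupp w ⊆ A := by
    intro v hv
    rw [mem_wsupp] at hv
    simp only [A, Finset.mem_filter, Finset.mem_univ, true_and]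
    by_contra h
    exact hv (by simp only [w, if_neg h])
  have hsum : ∀ {M : Type} [AddCommMonoid M] (φ : (Fin N → ℝ) → M),
      ∑ v : VT S, (if v.1 ∈ s then φ v.1 else 0) = ∑ y ∈ s, φ y := by
    intro M _ φ
    rw [← Finset.sum_filter]
    conv_rhs => rw [← hAm, Finset.sum_map]
    rfl
  refine ⟨w, ⟨?_, ?_, ?_⟩, ?_, ?_⟩
  · intro v
    simp only [w]
    split_ifs with h
    · exact c0 _ h
    · exact le_rfl
  · rw [← c1]; exact hsum c
  · exact abK_lower S hsub (Or.inr (hAm.symm ▸ hs))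
  · rw [← hAm]; exact Finset.map_subset_map.2 hsub
  · rw [← cx, Finset.centerMass_eq_of_sum_1 _ _ c1, ← hsum, RR]
    refine Finset.sum_congr rfl (fun v _ => ?_)
    simp only [w]
    split_ifs <;> simp

lemma RR_unique {w w' : VT S → ℝ} {A : Finset (VT S)} (hA : A.map (vemb S) ∈ S.faces)
    (h1 : wsupp w ⊆ A) (h2 : wsupp w' ⊆ A) (hs : ∑ v, w v = ∑ v, w' v) (hR : RR S w = RR S w') : w = w' := by
  classical
  have hz : ∀ v ∉ A, w v - w' v = 0 := by
    intro v hv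
    have e1 : w v = 0 := by by_contra h; exact hv (h1 (mem_wsupp.2 h))
    have e2 : w' v = 0 := by by_contra h; exact hv (h2 (mem_wsupp.2 h))
    rw [e1, e2, sub_zero]
  have hi := S.indep hA
  let em : A ↪ ↥((A.map (vemb S)) : Finset (Fin N → ℝ)) :=
    ⟨fun v => ⟨v.1.1, Finset.mem_map.2 ⟨v.1, v.2, rfl⟩⟩, fun a b hab => by
      apply Subtype.ext; apply Subtype.ext; exact congrArg (fun x => x.1) hab⟩
  have hi2 := hi.comp_embedding em
  have := (affineIndependent_iff (k := ℝ)).1 hi2 Finset.univ (fun v => w v.1 - w' v.1) ?_ ?_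
  · funext v
    by_cases hv : v ∈ A
    · exact sub_eq_zero.1 (this ⟨v, hv⟩ (Finset.mem_univ _))
    · exact sub_eq_zero.1 (hz v hv)
  · rw [Finset.sum_coe_sort A (fun v => w v - w' v), Finset.sum_subset (Finset.subset_univ A) (fun v _ hv => hz v hv),
      Finset.sum_sub_distrib, hs, sub_self]
  · show ∑ v : A, (w v.1 - w' v.1) • v.1.1 = 0
    rw [Finset.sum_coe_sort A (fun v => (w v - w' v) • v.1),
      Finset.sum_subset (Finset.subset_univ A) (fun v _ hv => by rw [hz v hv, zero_smul])]
    simp only [sub_smul]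
    rw [Finset.sum_sub_distrib]
    exact sub_eq_zero.2 hR

lemma RR_inj {w w' : VT S → ℝ} (hw : w ∈ geom (abK S)) (hw' : w' ∈ geom (abK S)) (h : RR S w = RR S w') :
    w = w' := by
  classical
  have hx1 := RR_mem hw
  have hx2 := RR_mem hw'
  rw [← h] at hx2
  have hx := S.inter_subset_convexHull (wsupp_face hw) (wsupp_face hw') ⟨hx1, hx2⟩
  rw [← Finset.coe_inter, ← Finset.map_inter] at hx
  have hne : (wsupp w ∩ wsupp w').Nonempty := by
    rw [Finset.nonempty_iff_ne_empty]
    intro he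
    rw [he] at hx
    simp at hx
  have hface : (wsupp w ∩ wsupp w').map (vemb S) ∈ S.faces :=
    S.down_closed (wsupp_face hw) (Finset.map_subset_map.2 Finset.inter_subset_left) (Finset.map_nonempty.2 hne)
  obtain ⟨c, hc, hcs, hcR⟩ := weights_of_mem hface hx
  rw [Finset.map_subset_map] at hcs
  have e1 : c = w := RR_unique (wsupp_face hw) (hcs.trans Finset.inter_subset_left) subset_rfl
    (hc.2.1.trans hw.2.1.symm) hcR
  have e2 : c = w' := RR_unique (wsupp_face hw') (hcs.trans Finset.inter_subset_right) subset_rfl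
    (hc.2.1.trans hw'.2.1.symm) (hcR.trans h)
  exact e1.symm.trans e2

/-- the realization homeomorphism -/
lemma exists_homeo : ∃ Φ : ↥(geom (abK S)) ≃ₜ ↥S.space, ∀ w, (Φ w : Fin N → ℝ) = RR S w.1 := by
  classical
  let F : ↥(geom (abK S)) → ↥S.space := fun w => ⟨RR S w.1, RR_space w.2⟩
  have hb : Function.Bijective F := by
    constructor
    · intro a b hab
      exact Subtype.ext (RR_inj a.2 b.2 (congrArg Subtype.val hab))
    · intro x
      obtain ⟨s, hs, hx⟩ := SimplicialComplex.mem_space_iff.1 x.2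
      obtain ⟨w, hw, _, hR⟩ := weights_of_mem hs hx
      exact ⟨⟨w, hw⟩, Subtype.ext hR⟩
  have hc : Continuous F := by
    refine Continuous.subtype_mk ?_ _
    unfold RR
    exact continuous_finsetSum _ (fun v _ =>
      ((continuous_apply v).comp continuous_subtype_val).smul continuous_const)
  have : CompactSpace ↥(geom (abK S)) := isCompact_iff_compactSpace.1 (geom_compact (abK_lower S))
  exact ⟨Continuous.homeoOfEquivCompactToT2 (f := Equiv.ofBijective F hb) hc, fun w => rfl⟩

end geo

end Tvb

/-- **Tverberg theorem for simplicial spheres.** If `S` is a finite simplicial complex in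
`ℝ^N` whose realization is homeomorphic to the sphere of dimension `(d+1)(r-1)-1` (the
unit sphere in `ℝ^{(d+1)(r-1)}`) and `r` is a prime power, then any continuous map
`f : |S| → ℝ^d` identifies points from `r` pairwise disjoint faces. -/
theorem tverberg_for_simplicial_spheres {N d r : ℕ} (hd : 1 ≤ d) (hr : IsPrimePow r)
    (S : SimplicialComplex ℝ (Fin N → ℝ)) (hfin : S.faces.Finite)
    (hsphere : Nonempty
      (↥S.space ≃ₜ Metric.sphere (0 : EuclideanSpace ℝ (Fin ((d + 1) * (r - 1)))) 1))
    (f : C(↥S.space, Fin d → ℝ)) :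
    ∃ σ : Fin r → Finset (Fin N → ℝ),
      (∀ j, σ j ∈ S.faces) ∧ (∀ j l, j ≠ l → Disjoint (σ j) (σ l)) ∧
      (⋂ j, f '' {x : ↥S.space |
        (x : Fin N → ℝ) ∈ convexHull ℝ ((σ j : Set (Fin N → ℝ)))}).Nonempty := by
  classical
  have hVfin : Finite (Tvb.VT S) :=
    (hfin.preimage (f := fun x : Fin N → ℝ => ({x} : Finset (Fin N → ℝ)))
      (fun a _ b _ hab => Finset.singleton_injective hab)).to_subtype
  have : Fintype (Tvb.VT S) := Fintype.ofFinite _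
  obtain ⟨Ψ⟩ := hsphere
  obtain ⟨Φ, hΦ⟩ := Tvb.exists_homeo (S := S)
  have hr1 : 1 < r := hr.one_lt
  have hn : 0 < (d + 1) * (r - 1) := Nat.mul_pos (by omega) (by omega)
  let T : ↥(Tvb.geom (Tvb.abK S)) ≃ₜ Metric.sphere (0 : EuclideanSpace ℝ (Fin ((d + 1) * (r - 1)))) 1 :=
    Φ.trans Ψ
  let x0 : Metric.sphere (0 : EuclideanSpace ℝ (Fin ((d + 1) * (r - 1)))) 1 :=
    ⟨EuclideanSpace.single ⟨0, hn⟩ 1, by simp⟩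
  have hVne : Nonempty (Tvb.VT S) := ⟨(Tvb.wsupp_ne (T.symm x0).2).choose⟩
  let h : (Tvb.VT S → ℝ) → EuclideanSpace ℝ (Fin ((d + 1) * (r - 1))) :=
    fun w => if hw : w ∈ Tvb.geom (Tvb.abK S) then (T ⟨w, hw⟩).1 else 0
  let g : EuclideanSpace ℝ (Fin ((d + 1) * (r - 1))) → Tvb.VT S → ℝ :=
    fun x => if hx : x ∈ Metric.sphere (0 : EuclideanSpace ℝ (Fin ((d + 1) * (r - 1)))) 1 then
      (T.symm ⟨x, hx⟩).1 else 0
  let f' : (Tvb.VT S → ℝ) → Fin d → ℝ :=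
    fun w => if hw : w ∈ Tvb.geom (Tvb.abK S) then f (Φ ⟨w, hw⟩) else 0
  have h_eq : ∀ w (hw : w ∈ Tvb.geom (Tvb.abK S)), h w = (T ⟨w, hw⟩).1 := fun w hw => dif_pos hw
  have g_eq : ∀ x (hx : x ∈ Metric.sphere (0 : EuclideanSpace ℝ (Fin ((d + 1) * (r - 1)))) 1),
      g x = (T.symm ⟨x, hx⟩).1 := fun x hx => dif_pos hx
  have f_eq : ∀ w (hw : w ∈ Tvb.geom (Tvb.abK S)), f' w = f (Φ ⟨w, hw⟩) := fun w hw => dif_pos hw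
  have hmem : ∀ x : EuclideanSpace ℝ (Fin ((d + 1) * (r - 1))), ‖x‖ = 1 → x ∈ Metric.sphere 0 1 :=
    fun x hx => by simpa using hx
  have hsn : ∀ x : Metric.sphere (0 : EuclideanSpace ℝ (Fin ((d + 1) * (r - 1)))) 1, ‖x.1‖ = 1 :=
    fun x => by simpa using x.2
  obtain ⟨u, u1, u2, u3⟩ := Tvb.main_abs hr (Tvb.abK_lower S) (Or.inl rfl) h g
    (by
      rw [continuousOn_iff_continuous_domRestrict]
      have : (Tvb.geom (Tvb.abK S)).domRestrict h = fun w => (T w).1 := by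
        funext w; exact h_eq w.1 w.2
      rw [this]
      exact continuous_subtype_val.comp T.continuous)
    (by
      rw [continuousOn_iff_continuous_domRestrict]
      have : (Metric.sphere (0 : EuclideanSpace ℝ (Fin ((d + 1) * (r - 1)))) 1).domRestrict g =
          fun w => (T.symm w).1 := by
        funext w; exact g_eq w.1 w.2
      rw [this]
      exact continuous_subtype_val.comp T.symm.continuous)
    (fun w hw => by rw [h_eq w hw]; exact hsn _)
    (fun x hx => by rw [g_eq x (hmem x hx)]; exact (T.symm _).2)
    (fun w hw => by
      rw [h_eq w hw, g_eq _ (T ⟨w, hw⟩).2]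
      simp)
    (fun x hx => by
      rw [g_eq x (hmem x hx), h_eq _ (T.symm ⟨x, hmem x hx⟩).2]
      simp)
    (f := f')
    (by
      rw [continuousOn_iff_continuous_domRestrict]
      have : (Tvb.geom (Tvb.abK S)).domRestrict f' = fun w => f (Φ w) := by
        funext w; exact f_eq w.1 w.2
      rw [this]
      exact f.continuous.comp Φ.continuous)
  refine ⟨fun j => (Tvb.wsupp (u j)).map (Tvb.vemb S), fun j => Tvb.wsupp_face (u1 j), fun j l hjl => ?_,
    f' (u ⟨0, by omega⟩), ?_⟩
  · exact (Finset.disjoint_map _).2 (u2 j l hjl)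
  · rw [Set.mem_iInter]
    intro j
    refine ⟨Φ ⟨u j, u1 j⟩, ?_, ?_⟩
    · rw [Set.mem_ofPred_eq, hΦ]
      exact Tvb.RR_mem (u1 j)
    · rw [u3 _ j, f_eq _ (u1 j)]
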